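/- Let ε > 0 be fixed, let A > 13 and δ > 0, let h ∈ 𝓗(A,δ), and let φ be an even Schwartz function with supp(φ̂) ⊂ (−15/8+ε, 15/8−ε). Then there is a constant C = C(ε,h,φ,A,δ) such that for every prime N one has Σ_{c ≡ 0 (mod N), c < N²} (1/(c·ϕ(c))) Σ_{d | c, d ≠ 1} d · Σ*_{χ mod d} | Σ_{n ≥ 1} (Λ(n) χ(n)/n^{1/2}) · φ̂(log n/log N) · H⁺(4π n^{1/2}/c) · (1/log N) | ≤ C · N^{−ε/10}. (The inner sum over n is finite since φ̂(log n/log N) vanishes for n ≥ N^{15/8}, and then 4π n^{1/2}/c ∈ (0,4π) since c ≥ N, so H⁺ is only evaluated where its defining integral converges.) -/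

import Mathlib

open MeasureTheory Real Complex
/-- The Bessel function of the first kind `J_ν(x)`, for `x > 0`, defined via its power series,
where `(x/2)^w := exp (w * log (x/2))` with the real logarithm. -/
noncomputable def besselJ (ν : ℂ) (x : ℝ) : ℂ :=
  ∑' m : ℕ, ((-1) ^ m / ((Nat.factorial m : ℂ) * Complex.Gamma (m + ν + 1))) *
    Complex.exp ((2 * m + ν) * Real.log (x / 2))

/-- The integral transform `H⁺(x) = (2i/π) ∫_ℝ h(t) J_{2it}(x) t / cosh(πt) dt`. -/
noncomputable def Hplus (h : ℝ → ℝ) (x : ℝ) : ℂ :=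
  (2 * Complex.I / (π : ℂ)) *
    ∫ t : ℝ, (h t : ℂ) * besselJ (2 * Complex.I * t) x * ((t : ℂ) / (Real.cosh (π * t) : ℂ))

/-- `h : ℝ → ℝ` belongs to the class `𝓗(A, δ)`, witnessed by the holomorphic extension
`H : ℂ → ℂ` to the strip `{s : |Im s| ≤ A}`. -/
structure IsInHClass (A δ : ℝ) (h : ℝ → ℝ) (H : ℂ → ℂ) : Prop where
  nonneg : ∀ t : ℝ, 0 ≤ h t
  even : ∀ t : ℝ, h (-t) = h t
  not_zero : ∃ t : ℝ, h t ≠ 0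
  extends_h : ∀ t : ℝ, H (t : ℂ) = (h t : ℂ)
  even_ext : ∀ s : ℂ, H (-s) = H s
  holo : DifferentiableOn ℂ H {s : ℂ | |s.im| ≤ A}
  bound : ∃ C : ℝ, ∀ s : ℂ, |s.im| ≤ A → ‖H s‖ ≤ C * (1 + ‖s‖) ^ (-(2 + δ))

/-- The Fourier transform `φ̂(ξ) = ∫_ℝ φ(x) e^{-2πixξ} dx` of a real-valued function. -/
noncomputable def fourierHat (φ : ℝ → ℝ) (ξ : ℝ) : ℂ :=
  ∫ x : ℝ, (φ x : ℂ) * Complex.exp (-2 * π * Complex.I * x * ξ)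

/-- The sum of `f` over all primitive Dirichlet characters modulo `d`
(a finite sum, since there are finitely many Dirichlet characters modulo `d`). -/
noncomputable def sumPrimitive (d : ℕ) (f : DirichletCharacter ℂ d → ℝ) : ℝ :=
  ∑ᶠ χ ∈ {χ : DirichletCharacter ℂ d | χ.IsPrimitive}, f χ


open MeasureTheory Real Complex

namespace PSB

/-- Divisor bound. -/
lemma divisor_bound (η : ℝ) (hη : 0 < η) :
    ∃ C : ℝ, 1 ≤ C ∧ ∀ n : ℕ, n ≠ 0 → (n.divisors.card : ℝ) ≤ C * (n : ℝ) ^ η := by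
  obtain ⟨P, hP⟩ : ∃ P : ℕ, 1 ≤ P ∧ (2 : ℝ) ≤ (P : ℝ) ^ η := by
    have := (tendsto_rpow_atTop hη).comp (tendsto_natCast_atTop_atTop (R := ℝ))
    obtain ⟨P, h1, h2⟩ := ((this.eventually_ge_atTop 2).and (Filter.eventually_ge_atTop 1)).exists
    exact ⟨P, h2, h1⟩
  set K : ℝ := max 1 (1 / (η * Real.log 2)) with hK
  have hl2 : 0 < Real.log 2 := Real.log_pos (by norm_num)
  have hK1 : 1 ≤ K := le_max_left _ _
  have hKa : ∀ a : ℕ, ∀ p : ℕ, 2 ≤ p → (a + 1 : ℝ) ≤ K * ((p : ℝ) ^ a) ^ η := by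
    intro a p hp
    have h1 : (1 : ℝ) + η * Real.log 2 * a ≤ ((p : ℝ) ^ a) ^ η := by
      have h2 : ((2 : ℝ) ^ a) ^ η ≤ ((p : ℝ) ^ a) ^ η := by
        gcongr
        exact_mod_cast hp
      refine le_trans ?_ h2
      rw [← Real.rpow_natCast, ← Real.rpow_mul (by norm_num), Real.rpow_def_of_pos (by norm_num)]
      have := Real.add_one_le_exp (Real.log 2 * (a * η))
      linarith
    have h3 : K * (1 + η * Real.log 2 * a) ≤ K * ((p : ℝ) ^ a) ^ η := by gcongr
    have h4 : 1 ≤ K * (η * Real.log 2) := by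
      have : 1 / (η * Real.log 2) ≤ K := le_max_right _ _
      rwa [div_le_iff₀ (by positivity)] at this
    nlinarith [Nat.cast_nonneg (α := ℝ) a]
  refine ⟨K ^ P, one_le_pow₀ hK1, fun n hn => ?_⟩
  rw [Nat.card_divisors hn]
  push_cast
  have hn' : (n : ℝ) ^ η = ∏ p ∈ n.primeFactors, ((p : ℝ) ^ (n.factorization p)) ^ η := by
    conv_lhs => rw [← Nat.prod_factorization_pow_eq_self hn]
    rw [Finsupp.prod, Nat.support_factorization]
    push_cast
    rw [Real.finsetProd_rpow _ _ (fun i _ => by positivity)]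
  have hKK : ∏ p ∈ n.primeFactors, (if p < P then K else 1) ≤ K ^ P := by
    rw [Finset.prod_ite, Finset.prod_const_one, mul_one, Finset.prod_const]
    refine pow_le_pow_right₀ hK1 ?_
    calc _ ≤ (Finset.range P).card := Finset.card_le_card (by
          intro p; simp)
      _ = P := by simp
  calc ∏ p ∈ n.primeFactors, ((n.factorization p : ℝ) + 1)
      ≤ ∏ p ∈ n.primeFactors, ((if p < P then K else 1) * ((p : ℝ) ^ (n.factorization p)) ^ η) := by
        refine Finset.prod_le_prod (fun i _ => by positivity) (fun p hp => ?_)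
        have hp' := Nat.prime_of_mem_primeFactors hp
        split_ifs with h
        · exact hKa _ _ hp'.two_le
        · rw [one_mul, ← Real.rpow_natCast, ← Real.rpow_mul (by positivity), mul_comm (_ : ℝ) η,
            Real.rpow_mul (by positivity), Real.rpow_natCast]
          have h5 : (2 : ℝ) ≤ (p : ℝ) ^ η := hP.2.trans (by
            gcongr; omega)
          calc ((n.factorization p : ℝ) + 1) ≤ 2 ^ (n.factorization p) := by
                exact_mod_cast (Nat.lt_two_pow_self (n := n.factorization p))
            _ ≤ _ := by gcongr
    _ = (∏ p ∈ n.primeFactors, (if p < P then K else 1)) * (n : ℝ) ^ η := by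
        rw [Finset.prod_mul_distrib, hn']
    _ ≤ K ^ P * (n : ℝ) ^ η := by gcongr

/-- Parseval for Dirichlet characters. -/
lemma parseval_char (d : ℕ) [NeZero d] (A : ZMod d → ℂ) :
    ∑ χ : DirichletCharacter ℂ d, ‖∑ r, A r * χ r‖ ^ 2 ≤ (d.totient : ℝ) * ∑ r, ‖A r‖ ^ 2 := by
  classical
  have hstar : ∀ (r r' : ZMod d), ∑ χ : DirichletCharacter ℂ d, starRingEnd ℂ (χ r) * χ r' =
      if IsUnit r ∧ r = r' then (d.totient : ℂ) else 0 := by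
    intro r r'
    by_cases hr : IsUnit r
    · have := DirichletCharacter.sum_char_inv_mul_char_eq ℂ hr r'
      simp only [hr, true_and]
      rw [← this]
      refine Finset.sum_congr rfl fun χ _ => ?_
      congr 1
      have h1 := MulChar.star_apply' χ r
      rw [RCLike.star_def] at h1
      rw [h1]
      obtain ⟨u, rfl⟩ := hr
      rw [MulChar.inv_apply, Ring.inverse_unit, ZMod.inv_coe_unit]
    · simp only [hr, false_and, if_false]
      refine Finset.sum_eq_zero fun χ _ => ?_
      rw [MulChar.map_nonunit χ hr]; simp
  have key : ∀ χ : DirichletCharacter ℂ d, ((‖∑ r, A r * χ r‖ ^ 2 : ℝ) : ℂ) =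
      ∑ r, ∑ r', (starRingEnd ℂ (A r) * A r') * (starRingEnd ℂ (χ r) * χ r') := by
    intro χ
    rw [← Complex.normSq_eq_norm_sq, Complex.normSq_eq_conj_mul_self, map_sum, Finset.sum_mul_sum]
    refine Finset.sum_congr rfl fun r _ => Finset.sum_congr rfl fun r' _ => ?_
    rw [map_mul]
    ring
  have h2 : ((∑ χ : DirichletCharacter ℂ d, ‖∑ r, A r * χ r‖ ^ 2 : ℝ) : ℂ) =
      ((∑ r, if IsUnit r then (d.totient : ℝ) * ‖A r‖ ^ 2 else 0 : ℝ) : ℂ) := by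
    rw [Complex.ofReal_sum]
    simp_rw [key]
    rw [Finset.sum_comm]
    rw [Complex.ofReal_sum]
    refine Finset.sum_congr rfl fun r _ => ?_
    rw [Finset.sum_comm]
    simp_rw [← Finset.mul_sum, hstar]
    by_cases hr : IsUnit r
    · simp only [hr, true_and, mul_ite, mul_zero, Finset.sum_ite_eq, Finset.mem_univ, if_true]
      push_cast
      rw [← Complex.conj_mul']
      ring
    · simp [hr]
  rw [Complex.ofReal_inj] at h2
  rw [h2, Finset.mul_sum]
  refine Finset.sum_le_sum fun r _ => ?_
  split_ifs
  · exact le_rfl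
  · positivity

/-- Weighted second moment bound. -/
lemma second_moment_weighted (d : ℕ) [NeZero d] (M : ℕ) (a : ℕ → ℂ) (v : ℕ → ℝ) (hv : ∀ j, 0 < v j)
    (V : ℝ) (hV : ∑ j ∈ Finset.range (M / d + 1), v j ≤ V) :
    ∑ χ : DirichletCharacter ℂ d, ‖∑ n ∈ Finset.Icc 1 M, a n * χ n‖ ^ 2 ≤
      (d : ℝ) * (V * ∑ n ∈ Finset.Icc 1 M, ‖a n‖ ^ 2 / v (n / d)) := by
  classical
  set A : ZMod d → ℂ := fun r => ∑ n ∈ (Finset.Icc 1 M).filter (fun n : ℕ => (n : ZMod d) = r), a n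
  have h1 : ∀ χ : DirichletCharacter ℂ d,
      ∑ n ∈ Finset.Icc 1 M, a n * χ n = ∑ r, A r * χ r := by
    intro χ
    rw [← Finset.sum_fiberwise (Finset.Icc 1 M) (fun n : ℕ => (n : ZMod d))]
    refine Finset.sum_congr rfl fun r _ => ?_
    rw [Finset.sum_mul]
    refine Finset.sum_congr rfl fun n hn => ?_
    rw [(Finset.mem_filter.1 hn).2]
  simp_rw [h1]
  have hVnn : 0 ≤ V := le_trans (Finset.sum_nonneg fun j _ => (hv j).le) hV
  refine (parseval_char d A).trans ?_
  have h2 : ∀ r, ‖A r‖ ^ 2 ≤ V *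
      ∑ n ∈ (Finset.Icc 1 M).filter (fun n : ℕ => (n : ZMod d) = r), ‖a n‖ ^ 2 / v (n / d) := by
    intro r
    have hA : ‖A r‖ ≤ ∑ n ∈ (Finset.Icc 1 M).filter (fun n : ℕ => (n : ZMod d) = r), ‖a n‖ :=
      norm_sum_le _ _
    have hcs := Finset.sum_sq_le_sum_mul_sum_of_sq_le_mul
      ((Finset.Icc 1 M).filter (fun n : ℕ => (n : ZMod d) = r)) (r := fun n => ‖a n‖)
      (f := fun n => v (n / d)) (g := fun n => ‖a n‖ ^ 2 / v (n / d))
      (fun i _ => (hv _).le) (fun i _ => div_nonneg (by positivity) (hv _).le)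
      (fun i _ => by have := (hv (i / d)).ne'; field_simp; exact le_rfl)
    have hsum : ∑ n ∈ (Finset.Icc 1 M).filter (fun n : ℕ => (n : ZMod d) = r), v (n / d) ≤ V := by
      refine le_trans ?_ hV
      rw [← Finset.sum_image (s := (Finset.Icc 1 M).filter (fun n : ℕ => (n : ZMod d) = r))
        (g := fun n => n / d) (f := v)]
      · refine Finset.sum_le_sum_of_subset_of_nonneg ?_ (fun j _ _ => (hv j).le)
        intro j hj
        obtain ⟨n, hn, rfl⟩ := Finset.mem_image.1 hj
        simp only [Finset.mem_filter, Finset.mem_Icc] at hn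
        exact Finset.mem_range.2 (Nat.lt_succ_of_le (Nat.div_le_div_right hn.1.2))
      · intro n hn m hm hnm
        simp only [Finset.coe_filter, Set.mem_ofPred_eq] at hn hm
        have h3 : (n : ZMod d) = (m : ZMod d) := hn.2.trans hm.2.symm
        rw [ZMod.natCast_eq_natCast_iff] at h3
        have h4 : n % d = m % d := h3
        simp only at hnm
        rw [← Nat.div_add_mod n d, ← Nat.div_add_mod m d, h4, hnm]
    calc ‖A r‖ ^ 2 ≤ _ := pow_le_pow_left₀ (norm_nonneg _) hA 2
      _ ≤ _ := hcs
      _ ≤ _ := by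
        refine mul_le_mul_of_nonneg_right hsum (Finset.sum_nonneg fun i _ => ?_)
        exact div_nonneg (by positivity) (hv _).le
  have h3 : ∑ r, ‖A r‖ ^ 2 ≤ V * ∑ n ∈ Finset.Icc 1 M, ‖a n‖ ^ 2 / v (n / d) := by
    refine (Finset.sum_le_sum fun r _ => h2 r).trans ?_
    rw [← Finset.mul_sum, Finset.sum_fiberwise]
  have h4 : (d.totient : ℝ) ≤ d := by exact_mod_cast Nat.totient_le d
  calc _ ≤ (d.totient : ℝ) * (V * ∑ n ∈ Finset.Icc 1 M, ‖a n‖ ^ 2 / v (n / d)) := by gcongr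
    _ ≤ _ := by
      refine mul_le_mul_of_nonneg_right h4 (mul_nonneg hVnn (Finset.sum_nonneg fun i _ => ?_))
      exact div_nonneg (by positivity) (hv _).le

/-- Plain second moment bound. -/
lemma second_moment (d : ℕ) [NeZero d] (M : ℕ) (a : ℕ → ℂ) (B : ℝ)
    (hB : ∀ n ∈ Finset.Icc 1 M, ‖a n‖ ≤ B) :
    ∑ χ : DirichletCharacter ℂ d, ‖∑ n ∈ Finset.Icc 1 M, a n * χ n‖ ^ 2 ≤
      ((d : ℝ) + M) * (M * B ^ 2) := by
  have h := second_moment_weighted d M a (fun _ => 1) (fun _ => one_pos) ((M : ℝ) / d + 1) (by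
    simp only [Finset.sum_const, Finset.card_range, nsmul_eq_mul, mul_one]
    push_cast
    have : ((M / d : ℕ) : ℝ) ≤ (M : ℝ) / d := Nat.cast_div_le
    linarith)
  refine h.trans ?_
  have hd : (0 : ℝ) < d := by exact_mod_cast Nat.pos_of_ne_zero (NeZero.ne d)
  have h1 : ∑ n ∈ Finset.Icc 1 M, ‖a n‖ ^ 2 / 1 ≤ M * B ^ 2 := by
    calc _ ≤ ∑ n ∈ Finset.Icc 1 M, B ^ 2 := by
          refine Finset.sum_le_sum fun n hn => ?_
          rw [div_one]
          exact pow_le_pow_left₀ (norm_nonneg _) (hB n hn) 2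
      _ = _ := by simp
  calc (d : ℝ) * (((M : ℝ) / d + 1) * ∑ n ∈ Finset.Icc 1 M, ‖a n‖ ^ 2 / 1)
      ≤ (d : ℝ) * (((M : ℝ) / d + 1) * (M * B ^ 2)) := by gcongr
    _ = _ := by field_simp; ring

/-- Weighted second moment with quadratic weights. -/
lemma second_moment_quad (d : ℕ) [NeZero d] (M : ℕ) (a : ℕ → ℂ) :
    ∑ χ : DirichletCharacter ℂ d, ‖∑ n ∈ Finset.Icc 1 M, a n * χ n‖ ^ 2 ≤
      (d : ℝ) * (3 * ∑ n ∈ Finset.Icc 1 M, ‖a n‖ ^ 2 * (1 + ((n : ℝ) / d) ^ 2)) := by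
  have hd : (0 : ℝ) < d := by exact_mod_cast Nat.pos_of_ne_zero (NeZero.ne d)
  have h := second_moment_weighted d M a (fun j => 1 / (1 + (j : ℝ) ^ 2))
    (fun j => by positivity) 3 (by
      have : ∀ m : ℕ, ∑ j ∈ Finset.range (m + 1), 1 / (1 + (j : ℝ) ^ 2) ≤ (3 : ℝ) - 2 / ((m : ℝ) + 1) := by
        intro m
        induction m with
        | zero => norm_num
        | succ k ih =>
          rw [Finset.sum_range_succ]
          push_cast
          have : 1 / (1 + ((k : ℝ) + 1) ^ 2) ≤ 2 / ((k : ℝ) + 1) - 2 / ((k : ℝ) + 1 + 1) := by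
            rw [div_sub_div _ _ (by positivity) (by positivity), div_le_div_iff₀ (by positivity) (by positivity)]
            nlinarith [Nat.cast_nonneg (α := ℝ) k]
          linarith
      refine (this _).trans ?_
      have : (0 : ℝ) ≤ 2 / (((M / d : ℕ) : ℝ) + 1) := by positivity
      linarith)
  refine h.trans ?_
  gcongr with n hn
  rw [div_div_eq_mul_div, div_one]
  gcongr
  exact Nat.cast_div_le

end PSB

open MeasureTheory Real Complex
open scoped FourierTransform
namespace PSB

lemma prim_inv {d : ℕ} {χ : DirichletCharacter ℂ d} (h : χ.IsPrimitive) : (χ⁻¹).IsPrimitive := by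
  rw [DirichletCharacter.isPrimitive_def] at *
  rw [DirichletCharacter.conductor_inv, h]

lemma gauss_norm_sq (d : ℕ) [NeZero d] (χ : DirichletCharacter ℂ d) (h : χ.IsPrimitive) :
    ‖gaussSum χ ZMod.stdAddChar‖ ^ 2 = d := by
  have h1 := congrFun (ZMod.dft_dft (χ : ZMod d → ℂ)) (-1)
  have h2 : ZMod.dft (χ : ZMod d → ℂ) = (gaussSum χ ZMod.stdAddChar * χ⁻¹ (-1)) • ⇑(χ⁻¹) := by
    funext k
    rw [h.fourierTransform_eq_inv_mul_gaussSum, ← neg_one_mul k, map_mul]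
    simp only [Pi.smul_apply, smul_eq_mul]; ring
  rw [h2, map_smul] at h1
  simp only [Pi.smul_apply, smul_eq_mul, (prim_inv h).fourierTransform_eq_inv_mul_gaussSum, neg_neg,
    map_one, one_mul, mul_one] at h1
  have h3 : χ⁻¹ (-1) * star (gaussSum χ ZMod.stdAddChar) = gaussSum χ⁻¹ ZMod.stdAddChar := by
    rw [star_gaussSum_eq, AddChar.inv_mulShift, ← Units.coe_neg_one]
    exact gaussSum_mulShift _ _ (-1)
  have h6 : χ⁻¹ (-1) * χ⁻¹ (-1) = 1 := by rw [← map_mul]; simp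
  have h4 : (gaussSum χ ZMod.stdAddChar) * star (gaussSum χ ZMod.stdAddChar) = d := by
    rw [← h3] at h1
    rw [← h1]
    linear_combination (-(gaussSum χ ZMod.stdAddChar) * star (gaussSum χ ZMod.stdAddChar)) * h6
  have h5 : ((‖gaussSum χ ZMod.stdAddChar‖ ^ 2 : ℝ) : ℂ) = (d : ℂ) := by
    rw [← h4, Complex.star_def, Complex.mul_conj, Complex.normSq_eq_norm_sq]
  exact_mod_cast h5

lemma sum_fin_zmod (d : ℕ) [NeZero d] (f : ZMod d → ℂ) :
    ∑ r : Fin d, f ((r : ℕ) : ZMod d) = ∑ r, f r := by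
  obtain ⟨e, rfl⟩ : ∃ e, d = e + 1 := ⟨d - 1, by have := NeZero.pos d; omega⟩
  refine Finset.sum_congr rfl fun r _ => ?_
  congr 1
  exact Fin.cast_val_eq_self r

lemma poisson_char (d : ℕ) [NeZero d] (χ : DirichletCharacter ℂ d) (h : χ.IsPrimitive)
    (F : SchwartzMap ℝ ℂ) (hs : Summable (fun n : ℤ => χ (n : ZMod d) * F ((n : ℝ) / d)))
    (hs2 : Summable (fun k : ℤ => (𝓕 F) (k : ℝ))) :
    ∑' n : ℤ, χ (n : ZMod d) * F ((n : ℝ) / d) =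
      gaussSum χ ZMod.stdAddChar * ∑' k : ℤ, χ⁻¹ (k : ZMod d) * (𝓕 F) (k : ℝ) := by
  have hd : (d : ℝ) ≠ 0 := by exact_mod_cast NeZero.ne d
  let e : Fin d × ℤ ≃ ℤ := (Equiv.prodComm _ _).trans (Int.divModEquiv d).symm
  have he : ∀ p : Fin d × ℤ, e p = p.2 * d + (p.1 : ℕ) := fun p => rfl
  have hs' : Summable (fun p : Fin d × ℤ => χ ((e p : ℤ) : ZMod d) * F (((e p : ℤ) : ℝ) / d)) :=
    (e.summable_iff (f := fun n : ℤ => χ (n : ZMod d) * F ((n : ℝ) / d))).mpr hs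
  rw [← e.tsum_eq, hs'.tsum_prod, tsum_fintype]
  have h1 : ∀ r : Fin d, ∑' m : ℤ, χ ((e (r, m) : ℤ) : ZMod d) * F (((e (r, m) : ℤ) : ℝ) / d)
      = ∑' k : ℤ, χ ((r : ℕ) : ZMod d) * ((𝓕 F) (k : ℝ) * ZMod.stdAddChar ((k : ZMod d) * ((r : ℕ) : ZMod d))) := by
    intro r
    rw [tsum_mul_left]
    have : ∀ m : ℤ, χ ((e (r, m) : ℤ) : ZMod d) * F (((e (r, m) : ℤ) : ℝ) / d) =
        χ ((r : ℕ) : ZMod d) * F (((r : ℕ) : ℝ) / d + m) := by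
      intro m
      rw [he]; push_cast
      congr 2
      · simp
      · field_simp; ring
    simp_rw [this]
    rw [tsum_mul_left, SchwartzMap.tsum_eq_tsum_fourier]
    congr 1
    refine tsum_congr fun k => ?_
    congr 1
    rw [fourier_coe_apply]
    have : (k : ZMod d) * ((r : ℕ) : ZMod d) = ((k * (r : ℕ) : ℤ) : ZMod d) := by push_cast; rfl
    rw [this, ZMod.stdAddChar_coe]
    congr 1
    push_cast
    field_simp
  simp_rw [h1]
  rw [← Summable.tsum_finsetSum, ← tsum_mul_left]
  · refine tsum_congr fun k => ?_
    have h3 := gaussSum_mulShift_of_isPrimitive ZMod.stdAddChar h (k : ZMod d)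
    rw [gaussSum] at h3
    have h4 : ∑ r : Fin d, χ ((r : ℕ) : ZMod d) * ((𝓕 F) (k : ℝ) * ZMod.stdAddChar ((k : ZMod d) * ((r : ℕ) : ZMod d)))
      = (𝓕 F) (k : ℝ) * ∑ r : ZMod d, χ r * (ZMod.stdAddChar.mulShift (k : ZMod d)) r := by
      rw [Finset.mul_sum]
      rw [← sum_fin_zmod d]
      refine Finset.sum_congr rfl fun r _ => ?_
      rw [AddChar.mulShift_apply]; ring
    rw [h4, h3]; ring
  · intro r _
    refine Summable.mul_left _ ?_
    refine Summable.of_norm ?_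
    convert hs2.norm using 2 with k
    rw [norm_mul]
    rw [ZMod.stdAddChar_apply, Circle.norm_coe, mul_one]
end PSB

open MeasureTheory Real Complex
namespace PSB

lemma poly_mul (d : ℕ) (M M' : ℕ) (a b : ℕ → ℂ) (G : ℕ → ℝ) 
    (hG : ∀ k ∈ Finset.Icc 1 M, ∀ l ∈ Finset.Icc 1 M', ‖a k‖ * ‖b l‖ ≤ G (k * l)) (hG0 : ∀ n, 0 ≤ G n) :
    ∃ c : ℕ → ℂ, (∀ n, ‖c n‖ ≤ n.divisors.card * G n) ∧ ∀ χ : DirichletCharacter ℂ d,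
      (∑ k ∈ Finset.Icc 1 M, a k * χ k) * (∑ l ∈ Finset.Icc 1 M', b l * χ l) =
        ∑ n ∈ Finset.Icc 1 (M * M'), c n * χ n := by
  refine ⟨fun n => ∑ p ∈ (Finset.Icc 1 M ×ˢ Finset.Icc 1 M').filter (fun p => p.1 * p.2 = n), a p.1 * b p.2,
    fun n => ?_, fun χ => ?_⟩
  · refine (norm_sum_le_of_le (f := fun p : ℕ × ℕ => a p.1 * b p.2) _ (n := fun _ => G n) fun p hp => ?_).trans ?_
    · simp only [Finset.mem_filter, Finset.mem_product] at hp
      rw [norm_mul, ← hp.2]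
      exact hG _ hp.1.1 _ hp.1.2
    · rw [Finset.sum_const, nsmul_eq_mul]
      refine mul_le_mul_of_nonneg_right ?_ (hG0 n)
      norm_cast
      refine Finset.card_le_card_of_injOn Prod.fst ?_ ?_
      · intro p hp
        simp only [Finset.coe_filter, Finset.mem_product, Finset.mem_Icc, Set.mem_ofPred_eq] at hp
        simp only [Finset.mem_coe, Nat.mem_divisors]
        refine ⟨⟨p.2, hp.2.symm⟩, ?_⟩
        rw [← hp.2]
        have := hp.1.1.1
        have := hp.1.2.1
        positivity
      · intro p hp q hq h
        simp only [Finset.coe_filter, Finset.mem_product, Finset.mem_Icc, Set.mem_ofPred_eq] at hp hq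
        have h1 : p.1 * p.2 = q.1 * q.2 := hp.2.trans hq.2.symm
        change p.1 = q.1 at h
        rw [← h] at h1
        exact Prod.ext h (Nat.eq_of_mul_eq_mul_left hp.1.1.1 h1)
  · rw [Finset.sum_mul_sum, ← Finset.sum_product', ← Finset.sum_fiberwise_of_maps_to (t := Finset.Icc 1 (M * M')) (g := fun p => p.1 * p.2)]
    · refine Finset.sum_congr rfl fun n _ => ?_
      rw [Finset.sum_mul]
      refine Finset.sum_congr rfl fun p hp => ?_
      rw [← (Finset.mem_filter.mp hp).2]
      push_cast
      rw [map_mul]; ring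
    · intro p hp
      simp only [Finset.mem_product, Finset.mem_Icc] at hp ⊢
      exact ⟨Nat.mul_pos hp.1.1 hp.2.1, Nat.mul_le_mul hp.1.2 hp.2.2⟩

lemma four_aux (η Y : ℝ) (hη0 : 0 < η) (hη : η ≤ 1 / 2) (hY : 0 < Y) (q g : ℝ) (hq0 : 0 ≤ q)
    (hq : q ≤ 4 / Y) (hg0 : 0 ≤ g) (hg1 : g ≤ 1) (hgY : g ≤ Y ^ 2) : g ^ 2 * (1 + q ^ 2) ≤ 17 * Y ^ (1 + 2 * η) := by
  have hq2 : q ^ 2 ≤ 16 / Y ^ 2 := by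
    calc q ^ 2 ≤ (4 / Y) ^ 2 := by gcongr
      _ = _ := by rw [div_pow]; norm_num
  rcases le_total Y 1 with h | h
  · have h1 : Y ^ (2 : ℝ) ≤ Y ^ (1 + 2 * η) := Real.rpow_le_rpow_of_exponent_ge hY h (by linarith)
    rw [Real.rpow_two] at h1
    have h2 : g ^ 2 * (1 + q ^ 2) ≤ (Y ^ 2) ^ 2 * (1 + 16 / Y ^ 2) := by gcongr
    have h3 : (Y ^ 2) ^ 2 * (1 + 16 / Y ^ 2) = Y ^ 4 + 16 * Y ^ 2 := by field_simp
    have h4 : Y ^ 4 ≤ Y ^ 2 := pow_le_pow_of_le_one hY.le h (by norm_num)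
    linarith
  · have h1 : (1 : ℝ) ≤ Y ^ (1 + 2 * η) := Real.one_le_rpow h (by linarith)
    have h2 : (16 : ℝ) / Y ^ 2 ≤ 16 := by
      apply div_le_self (by norm_num); exact one_le_pow₀ h
    have h3 : g ^ 2 * (1 + q ^ 2) ≤ 1 ^ 2 * (1 + 16) := by gcongr; linarith
    linarith

lemma four0 (η : ℝ) (hη0 : 0 < η) (hη : η ≤ 1 / 2) : ∃ C : ℝ, 0 ≤ C ∧ ∀ (d : ℕ) [NeZero d] (K : ℝ), 0 < K →
    K ^ 2 ≤ 4 * d → ∀ b : ℕ → ℂ, (∀ k : ℕ, 1 ≤ k → ‖b k‖ ≤ 1 ∧ ‖b k‖ ≤ (K / k) ^ 2) → ∀ M : ℕ,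
    ∑ χ : DirichletCharacter ℂ d, ‖∑ k ∈ Finset.Icc 1 M, b k * χ k‖ ^ 4 ≤
      C * (d : ℝ) ^ (1 + 2 * η) * K ^ 2 := by
  obtain ⟨C, hC1, hC⟩ := divisor_bound (η / 2) (by linarith)
  have hS : Summable (fun n : ℕ => (n : ℝ) ^ (-(1 + η))) :=
    Real.summable_nat_rpow.mpr (by linarith)
  set S := ∑' n : ℕ, (n : ℝ) ^ (-(1 + η)) with hSdef
  have hS0 : 0 ≤ S := tsum_nonneg fun n => by positivity
  refine ⟨3 * (C ^ 2 * 17 * 4 * S), by positivity, fun d _ K hK hKd b hb M => ?_⟩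
  have hd : (0 : ℝ) < d := by exact_mod_cast NeZero.pos d
  obtain ⟨c, hc, hcs⟩ := poly_mul d M M b b (fun n => min 1 ((K ^ 2 / n) ^ 2)) (by
    intro k hk l hl
    have hk1 := (Finset.mem_Icc.mp hk).1
    have hl1 := (Finset.mem_Icc.mp hl).1
    refine le_min ?_ ?_
    · exact mul_le_one₀ (hb k hk1).1 (norm_nonneg _) (hb l hl1).1
    · refine (mul_le_mul (hb k hk1).2 (hb l hl1).2 (norm_nonneg _) (by positivity)).trans (le_of_eq ?_)
      push_cast; rw [← mul_pow]; congr 1; rw [div_mul_div_comm]; ring) (by intro n; positivity)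
  have h1 : ∀ χ : DirichletCharacter ℂ d, ‖∑ k ∈ Finset.Icc 1 M, b k * χ k‖ ^ 4 =
      ‖∑ n ∈ Finset.Icc 1 (M * M), c n * χ n‖ ^ 2 := by
    intro χ; rw [← hcs χ, norm_mul]; ring
  simp_rw [h1]
  refine (second_moment_quad d (M * M) c).trans ?_
  have hterm : ∀ n ∈ Finset.Icc 1 (M * M), ‖c n‖ ^ 2 * (1 + ((n : ℝ) / d) ^ 2) ≤
      (C ^ 2 * 17 * 4 * (d : ℝ) ^ (2 * η) * K ^ 2) * (n : ℝ) ^ (-(1 + η)) := by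
    intro n hn
    have hn1 := (Finset.mem_Icc.mp hn).1
    have hn0 : (0 : ℝ) < n := by exact_mod_cast hn1
    have hτ := hC n (by omega)
    have hY : 0 < K ^ 2 / n := by positivity
    have h2 := four_aux η (K ^ 2 / n) hη0 hη hY ((n : ℝ) / d) (min 1 ((K ^ 2 / n) ^ 2)) (by positivity)
      (by rw [div_div_eq_mul_div, div_le_div_iff₀ hd (by positivity)]; nlinarith) (by positivity) (min_le_left _ _)
      (min_le_right _ _)
    calc ‖c n‖ ^ 2 * (1 + ((n : ℝ) / d) ^ 2)
        ≤ (C * (n : ℝ) ^ (η / 2) * min 1 ((K ^ 2 / n) ^ 2)) ^ 2 * (1 + ((n : ℝ) / d) ^ 2) := by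
          gcongr
          exact (hc n).trans (by gcongr)
      _ = C ^ 2 * ((n : ℝ) ^ (η / 2)) ^ 2 * (min 1 ((K ^ 2 / n) ^ 2) ^ 2 * (1 + ((n : ℝ) / d) ^ 2)) := by ring
      _ ≤ C ^ 2 * ((n : ℝ) ^ (η / 2)) ^ 2 * (17 * (K ^ 2 / n) ^ (1 + 2 * η)) := by gcongr
      _ = C ^ 2 * 17 * (K ^ 2) ^ (1 + 2 * η) * (n : ℝ) ^ (-(1 + η)) := by
          rw [Real.div_rpow (by positivity) hn0.le, ← Real.rpow_natCast ((n : ℝ) ^ (η / 2)), ← Real.rpow_mul hn0.le]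
          have : (n : ℝ) ^ (-(1 + η)) = (n : ℝ) ^ (η / 2 * ((2 : ℕ) : ℝ)) / (n : ℝ) ^ (1 + 2 * η) := by
            rw [← Real.rpow_sub hn0]; congr 1; push_cast; ring
          rw [this]; ring
      _ ≤ _ := by
          have h3 : (K ^ 2) ^ (1 + 2 * η) ≤ 4 * (d : ℝ) ^ (2 * η) * K ^ 2 := by
            rw [Real.rpow_add (by positivity), Real.rpow_one]
            have : (K ^ 2) ^ (2 * η) ≤ (4 * (d : ℝ)) ^ (2 * η) := by gcongr
            rw [Real.mul_rpow (by norm_num) hd.le] at this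
            have h4 : (4 : ℝ) ^ (2 * η) ≤ 4 ^ (1 : ℝ) := by gcongr <;> linarith
            rw [Real.rpow_one] at h4
            calc K ^ 2 * (K ^ 2) ^ (2 * η) ≤ K ^ 2 * (4 * (d : ℝ) ^ (2 * η)) := by
                  gcongr; exact this.trans (by gcongr)
              _ = _ := by ring
          calc C ^ 2 * 17 * (K ^ 2) ^ (1 + 2 * η) * (n : ℝ) ^ (-(1 + η)) ≤
            C ^ 2 * 17 * (4 * (d : ℝ) ^ (2 * η) * K ^ 2) * (n : ℝ) ^ (-(1 + η)) := by gcongr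
            _ = _ := by ring
  have hsum : ∑ n ∈ Finset.Icc 1 (M * M), ‖c n‖ ^ 2 * (1 + ((n : ℝ) / d) ^ 2) ≤
      (C ^ 2 * 17 * 4 * (d : ℝ) ^ (2 * η) * K ^ 2) * S := by
    refine (Finset.sum_le_sum hterm).trans ?_
    rw [← Finset.mul_sum]
    gcongr
    exact hS.sum_le_tsum _ fun n _ => by positivity
  calc (d : ℝ) * (3 * ∑ n ∈ Finset.Icc 1 (M * M), ‖c n‖ ^ 2 * (1 + ((n : ℝ) / d) ^ 2)) ≤
      d * (3 * ((C ^ 2 * 17 * 4 * (d : ℝ) ^ (2 * η) * K ^ 2) * S)) := by gcongr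
    _ = _ := by rw [Real.rpow_add hd, Real.rpow_one]; ring

/-- infinite version -/
lemma four0_tsum (η : ℝ) (hη0 : 0 < η) (hη : η ≤ 1 / 2) : ∃ C : ℝ, 0 ≤ C ∧ ∀ (d : ℕ) [NeZero d] (K : ℝ), 0 < K →
    K ^ 2 ≤ 4 * d → ∀ b : ℕ → ℂ, (∀ k : ℕ, 1 ≤ k → ‖b k‖ ≤ 1 ∧ ‖b k‖ ≤ (K / k) ^ 2) → 
    ∑ χ : DirichletCharacter ℂ d, ‖∑' k : ℕ, b (k + 1) * χ ((k + 1 : ℕ) : ZMod d)‖ ^ 4 ≤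
      C * (d : ℝ) ^ (1 + 2 * η) * K ^ 2 := by
  obtain ⟨C, hC0, hC⟩ := four0 η hη0 hη
  refine ⟨C, hC0, fun d _ K hK hKd b hb => ?_⟩
  have hsm : ∀ χ : DirichletCharacter ℂ d, Summable (fun k : ℕ => b (k + 1) * χ ((k + 1 : ℕ) : ZMod d)) := by
    intro χ
    refine Summable.of_norm_bounded (g := fun k : ℕ => K ^ 2 * (((k + 1 : ℕ) : ℝ) ^ 2)⁻¹) ?_ ?_
    · refine Summable.mul_left _ ?_
      exact (summable_nat_add_iff (f := fun k : ℕ => ((k : ℝ) ^ 2)⁻¹) 1).mpr (Real.summable_nat_pow_inv.mpr (by norm_num))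
    · intro k
      rw [norm_mul]
      calc ‖b (k + 1)‖ * ‖χ ((k + 1 : ℕ) : ZMod d)‖ ≤ (K / ((k + 1 : ℕ) : ℝ)) ^ 2 * 1 := by
            gcongr
            · exact (hb (k + 1) (by omega)).2
            · exact DirichletCharacter.norm_le_one χ _
        _ = _ := by rw [div_pow]; ring
  have ht : Filter.Tendsto (fun M : ℕ => ∑ χ : DirichletCharacter ℂ d, ‖∑ k ∈ Finset.range M, b (k + 1) * χ ((k + 1 : ℕ) : ZMod d)‖ ^ 4)
      Filter.atTop (nhds (∑ χ : DirichletCharacter ℂ d, ‖∑' k : ℕ, b (k + 1) * χ ((k + 1 : ℕ) : ZMod d)‖ ^ 4)) := by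
    refine tendsto_finsetSum _ fun χ _ => ?_
    exact ((hsm χ).hasSum.tendsto_sum_nat.norm).pow 4
  refine le_of_tendsto' ht fun M => ?_
  refine le_trans (le_of_eq ?_) (hC d K hK hKd b hb M)
  refine Finset.sum_congr rfl fun χ _ => ?_
  congr 2
  rw [Finset.range_eq_Ico, Finset.sum_Ico_add' (fun k : ℕ => b k * χ ((k : ℕ) : ZMod d)) 0 M 1]
  rfl
end PSB

open MeasureTheory Real Complex
open scoped FourierTransform
namespace PSB

/-- The finset of primitive characters modulo `d`. -/
noncomputable def prims (d : ℕ) [NeZero d] : Finset (DirichletCharacter ℂ d) :=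
  (Set.toFinite {χ : DirichletCharacter ℂ d | χ.IsPrimitive}).toFinset

lemma mem_prims {d : ℕ} [NeZero d] (χ : DirichletCharacter ℂ d) : χ ∈ prims d ↔ χ.IsPrimitive := by
  simp [prims]

lemma fourier_bound0 (F : ℝ → ℂ) (a b B : ℝ) (hab : a ≤ b)
    (h0 : ∀ x ∉ Set.Icc a b, F x = 0) (hB : ∀ x, ‖F x‖ ≤ B) (ξ : ℝ) : ‖𝓕 F ξ‖ ≤ B * (b - a) := by
  rw [Real.fourier_real_eq_integral_exp_smul,
    ← setIntegral_eq_integral_of_forall_compl_eq_zero (s := Set.Icc a b)]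
  · refine (norm_setIntegral_le_of_norm_le_const (C := B) (by simp) ?_).trans ?_
    · intro x _
      rw [norm_smul, Complex.norm_exp_ofReal_mul_I, one_mul]
      exact hB x
    · simp [hab]
  · intro x hx; rw [h0 x hx, smul_zero]

lemma deriv_zero_off (F : ℝ → ℂ) (a b : ℝ) (h0 : ∀ x ∉ Set.Icc a b, F x = 0) :
    ∀ x ∉ Set.Icc a b, deriv F x = 0 := by
  intro x hx
  apply deriv_of_notMem_tsupport
  intro h
  apply hx
  refine closure_minimal ?_ isClosed_Icc h
  intro y hy
  by_contra hc
  exact hy (h0 y hc)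

lemma fourier_bound2 (F : ℝ → ℂ) (a b B : ℝ) (hab : a ≤ b) (hF : ContDiff ℝ 2 F)
    (h0 : ∀ x ∉ Set.Icc a b, F x = 0) (hB : ∀ x, ‖deriv (deriv F) x‖ ≤ B) (ξ : ℝ) :
    (2 * π * ξ) ^ 2 * ‖𝓕 F ξ‖ ≤ B * (b - a) := by
  have h1 := deriv_zero_off F a b h0
  have h2 := deriv_zero_off _ a b h1
  have c1 : ContDiff ℝ 1 (deriv F) := (contDiff_succ_iff_deriv (n := 1)).mp hF |>.2.2
  have c2 : Continuous (deriv (deriv F)) := c1.continuous_deriv le_rfl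
  have i0 := hF.continuous.integrable_of_hasCompactSupport (μ := volume) (HasCompactSupport.intro isCompact_Icc h0)
  have i1 := c1.continuous.integrable_of_hasCompactSupport (μ := volume) (HasCompactSupport.intro isCompact_Icc h1)
  have i2 := c2.integrable_of_hasCompactSupport (μ := volume) (HasCompactSupport.intro isCompact_Icc h2)
  have e1 := congrFun (Real.fourier_deriv i0 (hF.differentiable (by norm_num)) i1) ξ
  have e2 := congrFun (Real.fourier_deriv i1 (c1.differentiable (by norm_num)) i2) ξ
  have h3 := fourier_bound0 _ a b B hab h2 hB ξ
  rw [e2, e1, smul_smul, norm_smul, norm_mul] at h3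
  have h4 : ‖2 * (π : ℂ) * I * ξ‖ = |2 * π * ξ| := by
    rw [norm_mul, norm_mul, norm_mul, Complex.norm_I, Complex.norm_real, Complex.norm_real]
    simp [abs_mul, abs_of_pos Real.pi_pos]
  rw [h4, abs_mul_abs_self] at h3
  rw [pow_two]; exact h3

lemma four_case2 (d : ℕ) [NeZero d] (hd2 : 2 ≤ d) (L : ℝ) (hL : 1 ≤ L) (f : ℝ → ℂ) (B : ℝ) (hB : 0 < B)
    (hf : ContDiff ℝ (⊤ : ℕ∞) f) (h0 : ∀ u ∉ Set.Icc (1 / 2) 2, f u = 0)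
    (hfB : ∀ u, ‖f u‖ ≤ B) (hfB2 : ∀ u, ‖deriv (deriv f) u‖ ≤ B) (M : ℕ) (hM : 2 * L ≤ M) :
    ∃ b₁ b₂ : ℕ → ℂ, (∀ k : ℕ, 1 ≤ k → ‖b₁ k‖ ≤ 1 ∧ ‖b₁ k‖ ≤ (d / L / k) ^ 2) ∧
      (∀ k : ℕ, 1 ≤ k → ‖b₂ k‖ ≤ 1 ∧ ‖b₂ k‖ ≤ (d / L / k) ^ 2) ∧
      ∀ χ : DirichletCharacter ℂ d, χ.IsPrimitive → 
        ‖∑ n ∈ Finset.Icc 1 M, f (n / L) * χ n‖ ≤ Real.sqrt d * (2 * B * L / d) *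
          (‖∑' k : ℕ, b₁ (k + 1) * χ⁻¹ ((k + 1 : ℕ) : ZMod d)‖ + ‖∑' k : ℕ, b₂ (k + 1) * χ⁻¹ ((k + 1 : ℕ) : ZMod d)‖) := by
  have hd : (0 : ℝ) < d := by exact_mod_cast NeZero.pos d
  have hL0 : 0 < L := by linarith
  set c : ℝ := d / L with hc
  have hc0 : 0 < c := by positivity
  set G : ℝ := 2 * B * L / d with hG
  have hG0 : 0 < G := by positivity
  let F0 : ℝ → ℂ := fun x => f (c * x)
  have hF0 : ContDiff ℝ (⊤ : ℕ∞) F0 := hf.comp (contDiff_const.mul contDiff_id)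
  have hz : ∀ x ∉ Set.Icc (1 / 2 / c) (2 / c), F0 x = 0 := by
    intro x hx
    apply h0
    intro h
    apply hx
    rw [Set.mem_Icc] at h ⊢
    rw [div_le_iff₀ hc0, le_div_iff₀ hc0]
    constructor <;> linarith
  have hab : 1 / 2 / c ≤ 2 / c := by gcongr; norm_num
  have hlen : 2 / c - 1 / 2 / c ≤ 2 / c := by
    have : 0 < 1 / 2 / c := by positivity
    linarith
  have hBG : B * (2 / c - 1 / 2 / c) ≤ G := by
    calc B * (2 / c - 1 / 2 / c) ≤ B * (2 / c) := by gcongr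
      _ = G := by rw [hG, hc]; field_simp
  obtain ⟨F, hFF⟩ : ∃ F : SchwartzMap ℝ ℂ, ∀ x, F x = f (c * x) := 
    ⟨(HasCompactSupport.intro isCompact_Icc hz).toSchwartzMap hF0, fun x => HasCompactSupport.toSchwartzMap_toFun _ _ x⟩
  have hFc : ⇑F = F0 := funext hFF
  have hb0 : ∀ ξ, ‖(𝓕 F) ξ‖ ≤ G := by
    intro ξ
    rw [SchwartzMap.fourier_coe, hFc]
    exact (fourier_bound0 F0 _ _ B hab hz (fun x => hfB _) ξ).trans hBG
  have hdd : ∀ x, ‖deriv (deriv F0) x‖ ≤ c ^ 2 * B := by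
    intro x
    have e1 : deriv F0 = fun x => c • deriv f (c * x) := by
      funext x; exact deriv_comp_mul_left c f x
    have e2 : deriv (deriv F0) x = c • (c • deriv (deriv f) (c * x)) := by
      rw [e1]
      rw [deriv_fun_const_smul_field]
      congr 1
      exact deriv_comp_mul_left c (deriv f) x
    rw [e2, norm_smul, norm_smul, Real.norm_of_nonneg hc0.le, pow_two, mul_assoc]
    gcongr
    exact hfB2 _
  have hb2 : ∀ ξ, ξ ≠ 0 → ‖(𝓕 F) ξ‖ ≤ G * (c / ξ) ^ 2 := by
    intro ξ hξ
    have h1 := fourier_bound2 F0 _ _ (c ^ 2 * B) hab (hF0.of_le (by norm_cast)) hz hdd ξ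
    rw [SchwartzMap.fourier_coe, hFc]
    have h2 : ξ ^ 2 * ‖𝓕 F0 ξ‖ ≤ c ^ 2 * G := by
      have h3 : ξ ^ 2 * ‖𝓕 F0 ξ‖ ≤ (2 * π * ξ) ^ 2 * ‖𝓕 F0 ξ‖ := by
        gcongr ?_ * _
        rw [mul_pow]
        have : (1 : ℝ) ≤ (2 * π) ^ 2 := one_le_pow₀ (by linarith [Real.pi_gt_three])
        nlinarith [sq_nonneg ξ]
      refine h3.trans (h1.trans ?_)
      rw [mul_assoc]
      gcongr
    have h4 : 0 < ξ ^ 2 := by positivity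
    rw [div_pow, mul_div_assoc', le_div_iff₀ h4]
    linarith
  have hsZ : Summable (fun k : ℤ => (𝓕 F) (k : ℝ)) := by
    refine Summable.of_norm_bounded_eventually (g := fun k : ℤ => (G * c ^ 2) * (1 / (k : ℝ) ^ 2)) ?_ ?_
    · exact (Real.summable_one_div_int_pow.mpr (by norm_num)).mul_left _
    · refine Filter.mem_of_superset (Set.Finite.compl_mem_cofinite (Set.finite_singleton (0 : ℤ))) ?_
      intro k hk
      have hk' : (k : ℝ) ≠ 0 := by exact_mod_cast hk
      refine (hb2 k hk').trans (le_of_eq ?_)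
      rw [div_pow]; ring
  refine ⟨fun k => (𝓕 F) ((k : ℝ)) / G, fun k => (𝓕 F) (-(k : ℝ)) / G, ?_, ?_, ?_⟩
  · intro k hk
    have hk0 : (k : ℝ) ≠ 0 := by positivity
    simp only [norm_div, Complex.norm_real, Real.norm_of_nonneg hG0.le]
    rw [div_le_iff₀ hG0, div_le_iff₀ hG0, one_mul, mul_comm _ G]
    exact ⟨hb0 _, hb2 _ hk0⟩
  · intro k hk
    have hk0 : -(k : ℝ) ≠ 0 := by rw [neg_ne_zero]; positivity
    simp only [norm_div, Complex.norm_real, Real.norm_of_nonneg hG0.le]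
    rw [div_le_iff₀ hG0, div_le_iff₀ hG0, one_mul, mul_comm _ G]
    refine ⟨hb0 _, (hb2 _ hk0).trans (le_of_eq ?_)⟩
    rw [div_neg, neg_sq]
  · intro χ hχ
    have hnz : ∀ n : ℤ, n ∉ (Finset.Icc 1 (M : ℤ)) → χ (n : ZMod d) * F ((n : ℝ) / d) = 0 := by
      intro n hn
      have : F ((n : ℝ) / d) = 0 := by
        rw [hFF]
        apply h0
        intro h
        apply hn
        have e : c * ((n : ℝ) / d) = n / L := by rw [hc]; field_simp
        rw [e, Set.mem_Icc, div_le_iff₀ hL0, le_div_iff₀ hL0] at h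
        rw [Finset.mem_Icc]
        constructor
        · have : (0 : ℝ) < n := by linarith
          have : 0 < n := by exact_mod_cast this
          omega
        · have : (n : ℝ) ≤ M := by linarith
          exact_mod_cast this
      rw [this, mul_zero]
    have hP := poisson_char d χ hχ F (summable_of_ne_finset_zero (s := Finset.Icc 1 (M : ℤ)) (fun n hn => hnz n hn)) hsZ
    rw [tsum_eq_sum (s := Finset.Icc 1 (M : ℤ)) (fun n hn => hnz n hn)] at hP
    have e1 : ∑ n ∈ Finset.Icc 1 (M : ℤ), χ (n : ZMod d) * F ((n : ℝ) / d) = ∑ n ∈ Finset.Icc 1 M, f (n / L) * χ n := by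
      symm
      refine Finset.sum_nbij (fun n : ℕ => (n : ℤ)) ?_ ?_ ?_ ?_
      · intro n hn; rw [Finset.mem_Icc] at *; omega
      · intro a _ b _ h; exact Nat.cast_injective h
      · intro n hn
        have hn' := Finset.mem_Icc.mp (Finset.mem_coe.mp hn)
        refine ⟨n.toNat, ?_, ?_⟩
        · simp only [Finset.coe_Icc, Set.mem_Icc]; omega
        · simp only [Int.toNat_of_nonneg (by omega : (0 : ℤ) ≤ n)]
      · intro n _
        rw [hFF, mul_comm]
        have e : c * (((n : ℤ) : ℝ) / d) = n / L := by rw [hc]; push_cast; field_simp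
        rw [e]; push_cast; rfl
    rw [e1] at hP
    rw [hP, norm_mul]
    have hsum : Summable (fun k : ℤ => χ⁻¹ (k : ZMod d) * (𝓕 F) (k : ℝ)) := by
      refine Summable.of_norm_bounded hsZ.norm fun k => ?_
      rw [norm_mul]
      exact mul_le_of_le_one_left (norm_nonneg _) (DirichletCharacter.norm_le_one _ _)
    obtain ⟨Q, hQ⟩ : ∃ Q : ℤ → ℂ, ∀ k : ℤ, χ⁻¹ (k : ZMod d) * (𝓕 F) (k : ℝ) = Q k := ⟨_, fun k => rfl⟩
    simp_rw [hQ] at hsum ⊢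
    have hs1 : Summable (fun n : ℕ => Q ((n : ℤ) + 1)) :=
      hsum.comp_injective (i := fun n : ℕ => ((n : ℤ) + 1)) (fun a b h => by simpa using h)
    have hs2 : Summable (fun n : ℕ => Q (-((n : ℤ) + 1))) :=
      hsum.comp_injective (i := fun n : ℕ => -((n : ℤ) + 1)) (fun a b h => by simpa using h)
    have hτ : ‖gaussSum χ ZMod.stdAddChar‖ = Real.sqrt d := by
      rw [← gauss_norm_sq d χ hχ, Real.sqrt_sq (norm_nonneg _)]
    have hsp := tsum_of_add_one_of_neg_add_one hs1 hs2
    rw [hτ, hsp]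
    have hz0 : χ⁻¹ ((0 : ℤ) : ZMod d) = 0 := by
      push_cast
      haveI : Fact (1 < d) := ⟨by omega⟩
      exact MulChar.map_zero _
    rw [← hQ 0, hz0, zero_mul, add_zero, mul_assoc]
    gcongr
    refine (norm_add_le _ _).trans ?_
    rw [mul_add]
    have t1 : ∑' n : ℕ, Q ((n : ℤ) + 1) =
        G * ∑' k : ℕ, (𝓕 F) (((k + 1 : ℕ) : ℝ)) / G * χ⁻¹ ((k + 1 : ℕ) : ZMod d) := by
      rw [← tsum_mul_left]
      refine tsum_congr fun k => ?_
      rw [← hQ]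
      have : (G : ℂ) ≠ 0 := by exact_mod_cast hG0.ne'
      push_cast
      field_simp
    have t2 : ∑' n : ℕ, Q (-((n : ℤ) + 1)) =
        χ⁻¹ (-1) * G * ∑' k : ℕ, (𝓕 F) (-((k + 1 : ℕ) : ℝ)) / G * χ⁻¹ ((k + 1 : ℕ) : ZMod d) := by
      rw [← tsum_mul_left]
      refine tsum_congr fun k => ?_
      rw [← hQ]
      have : (G : ℂ) ≠ 0 := by exact_mod_cast hG0.ne'
      have e : ((-((k : ℤ) + 1) : ℤ) : ZMod d) = (-1) * ((k + 1 : ℕ) : ZMod d) := by push_cast; ring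
      rw [e, map_mul]
      push_cast
      field_simp
    rw [t1, t2, norm_mul, norm_mul, norm_mul, Complex.norm_real, Real.norm_of_nonneg hG0.le]
    gcongr
    exact mul_le_of_le_one_left hG0.le (DirichletCharacter.norm_le_one _ _)

lemma four (η : ℝ) (hη0 : 0 < η) (hη : η ≤ 1 / 2) : ∃ C : ℝ, 0 ≤ C ∧ ∀ (d : ℕ) [NeZero d], 2 ≤ d → 
    ∀ (L : ℝ), 1 ≤ L → ∀ (f : ℝ → ℂ) (B : ℝ), 0 < B → ContDiff ℝ (⊤ : ℕ∞) f → (∀ u ∉ Set.Icc (1 / 2) 2, f u = 0) →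
    (∀ u, ‖f u‖ ≤ B) → (∀ u, ‖deriv (deriv f) u‖ ≤ B) → ∀ M : ℕ, 2 * L ≤ M →
    ∑ χ ∈ prims d, ‖∑ n ∈ Finset.Icc 1 M, f (n / L) * χ n‖ ^ 4 ≤ 
      C * B ^ 4 * (d : ℝ) ^ (1 + 2 * η) * L ^ 2 := by
  classical
  obtain ⟨C1, hC10, hC1⟩ := four0 η hη0 hη
  obtain ⟨C2, hC20, hC2⟩ := four0_tsum η hη0 hη
  refine ⟨4 * C1 + 256 * C2, by positivity, fun d _ hd2 L hL f B hB hf h0 hfB hfB2 M hM => ?_⟩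
  have hd : (0 : ℝ) < d := by exact_mod_cast NeZero.pos d
  have hL0 : 0 < L := by linarith
  rcases le_or_gt (L ^ 2) d with hc | hc
  · have h1 := hC1 d (2 * L) (by linarith) (by nlinarith) (fun n => f (n / L) / B) (by
      intro k hk
      have hk0 : (0 : ℝ) < k := by positivity
      rw [norm_div, Complex.norm_real, Real.norm_of_nonneg hB.le]
      have h1 : ‖f (k / L)‖ / B ≤ 1 := by rw [div_le_one hB]; exact hfB _
      refine ⟨h1, ?_⟩
      by_cases hh : (k : ℝ) / L ∈ Set.Icc (1 / 2) 2
      · have := hh.2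
        rw [div_le_iff₀ hL0] at this
        refine h1.trans (one_le_pow₀ ?_)
        rwa [one_le_div hk0]
      · rw [h0 _ hh]; simp; positivity) M
    calc ∑ χ ∈ prims d, ‖∑ n ∈ Finset.Icc 1 M, f (n / L) * χ n‖ ^ 4 
        ≤ ∑ χ : DirichletCharacter ℂ d, ‖∑ n ∈ Finset.Icc 1 M, f (n / L) * χ n‖ ^ 4 :=
          Finset.sum_le_sum_of_subset_of_nonneg (Finset.subset_univ _) (fun _ _ _ => by positivity)
      _ = B ^ 4 * ∑ χ : DirichletCharacter ℂ d, ‖∑ n ∈ Finset.Icc 1 M, f (n / L) / B * χ n‖ ^ 4 := by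
          rw [Finset.mul_sum]
          refine Finset.sum_congr rfl fun χ _ => ?_
          have : ∑ n ∈ Finset.Icc 1 M, f (n / L) * χ n = B * ∑ n ∈ Finset.Icc 1 M, f (n / L) / B * χ n := by
            rw [Finset.mul_sum]
            refine Finset.sum_congr rfl fun n _ => ?_
            have : (B : ℂ) ≠ 0 := by exact_mod_cast hB.ne'
            field_simp
          rw [this, norm_mul, Complex.norm_real, Real.norm_of_nonneg hB.le, mul_pow]
      _ ≤ B ^ 4 * (C1 * (d : ℝ) ^ (1 + 2 * η) * (2 * L) ^ 2) := by gcongr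
      _ = 4 * C1 * (B ^ 4 * (d : ℝ) ^ (1 + 2 * η) * L ^ 2) := by ring
      _ ≤ (4 * C1 + 256 * C2) * (B ^ 4 * (d : ℝ) ^ (1 + 2 * η) * L ^ 2) := by gcongr; linarith
      _ = _ := by ring
  · obtain ⟨b₁, b₂, hb₁, hb₂, hS⟩ := four_case2 d hd2 L hL f B hB hf h0 hfB hfB2 M hM
    have hKd : (d / L) ^ 2 ≤ 4 * (d : ℝ) := by
      rw [div_pow, div_le_iff₀ (by positivity)]; nlinarith
    have h1 := hC2 d (d / L) (by positivity) hKd b₁ hb₁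
    have h2 := hC2 d (d / L) (by positivity) hKd b₂ hb₂
    let P₁ : DirichletCharacter ℂ d → ℝ := fun χ => ‖∑' k : ℕ, b₁ (k + 1) * χ ((k + 1 : ℕ) : ZMod d)‖
    let P₂ : DirichletCharacter ℂ d → ℝ := fun χ => ‖∑' k : ℕ, b₂ (k + 1) * χ ((k + 1 : ℕ) : ZMod d)‖
    have hG4 : (Real.sqrt d * (2 * B * L / d)) ^ 4 = 16 * B ^ 4 * L ^ 4 / d ^ 2 := by
      rw [mul_pow, show Real.sqrt d ^ 4 = (Real.sqrt d ^ 2) ^ 2 by ring, Real.sq_sqrt hd.le]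
      field_simp; norm_num
    calc ∑ χ ∈ prims d, ‖∑ n ∈ Finset.Icc 1 M, f (n / L) * χ n‖ ^ 4 
        ≤ ∑ χ ∈ prims d, (16 * B ^ 4 * L ^ 4 / d ^ 2) * (8 * (P₁ χ⁻¹ ^ 4 + P₂ χ⁻¹ ^ 4)) := by
          refine Finset.sum_le_sum fun χ hχ => ?_
          refine (pow_le_pow_left₀ (norm_nonneg _) (hS χ ((mem_prims χ).mp hχ)) 4).trans ?_
          rw [mul_pow, hG4]
          gcongr
          have e := add_pow_le (norm_nonneg (∑' k : ℕ, b₁ (k + 1) * χ⁻¹ ((k + 1 : ℕ) : ZMod d))) (norm_nonneg (∑' k : ℕ, b₂ (k + 1) * χ⁻¹ ((k + 1 : ℕ) : ZMod d))) 4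
          norm_num at e
          norm_num [P₁, P₂]
          exact e
      _ ≤ ∑ χ : DirichletCharacter ℂ d, (16 * B ^ 4 * L ^ 4 / d ^ 2) * (8 * (P₁ χ⁻¹ ^ 4 + P₂ χ⁻¹ ^ 4)) := 
          Finset.sum_le_sum_of_subset_of_nonneg (Finset.subset_univ _) (fun _ _ _ => by positivity)
      _ = ∑ χ : DirichletCharacter ℂ d, (16 * B ^ 4 * L ^ 4 / d ^ 2) * (8 * (P₁ χ ^ 4 + P₂ χ ^ 4)) := 
          Fintype.sum_equiv (Equiv.inv _) _ _ (fun χ => rfl)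
      _ = (16 * B ^ 4 * L ^ 4 / d ^ 2) * (8 * (∑ χ, P₁ χ ^ 4 + ∑ χ, P₂ χ ^ 4)) := by
          rw [← Finset.mul_sum, ← Finset.mul_sum, Finset.sum_add_distrib]
      _ ≤ (16 * B ^ 4 * L ^ 4 / d ^ 2) * (8 * (C2 * (d : ℝ) ^ (1 + 2 * η) * (d / L) ^ 2 + C2 * (d : ℝ) ^ (1 + 2 * η) * (d / L) ^ 2)) := by
          gcongr
      _ = 256 * C2 * (B ^ 4 * (d : ℝ) ^ (1 + 2 * η) * L ^ 2) := by field_simp; ring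
      _ ≤ (4 * C1 + 256 * C2) * (B ^ 4 * (d : ℝ) ^ (1 + 2 * η) * L ^ 2) := by gcongr; linarith
      _ = _ := by ring
end PSB

open MeasureTheory Real Complex
namespace PSB

lemma bump_mul_pow (b : ℝ → ℝ) (hb : ContDiff ℝ (⊤ : ℕ∞) b) (h0 : ∀ u ∉ Set.Icc (1 / 2 : ℝ) 2, b u = 0) (A : ℝ)
    (hA0 : ∀ u, |b u| ≤ A) (hA1 : ∀ u, |deriv b u| ≤ A) (hA2 : ∀ u, |deriv (deriv b) u| ≤ A) (w : ℂ) :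
    ContDiff ℝ (⊤ : ℕ∞) (fun u : ℝ => (b u : ℂ) * (u : ℂ) ^ w) ∧
    (∀ u ∉ Set.Icc (1 / 2 : ℝ) 2, (b u : ℂ) * (u : ℂ) ^ w = 0) ∧
    (∀ u, ‖(b u : ℂ) * (u : ℂ) ^ w‖ ≤ 8 * A * (1 + ‖w‖) ^ 2 * 2 ^ |w.re|) ∧
    (∀ u, ‖deriv (deriv (fun u : ℝ => (b u : ℂ) * (u : ℂ) ^ w)) u‖ ≤ 8 * A * (1 + ‖w‖) ^ 2 * 2 ^ |w.re|) := by
  have hA : 0 ≤ A := (abs_nonneg _).trans (hA0 0)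
  have hz : ∀ u ∉ Set.Icc (1 / 2 : ℝ) 2, (b u : ℂ) * (u : ℂ) ^ w = 0 := by
    intro u hu; rw [h0 u hu]; simp
  have hpow : ∀ u ∈ Set.Icc (1 / 2 : ℝ) 2, ∀ t : ℝ, u ^ t ≤ 2 ^ |t| := by
    intro u hu t
    have hu0 : 0 < u := by linarith [hu.1]
    rcases le_total 0 t with ht | ht
    · rw [abs_of_nonneg ht]; exact Real.rpow_le_rpow hu0.le hu.2 ht
    · rw [abs_of_nonpos ht]
      rw [← inv_inv u, Real.inv_rpow (by positivity), ← Real.rpow_neg (by positivity)]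
      refine Real.rpow_le_rpow (by positivity) ?_ (by linarith)
      rw [inv_le_comm₀ hu0 (by norm_num)]; linarith [hu.1]
  have hnb : ∀ u ∈ Set.Icc (1 / 2 : ℝ) 2, ∀ k : ℕ, k ≤ 2 → ‖(u : ℂ) ^ (w - k)‖ ≤ 2 ^ k * 2 ^ |w.re| := by
    intro u hu k hk
    have hu0 : 0 < u := by linarith [hu.1]
    rw [Complex.norm_cpow_eq_rpow_re_of_pos hu0]
    refine (hpow u hu _).trans ?_
    rw [← Real.rpow_natCast, ← Real.rpow_add (by norm_num)]
    apply Real.rpow_le_rpow_of_exponent_le (by norm_num)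
    have : (w - k).re = w.re - k := by simp
    rw [this]
    have := abs_sub w.re (k : ℝ)
    rw [abs_of_nonneg (Nat.cast_nonneg k : (0 : ℝ) ≤ k)] at this
    linarith
  have hE : (0 : ℝ) < 2 ^ |w.re| := by positivity
  have hw := norm_nonneg w
  have hbC : ContDiff ℝ (⊤ : ℕ∞) (fun u : ℝ => (b u : ℂ)) := Complex.ofRealCLM.contDiff.comp hb
  refine ⟨?_, hz, ?_, ?_⟩
  · rw [contDiff_iff_contDiffAt]
    intro u
    rcases lt_or_ge u (1 / 2) with hu | hu
    · have : (fun u : ℝ => (b u : ℂ) * (u : ℂ) ^ w) =ᶠ[nhds u] fun _ => 0 := by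
        filter_upwards [Iio_mem_nhds hu] with v hv
        exact hz v (fun h => by linarith [h.1, Set.mem_Iio.mp hv])
      exact contDiffAt_const.congr_of_eventuallyEq this
    · have hu0 : 0 < u := by linarith
      have : (fun u : ℝ => (b u : ℂ) * (u : ℂ) ^ w) =ᶠ[nhds u] fun u => (b u : ℂ) * Complex.exp (((Real.log u : ℝ) : ℂ) * w) := by
        filter_upwards [Ioi_mem_nhds hu0] with v hv
        have hv0 : (v : ℂ) ≠ 0 := by exact_mod_cast (Set.mem_Ioi.mp hv).ne'
        rw [Complex.cpow_def_of_ne_zero hv0, Complex.ofReal_log (Set.mem_Ioi.mp hv).le]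
      refine ContDiffAt.congr_of_eventuallyEq ?_ this
      refine hbC.contDiffAt.mul ?_
      refine ContDiffAt.cexp ?_
      refine ContDiffAt.mul ?_ contDiffAt_const
      exact Complex.ofRealCLM.contDiff.contDiffAt.comp u (Real.contDiffAt_log.mpr hu0.ne')
  · intro u
    by_cases hu : u ∈ Set.Icc (1 / 2 : ℝ) 2
    · rw [norm_mul, Complex.norm_real, Real.norm_eq_abs]
      have h1 := hnb u hu 0 (by norm_num)
      simp only [Nat.cast_zero, sub_zero, pow_zero, one_mul] at h1
      calc |b u| * ‖(u : ℂ) ^ w‖ ≤ A * 2 ^ |w.re| := by gcongr; exact hA0 u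
        _ = A * 2 ^ |w.re| * 1 := by ring
        _ ≤ A * 2 ^ |w.re| * (8 * (1 + ‖w‖) ^ 2) := by gcongr; nlinarith
        _ = _ := by ring
    · rw [hz u hu]; simp; positivity
  · intro u
    by_cases hu : u ∈ Set.Icc (1 / 2 : ℝ) 2
    · have hu0 : 0 < u := by linarith [hu.1]
      have hbd : ∀ v, HasDerivAt (fun u : ℝ => (b u : ℂ)) ((deriv b v : ℝ) : ℂ) v := fun v =>
        ((hb.differentiable (by norm_num) v).hasDerivAt).ofReal_comp
      have c1 : ContDiff ℝ 1 (deriv b) := ((contDiff_succ_iff_deriv (n := 1)).mp (hb.of_le (by norm_cast))).2.2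
      have hbd2 : ∀ v, HasDerivAt (fun u : ℝ => ((deriv b u : ℝ) : ℂ)) ((deriv (deriv b) v : ℝ) : ℂ) v := fun v =>
        ((c1.differentiable (by norm_num) v).hasDerivAt).ofReal_comp
      have hpd : ∀ (s : ℂ) (v : ℝ), 0 < v → HasDerivAt (fun u : ℝ => (u : ℂ) ^ s) (s * (v : ℂ) ^ (s - 1)) v := by
        intro s v hv
        have h1 : HasDerivAt (fun y : ℂ => y ^ s) (s * (v : ℂ) ^ (s - 1) * 1) (v : ℂ) :=
          (hasDerivAt_id (v : ℂ)).cpow_const (Or.inl (by simpa using hv))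
        rw [mul_one] at h1
        exact h1.comp_ofReal
      have e1 : deriv (fun u : ℝ => (b u : ℂ) * (u : ℂ) ^ w) =ᶠ[nhds u]
          fun v => ((deriv b v : ℝ) : ℂ) * (v : ℂ) ^ w + (b v : ℂ) * (w * (v : ℂ) ^ (w - 1)) := by
        filter_upwards [Ioi_mem_nhds hu0] with v hv
        exact ((hbd v).mul (hpd w v hv)).deriv
      rw [e1.deriv_eq]
      have e2 := ((hbd2 u).mul (hpd w u hu0)).add ((hbd u).mul ((hpd (w - 1) u hu0).const_mul w))
      have e3 := e2.deriv
      change deriv (fun v => ((deriv b v : ℝ) : ℂ) * (v : ℂ) ^ w + (b v : ℂ) * (w * (v : ℂ) ^ (w - 1))) u = _ at e3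
      rw [e3]
      have n0 := hnb u hu 0 (by norm_num)
      have n1 := hnb u hu 1 (by norm_num)
      have n2 := hnb u hu 2 (by norm_num)
      simp only [Nat.cast_zero, sub_zero, pow_zero, one_mul, Nat.cast_one, pow_one, Nat.cast_ofNat] at n0 n1 n2
      have e4 : w - 1 - 1 = w - 2 := by ring
      rw [e4]
      set E : ℝ := 2 ^ |w.re|
      have m0 := hA0 u
      have m1 := hA1 u
      have m2 := hA2 u
      have t1 : ‖((deriv (deriv b) u : ℝ) : ℂ) * (u : ℂ) ^ w‖ ≤ A * E := by
        rw [norm_mul, Complex.norm_real, Real.norm_eq_abs]; gcongr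
      have t2 : ‖((deriv b u : ℝ) : ℂ) * (w * (u : ℂ) ^ (w - 1))‖ ≤ A * (‖w‖ * (2 * E)) := by
        rw [norm_mul, norm_mul, Complex.norm_real, Real.norm_eq_abs]; gcongr
      have t3 : ‖(b u : ℂ) * (w * ((w - 1) * (u : ℂ) ^ (w - 2)))‖ ≤ A * (‖w‖ * ((‖w‖ + 1) * (2 ^ 2 * E))) := by
        rw [norm_mul, norm_mul, norm_mul, Complex.norm_real, Real.norm_eq_abs]; gcongr
        refine (norm_sub_le _ _).trans (by simp)
      refine (norm_add_le _ _).trans ((add_le_add (norm_add_le _ _) (norm_add_le _ _)).trans ?_)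
      have : 8 * A * (1 + ‖w‖) ^ 2 * E = A * E * (8 * (1 + ‖w‖) ^ 2) := by ring
      have hAE : 0 ≤ A * E := by positivity
      nlinarith [mul_nonneg hAE hw, mul_nonneg hAE (mul_nonneg hw hw)]
    · have := deriv_zero_off _ _ _ (deriv_zero_off _ _ _ hz) u hu
      rw [this]; simp; positivity

/-- smooth step -/
noncomputable def thetaF (u : ℝ) : ℝ := Real.smoothTransition (2 * u - 1)
/-- smooth dyadic bump -/
noncomputable def psiF (u : ℝ) : ℝ := thetaF u - thetaF (u / 2)

lemma thetaF_zero {u : ℝ} (h : u ≤ 1 / 2) : thetaF u = 0 :=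
  Real.smoothTransition.zero_of_nonpos (by linarith)
lemma thetaF_one {u : ℝ} (h : 1 ≤ u) : thetaF u = 1 :=
  Real.smoothTransition.one_of_one_le (by linarith)
lemma psiF_zero {u : ℝ} (h : u ∉ Set.Icc (1 / 2 : ℝ) 2) : psiF u = 0 := by
  rw [Set.mem_Icc, not_and_or, not_le, not_le] at h
  unfold psiF
  rcases h with h | h
  · rw [thetaF_zero h.le, thetaF_zero (by linarith), sub_zero]
  · rw [thetaF_one (by linarith), thetaF_one (by linarith), sub_self]
lemma thetaF_contDiff : ContDiff ℝ (⊤ : ℕ∞) thetaF :=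
  Real.smoothTransition.contDiff.comp ((contDiff_const.mul contDiff_id).sub contDiff_const)
lemma psiF_contDiff : ContDiff ℝ (⊤ : ℕ∞) psiF :=
  thetaF_contDiff.sub (thetaF_contDiff.comp (contDiff_id.div_const 2))
lemma psiF_sum (n J : ℕ) (hn : 1 ≤ n) (hJ : n ≤ 2 ^ J) : ∑ l ∈ Finset.range (J + 1), psiF (n / 2 ^ l) = 1 := by
  have : ∀ m : ℕ, ∑ l ∈ Finset.range m, psiF ((n : ℝ) / 2 ^ l) = thetaF n - thetaF (n / 2 ^ m) := by
    intro m
    induction m with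
    | zero => simp
    | succ m ih =>
      rw [Finset.sum_range_succ, ih, psiF, pow_succ, div_div]; ring
  rw [this, thetaF_one (by exact_mod_cast hn), thetaF_zero, sub_zero]
  rw [div_le_iff₀ (by positivity), pow_succ]
  have : (n : ℝ) ≤ 2 ^ J := by exact_mod_cast hJ
  linarith
lemma psiF_le (u : ℝ) : |psiF u| ≤ 1 := by
  unfold psiF thetaF
  have h1 := Real.smoothTransition.nonneg (2 * u - 1)
  have h2 := Real.smoothTransition.le_one (2 * u - 1)
  have h3 := Real.smoothTransition.nonneg (2 * (u / 2) - 1)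
  have h4 := Real.smoothTransition.le_one (2 * (u / 2) - 1)
  rw [abs_le]; constructor <;> linarith

/-- `ψ(u) log u` -/
noncomputable def psiLog (u : ℝ) : ℝ := psiF u * Real.log u

lemma psiLog_zero {u : ℝ} (h : u ∉ Set.Icc (1 / 2 : ℝ) 2) : psiLog u = 0 := by
  rw [psiLog, psiF_zero h, zero_mul]

lemma psiLog_contDiff : ContDiff ℝ (⊤ : ℕ∞) psiLog := by
  rw [contDiff_iff_contDiffAt]
  intro u
  rcases lt_or_ge u (1 / 2) with hu | hu
  · have : psiLog =ᶠ[nhds u] fun _ => 0 := by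
      filter_upwards [Iio_mem_nhds hu] with v hv
      exact psiLog_zero (fun h => by linarith [h.1, Set.mem_Iio.mp hv])
    exact contDiffAt_const.congr_of_eventuallyEq this
  · exact psiF_contDiff.contDiffAt.mul (Real.contDiffAt_log.mpr (by linarith))

lemma bdd_of_cpt (b : ℝ → ℝ) (hb : Continuous b) (h0 : ∀ u ∉ Set.Icc (1 / 2 : ℝ) 2, b u = 0) : ∃ A, ∀ u, |b u| ≤ A := by
  obtain ⟨C, hC⟩ := hb.bounded_above_of_compact_support (HasCompactSupport.intro isCompact_Icc h0)
  exact ⟨C, hC⟩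

lemma deriv_zero_off_real (F : ℝ → ℝ) (a b : ℝ) (h0 : ∀ x ∉ Set.Icc a b, F x = 0) :
    ∀ x ∉ Set.Icc a b, deriv F x = 0 := by
  intro x hx
  apply deriv_of_notMem_tsupport
  intro h
  apply hx
  refine closure_minimal ?_ isClosed_Icc h
  intro y hy
  by_contra hc
  exact hy (h0 y hc)

lemma bump_bounds (b : ℝ → ℝ) (hb : ContDiff ℝ (⊤ : ℕ∞) b) (h0 : ∀ u ∉ Set.Icc (1 / 2 : ℝ) 2, b u = 0) :
    ∃ A, ∀ u, |b u| ≤ A ∧ |deriv b u| ≤ A ∧ |deriv (deriv b) u| ≤ A := by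
  have c1 : ContDiff ℝ 1 (deriv b) := ((contDiff_succ_iff_deriv (n := 1)).mp (hb.of_le (by norm_cast))).2.2
  have c2 : Continuous (deriv (deriv b)) := c1.continuous_deriv le_rfl
  have z1 := deriv_zero_off_real b _ _ h0
  have z2 := deriv_zero_off_real _ _ _ z1
  obtain ⟨A0, h0⟩ := bdd_of_cpt b hb.continuous h0
  obtain ⟨A1, h1⟩ := bdd_of_cpt _ c1.continuous z1
  obtain ⟨A2, h2⟩ := bdd_of_cpt _ c2 z2
  refine ⟨max A0 (max A1 A2), fun u => ⟨(h0 u).trans (le_max_left _ _), (h1 u).trans ?_, (h2 u).trans ?_⟩⟩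
  · exact (le_max_left _ _).trans (le_max_right _ _)
  · exact (le_max_right _ _).trans (le_max_right _ _)

/-- the bump with logarithmic weight: `ψ(u) (κ λ + log u ...)`. -/
lemma bump_family : ∃ A : ℝ, 1 ≤ A ∧ ∀ p q : ℝ, |p| ≤ 1 → 0 ≤ q → ∀ u,
    |q * psiF u + p * psiLog u| ≤ A * (1 + q) ∧ |deriv (fun u => q * psiF u + p * psiLog u) u| ≤ A * (1 + q) ∧
    |deriv (deriv (fun u => q * psiF u + p * psiLog u)) u| ≤ A * (1 + q) := by
  obtain ⟨A1, h1⟩ := bump_bounds psiF psiF_contDiff (fun u h => psiF_zero h)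
  obtain ⟨A2, h2⟩ := bump_bounds psiLog psiLog_contDiff (fun u h => psiLog_zero h)
  refine ⟨max 1 (max A1 A2), le_max_left _ _, fun p q hp hq u => ?_⟩
  set A := max 1 (max A1 A2)
  have hA1 : A1 ≤ A := (le_max_left _ _).trans (le_max_right _ _)
  have hA2 : A2 ≤ A := (le_max_right _ _).trans (le_max_right _ _)
  have key : ∀ x y : ℝ, |x| ≤ A1 → |y| ≤ A2 → |q * x + p * y| ≤ A * (1 + q) := by
    intro x y hx hy
    refine (abs_add_le _ _).trans ?_
    rw [abs_mul, abs_mul, abs_of_nonneg hq]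
    have e1 : q * |x| ≤ q * A := by gcongr; linarith
    have e2 : |p| * |y| ≤ 1 * A := by gcongr; linarith
    linarith
  have d1 : Differentiable ℝ psiF := psiF_contDiff.differentiable (by norm_num)
  have d2 : Differentiable ℝ psiLog := psiLog_contDiff.differentiable (by norm_num)
  have d1' : Differentiable ℝ (deriv psiF) := (((contDiff_succ_iff_deriv (n := 1)).mp (psiF_contDiff.of_le (by norm_cast))).2.2).differentiable (by norm_num)
  have d2' : Differentiable ℝ (deriv psiLog) := (((contDiff_succ_iff_deriv (n := 1)).mp (psiLog_contDiff.of_le (by norm_cast))).2.2).differentiable (by norm_num)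
  have e1 : deriv (fun u => q * psiF u + p * psiLog u) = fun u => q * deriv psiF u + p * deriv psiLog u := by
    funext v
    exact (((d1 v).hasDerivAt.const_mul q).add ((d2 v).hasDerivAt.const_mul p)).deriv
  have e2 : deriv (fun u => q * deriv psiF u + p * deriv psiLog u) = fun u => q * deriv (deriv psiF) u + p * deriv (deriv psiLog) u := by
    funext v
    exact (((d1' v).hasDerivAt.const_mul q).add ((d2' v).hasDerivAt.const_mul p)).deriv
  rw [e1, e2]
  exact ⟨key _ _ (h1 u).1 (h2 u).1, key _ _ (h1 u).2.1 (h2 u).2.1, key _ _ (h1 u).2.2 (h2 u).2.2⟩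
end PSB

open MeasureTheory Real Complex
namespace PSB

lemma smooth_four (η : ℝ) (hη0 : 0 < η) (hη : η ≤ 1 / 2) : ∃ C : ℝ, 0 ≤ C ∧ ∀ (d : ℕ) [NeZero d], 2 ≤ d → 
    ∀ (L : ℝ), 1 ≤ L → ∀ w : ℂ, -1 ≤ w.re → ∀ p q : ℝ, |p| ≤ 1 → 0 ≤ q → ∀ M : ℕ, 2 * L ≤ M →
    ∑ χ ∈ prims d, ‖∑ n ∈ Finset.Icc 1 M, (((q * psiF (n / L) + p * psiLog (n / L) : ℝ) : ℂ) * (n : ℂ) ^ w) * χ n‖ ^ 4 ≤ 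
      C * ((1 + q) * (1 + ‖w‖) ^ 2 * (2 * L) ^ (max w.re 0)) ^ 4 * (d : ℝ) ^ (1 + 2 * η) * L ^ 2 := by
  obtain ⟨C, hC0, hC⟩ := four η hη0 hη
  obtain ⟨A, hA1, hA⟩ := bump_family
  refine ⟨C * (16 * A) ^ 4, by positivity, fun d _ hd2 L hL w hw p q hp hq M hM => ?_⟩
  have hL0 : 0 < L := by linarith
  have hd : (0 : ℝ) < d := by exact_mod_cast NeZero.pos d
  let b : ℝ → ℝ := fun u => q * psiF u + p * psiLog u
  have hb : ContDiff ℝ (⊤ : ℕ∞) b := (contDiff_const.mul psiF_contDiff).add (contDiff_const.mul psiLog_contDiff)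
  have hb0 : ∀ u ∉ Set.Icc (1 / 2 : ℝ) 2, b u = 0 := by
    intro u hu; simp only [b]; rw [psiF_zero hu, psiLog_zero hu]; ring
  obtain ⟨k1, k2, k3, k4⟩ := bump_mul_pow b hb hb0 (A * (1 + q)) (fun u => (hA p q hp hq u).1)
    (fun u => (hA p q hp hq u).2.1) (fun u => (hA p q hp hq u).2.2) w
  have h1 := hC d hd2 L hL (fun u : ℝ => (b u : ℂ) * (u : ℂ) ^ w) _ (by positivity) k1 k2 k3 k4 M hM
  have h2 : ∀ χ : DirichletCharacter ℂ d, ‖∑ n ∈ Finset.Icc 1 M, (((q * psiF (n / L) + p * psiLog (n / L) : ℝ) : ℂ) * (n : ℂ) ^ w) * χ n‖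
      = L ^ w.re * ‖∑ n ∈ Finset.Icc 1 M, ((b ((n : ℝ) / L) : ℂ) * (((n : ℝ) / L : ℝ) : ℂ) ^ w) * χ n‖ := by
    intro χ
    rw [← Complex.norm_cpow_eq_rpow_re_of_pos hL0, ← norm_mul, Finset.mul_sum]
    congr 1
    refine Finset.sum_congr rfl fun n hn => ?_
    have e : (n : ℂ) ^ w = (L : ℂ) ^ w * (((n : ℝ) / L : ℝ) : ℂ) ^ w := by
      rw [← Complex.mul_cpow_ofReal_nonneg hL0.le (by positivity)]
      congr 1
      push_cast
      have : (L : ℂ) ≠ 0 := by exact_mod_cast hL0.ne'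
      field_simp
    rw [e]; simp only [b]; ring
  simp_rw [h2, mul_pow]
  rw [← Finset.mul_sum]
  have h3 : L ^ w.re * 2 ^ |w.re| ≤ 2 * (2 * L) ^ (max w.re 0) := by
    rcases le_total 0 w.re with h | h
    · rw [abs_of_nonneg h, max_eq_left h, Real.mul_rpow (by norm_num) hL0.le]
      have : 0 ≤ L ^ w.re * 2 ^ w.re := by positivity
      linarith
    · rw [max_eq_right h, Real.rpow_zero, mul_one, abs_of_nonpos h]
      have e1 : L ^ w.re ≤ 1 := Real.rpow_le_one_of_one_le_of_nonpos hL h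
      have e2 : (2 : ℝ) ^ (-w.re) ≤ 2 ^ (1 : ℝ) := Real.rpow_le_rpow_of_exponent_le (by norm_num) (by linarith)
      rw [Real.rpow_one] at e2
      calc L ^ w.re * 2 ^ (-w.re) ≤ 1 * 2 := by gcongr
        _ = 2 := by norm_num
  calc (L ^ w.re) ^ 4 * _ ≤ (L ^ w.re) ^ 4 * (C * (8 * (A * (1 + q)) * (1 + ‖w‖) ^ 2 * 2 ^ |w.re|) ^ 4 * (d : ℝ) ^ (1 + 2 * η) * L ^ 2) := by
        gcongr
    _ = C * (8 * A) ^ 4 * ((1 + q) * (1 + ‖w‖) ^ 2 * (L ^ w.re * 2 ^ |w.re|)) ^ 4 * (d : ℝ) ^ (1 + 2 * η) * L ^ 2 := by ring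
    _ ≤ C * (8 * A) ^ 4 * ((1 + q) * (1 + ‖w‖) ^ 2 * (2 * (2 * L) ^ (max w.re 0))) ^ 4 * (d : ℝ) ^ (1 + 2 * η) * L ^ 2 := by gcongr
    _ = _ := by ring
end PSB

open MeasureTheory Real Complex
namespace PSB

/-- `P` is a character polynomial of length `M` with coefficients bounded by `B`. -/
def IsP (d : ℕ) (P : DirichletCharacter ℂ d → ℂ) (M : ℕ) (B : ℝ) : Prop :=
  ∃ a : ℕ → ℂ, (∀ n ∈ Finset.Icc 1 M, ‖a n‖ ≤ B) ∧
    ∀ χ : DirichletCharacter ℂ d, P χ = ∑ n ∈ Finset.Icc 1 M, a n * χ n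

lemma IsP.mul {d : ℕ} {P P' : DirichletCharacter ℂ d → ℂ} {M M' : ℕ} {B B' D : ℝ} (hB : 0 ≤ B) (hB' : 0 ≤ B')
    (h : IsP d P M B) (h' : IsP d P' M' B')
    (hD : ∀ n : ℕ, 1 ≤ n → n ≤ M * M' → (n.divisors.card : ℝ) ≤ D) :
    IsP d (fun χ => P χ * P' χ) (M * M') (D * (B * B')) := by
  obtain ⟨a, ha, haP⟩ := h
  obtain ⟨b, hb, hbP⟩ := h'
  obtain ⟨c, hc, hcs⟩ := poly_mul d M M' a b (fun _ => B * B')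
    (fun k hk l hl => mul_le_mul (ha k hk) (hb l hl) (norm_nonneg _) hB) (fun _ => by positivity)
  refine ⟨c, fun n hn => (hc n).trans ?_, fun χ => ?_⟩
  · have := Finset.mem_Icc.mp hn
    exact mul_le_mul_of_nonneg_right (hD n this.1 this.2) (by positivity)
  · simp only [haP, hbP, hcs]

lemma IsP.prod {ι : Type*} [DecidableEq ι] {d : ℕ} (P : ι → DirichletCharacter ℂ d → ℂ) (M : ι → ℕ) (D Y : ℝ)
    (hD1 : 1 ≤ D) (hP : ∀ i, IsP d (P i) (M i) 1)
    (hD : ∀ n : ℕ, 1 ≤ n → (n : ℝ) ≤ Y → (n.divisors.card : ℝ) ≤ D) (S : Finset ι) :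
    (∀ T ⊆ S, ((∏ i ∈ T, M i : ℕ) : ℝ) ≤ Y) →
    IsP d (fun χ => ∏ i ∈ S, P i χ) (∏ i ∈ S, M i) (D ^ S.card) := by
  induction S using Finset.induction_on with
  | empty =>
    intro _
    refine ⟨fun _ => 1, fun n _ => by simp, fun χ => by simp⟩
  | insert i S hi ih =>
    intro hY
    have h1 := ih fun T hT => hY T (hT.trans (Finset.subset_insert _ _))
    simp only [Finset.prod_insert hi, Finset.card_insert_of_notMem hi]
    have := IsP.mul (D := D) zero_le_one (by positivity) (hP i) h1 (fun n hn hn' => hD n hn ?_)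
    · convert this using 1
      ring
    · have h2 := hY _ le_rfl
      rw [Finset.prod_insert hi] at h2
      exact le_trans (by exact_mod_cast hn') h2

lemma IsP.second {d : ℕ} [NeZero d] {P : DirichletCharacter ℂ d → ℂ} {M : ℕ} {B : ℝ} (h : IsP d P M B) :
    ∑ χ ∈ prims d, ‖P χ‖ ^ 2 ≤ ((d : ℝ) + M) * (M * B ^ 2) := by
  obtain ⟨a, ha, haP⟩ := h
  simp only [haP]
  exact (Finset.sum_le_sum_of_subset_of_nonneg (Finset.subset_univ _) (fun _ _ _ => by positivity)).trans
    (second_moment d M a B ha)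

lemma card_prims_le (d : ℕ) [NeZero d] : ((prims d).card : ℝ) ≤ d := by
  have h1 : (prims d).card ≤ Fintype.card (DirichletCharacter ℂ d) := Finset.card_le_univ _
  have h2 : Fintype.card (DirichletCharacter ℂ d) = d.totient := by
    rw [← Nat.card_eq_fintype_card]
    exact DirichletCharacter.card_eq_totient_of_hasEnoughRootsOfUnity ℂ d
  have h3 := Nat.totient_le d
  exact_mod_cast (h1.trans (h2.le.trans h3))

lemma cs_sq {ι : Type*} (s : Finset ι) (f g : ι → ℝ) :
    (∑ i ∈ s, f i * g i) ^ 2 ≤ (∑ i ∈ s, f i ^ 2) * ∑ i ∈ s, g i ^ 2 :=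
  Finset.sum_mul_sq_le_sq_mul_sq s f g

lemma typeII {d : ℕ} [NeZero d] {P P' : DirichletCharacter ℂ d → ℂ} {M M' : ℕ} {B t W Y : ℝ} (ht : 1 ≤ t) 
    (hW : 1 ≤ W) (hB : 0 ≤ B) (hd : t ^ 8 ≤ d)
    (hY : Y ≤ W * t ^ 15)
    (h : IsP d P M B) (h' : IsP d P' M' B) (hM : (M : ℝ) ≤ 2 * t ^ 9) (hM' : (M' : ℝ) ≤ W * t ^ 9)
    (hMM : (M : ℝ) * M' ≤ Y) :
    (∑ χ ∈ prims d, ‖P χ‖ * ‖P' χ‖) ^ 2 ≤ (3 + 2 * W) * B ^ 4 * d ^ 2 * t * Y := by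
  refine (cs_sq _ _ _).trans ?_
  refine (mul_le_mul h.second h'.second (by positivity) (by positivity)).trans ?_
  have h1 : ((d : ℝ) + M) * (d + M') ≤ (3 + 2 * W) * d ^ 2 * t := by
    have e1 : (M : ℝ) ≤ 2 * (d * t) := hM.trans (by nlinarith)
    have e2 : (M' : ℝ) ≤ W * (d * t) := hM'.trans (mul_le_mul_of_nonneg_left (by nlinarith) (by linarith))
    have e3 : (M : ℝ) * M' ≤ W * d ^ 2 := by
      have : W * t ^ 15 ≤ W * d ^ 2 := by
        refine mul_le_mul_of_nonneg_left ?_ (by linarith)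
        calc t ^ 15 ≤ t ^ 16 := pow_le_pow_right₀ ht (by norm_num)
          _ = (t ^ 8) ^ 2 := by ring
          _ ≤ _ := pow_le_pow_left₀ (by positivity) hd 2
      linarith
    have hd0 : (0 : ℝ) ≤ d := by positivity
    have e4 : (d : ℝ) ^ 2 ≤ d ^ 2 * t := by nlinarith [sq_nonneg (d : ℝ)]
    have e5 : W * (d : ℝ) ^ 2 ≤ W * (d ^ 2 * t) := mul_le_mul_of_nonneg_left e4 (by linarith)
    nlinarith [mul_le_mul_of_nonneg_left e1 hd0, mul_le_mul_of_nonneg_left e2 hd0]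
  have hY0 : 0 ≤ (M : ℝ) * M' := by positivity
  calc ((d : ℝ) + M) * (M * B ^ 2) * ((d + M') * (M' * B ^ 2)) 
      = (((d : ℝ) + M) * (d + M')) * (B ^ 4 * (M * M')) := by ring
    _ ≤ ((3 + 2 * W) * d ^ 2 * t) * (B ^ 4 * Y) := by
        refine mul_le_mul h1 (mul_le_mul_of_nonneg_left hMM (by positivity)) (by positivity) (by positivity)
    _ = _ := by ring

lemma tuple {ι : Type*} [Fintype ι] {d : ℕ} [NeZero d] (P : ι → DirichletCharacter ℂ d → ℂ) (M : ι → ℕ) 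
    (D Y W t Q : ℝ) (hD1 : 1 ≤ D) (ht : 1 ≤ t) (hW : 1 ≤ W) (hQ : 1 ≤ Q) (hd : t ^ 8 ≤ d) (hY : Y ≤ W * t ^ 15)
    (hM1 : ∀ i, 1 ≤ M i) (hP : ∀ i, IsP d (P i) (M i) 1)
    (hsm : ∀ i, (M i : ℝ) ≤ 2 * t ^ 3 ∨ ∑ χ ∈ prims d, ‖P i χ‖ ^ 4 ≤ Q * d * (M i : ℝ) ^ 2)
    (hD : ∀ n : ℕ, 1 ≤ n → (n : ℝ) ≤ Y → (n.divisors.card : ℝ) ≤ D)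
    (hMY : ∏ i, (M i : ℝ) ≤ Y) :
    (∑ χ ∈ prims d, ∏ i, ‖P i χ‖) ^ 2 ≤ (3 + 2 * W) * Q * D ^ (4 * Fintype.card ι) * d ^ 2 * t * Y := by
  classical
  have hM1r : ∀ i, (1 : ℝ) ≤ M i := fun i => by exact_mod_cast hM1 i
  have hM0r : ∀ i, (0 : ℝ) ≤ M i := fun i => by positivity
  have hmono : ∀ S T : Finset ι, S ⊆ T → ∏ i ∈ S, (M i : ℝ) ≤ ∏ i ∈ T, (M i : ℝ) := fun S T h =>
    by
      have h0 := Finset.prod_le_prod_of_subset_of_one_le' (f := M) h (fun i _ _ => hM1 i)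
      exact_mod_cast h0
  have hpos : ∀ S : Finset ι, 1 ≤ ∏ i ∈ S, (M i : ℝ) := fun S => by
    simpa using hmono ∅ S (Finset.empty_subset _)
  have hsub : ∀ S : Finset ι, ∏ i ∈ S, (M i : ℝ) ≤ Y := fun S => (hmono S _ (Finset.subset_univ _)).trans hMY
  have hY1 : 1 ≤ Y := (hpos ∅).trans (hsub ∅)
  set K : ℝ := D ^ Fintype.card ι with hK
  have hK1 : 1 ≤ K := one_le_pow₀ hD1
  have hprod : ∀ S : Finset ι, IsP d (fun χ => ∏ i ∈ S, P i χ) (∏ i ∈ S, M i) K := by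
    intro S
    obtain ⟨a, ha, h⟩ := IsP.prod P M D Y hD1 hP hD S (fun T _ => by push_cast; exact hsub T)
    refine ⟨a, fun n hn => (ha n hn).trans (pow_le_pow_right₀ hD1 (Finset.card_le_univ _)), h⟩
  have hsplit : ∀ S : Finset ι, ∑ χ ∈ prims d, ∏ i, ‖P i χ‖ = 
      ∑ χ ∈ prims d, ‖∏ i ∈ S, P i χ‖ * ‖∏ i ∈ Sᶜ, P i χ‖ := by
    intro S
    refine Finset.sum_congr rfl fun χ _ => ?_
    rw [norm_prod, norm_prod, Finset.prod_mul_prod_compl]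
  have hsplitM : ∀ S : Finset ι, (∏ i ∈ S, (M i : ℝ)) * ∏ i ∈ Sᶜ, (M i : ℝ) ≤ Y := by
    intro S
    rw [Finset.prod_mul_prod_compl]; exact hMY
  have hKD : K ^ 4 = D ^ (4 * Fintype.card ι) := by rw [hK, ← pow_mul, mul_comm]
  rw [← hKD]
  have t9 : t ^ 6 ≤ 2 * t ^ 9 := by
    have : t ^ 6 ≤ t ^ 9 := pow_le_pow_right₀ ht (by norm_num)
    nlinarith [pow_pos (zero_lt_one.trans_le ht) 9]
  have fin2 : ∀ S : Finset ι, ∏ i ∈ S, (M i : ℝ) ≤ 2 * t ^ 9 → ∏ i ∈ Sᶜ, (M i : ℝ) ≤ W * t ^ 9 → 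
      (∑ χ ∈ prims d, ∏ i, ‖P i χ‖) ^ 2 ≤ (3 + 2 * W) * Q * K ^ 4 * d ^ 2 * t * Y := by
    intro S h1 h2
    rw [hsplit S]
    refine (typeII ht hW (by positivity) hd hY (hprod S) (hprod Sᶜ) (by push_cast; exact h1)
      (by push_cast; exact h2) (by push_cast; exact hsplitM S)).trans ?_
    have : (3 + 2 * W) * K ^ 4 * d ^ 2 * t * Y * 1 ≤ (3 + 2 * W) * K ^ 4 * d ^ 2 * t * Y * Q :=
      mul_le_mul_of_nonneg_left hQ (by positivity)
    linarith
  by_cases hall : ∏ i, (M i : ℝ) < t ^ 6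
  · refine fin2 Finset.univ (by linarith) ?_
    simp only [Finset.compl_univ, Finset.prod_empty]
    have : 1 ≤ t ^ 9 := one_le_pow₀ ht
    nlinarith
  push Not at hall
  obtain ⟨S, hSm, hSmin⟩ := Finset.exists_min_image
    ((Finset.univ : Finset ι).powerset.filter (fun S => t ^ 6 ≤ ∏ i ∈ S, (M i : ℝ))) Finset.card
    ⟨Finset.univ, by simp [hall]⟩
  simp only [Finset.mem_filter, Finset.mem_powerset, Finset.subset_univ, true_and] at hSm hSmin
  have t0 : 0 < t := by linarith
  by_cases hS9 : ∏ i ∈ S, (M i : ℝ) ≤ 2 * t ^ 9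
  · refine fin2 S hS9 ?_
    have h1 := hsplitM S
    have h2 : t ^ 6 * ∏ i ∈ Sᶜ, (M i : ℝ) ≤ t ^ 6 * (W * t ^ 9) := by
      calc t ^ 6 * ∏ i ∈ Sᶜ, (M i : ℝ) ≤ (∏ i ∈ S, (M i : ℝ)) * ∏ i ∈ Sᶜ, (M i : ℝ) :=
            mul_le_mul_of_nonneg_right hSm (by linarith [hpos Sᶜ])
        _ ≤ Y := h1
        _ ≤ _ := by linarith
    exact le_of_mul_le_mul_left h2 (by positivity)
  push Not at hS9
  have herase : ∀ i ∈ S, ∏ j ∈ S.erase i, (M j : ℝ) < t ^ 6 := by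
    intro i hi
    by_contra hcon
    push Not at hcon
    have := hSmin _ hcon
    have h2 := Finset.card_erase_lt_of_mem hi
    omega
  have hbig : ∀ i ∈ S, 2 * t ^ 3 < M i := by
    intro i hi
    have h1 := herase i hi
    rw [← Finset.mul_prod_erase S _ hi] at hS9
    by_contra hcon
    push Not at hcon
    have := mul_le_mul hcon h1.le (by linarith [hpos (S.erase i)]) (by positivity)
    nlinarith
  have hsm' : ∀ i ∈ S, ∑ χ ∈ prims d, ‖P i χ‖ ^ 4 ≤ Q * d * (M i : ℝ) ^ 2 := by
    intro i hi
    rcases hsm i with h | h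
    · linarith [hbig i hi]
    · exact h
  have hMc : ∏ i ∈ Sᶜ, (M i : ℝ) ≤ W * d := by
    have h1 := hsplitM S
    have h2 : t ^ 9 * ∏ i ∈ Sᶜ, (M i : ℝ) ≤ t ^ 9 * (W * t ^ 6) := by
      calc t ^ 9 * ∏ i ∈ Sᶜ, (M i : ℝ) ≤ (∏ i ∈ S, (M i : ℝ)) * ∏ i ∈ Sᶜ, (M i : ℝ) :=
            mul_le_mul_of_nonneg_right (by nlinarith [pow_pos t0 9]) (by linarith [hpos Sᶜ])
        _ ≤ Y := h1
        _ ≤ _ := by linarith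
    have h3 := le_of_mul_le_mul_left h2 (by positivity)
    have h4 : t ^ 6 ≤ t ^ 8 := pow_le_pow_right₀ ht (by norm_num)
    nlinarith
  have hPS : ∑ χ ∈ prims d, ‖∏ i ∈ S, P i χ‖ ^ 2 ≤ Q * d * ∏ i ∈ S, (M i : ℝ) := by
    have hne : S.Nonempty := by
      rw [Finset.nonempty_iff_ne_empty]
      rintro rfl
      simp only [Finset.prod_empty] at hS9
      have : 1 ≤ t ^ 9 := one_le_pow₀ ht
      linarith
    obtain ⟨i, hi⟩ := hne
    have hle : ∀ x y : ℝ, 0 ≤ y → x ^ 2 ≤ y ^ 2 → x ≤ y := fun x y hy h => abs_le_of_sq_le_sq' h hy |>.2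
    by_cases hone : S = {i}
    · subst hone
      simp only [Finset.prod_singleton]
      refine hle _ _ (by positivity) ?_
      have h1 := cs_sq (prims d) (fun _ => 1) (fun χ => ‖P i χ‖ ^ 2)
      simp only [one_mul, one_pow, Finset.sum_const, nsmul_eq_mul, mul_one, ← pow_mul] at h1
      refine h1.trans ((mul_le_mul (card_prims_le d) (hsm' i hi) (by positivity) (by positivity)).trans ?_)
      have : (d : ℝ) ^ 2 * M i ^ 2 * Q * 1 ≤ d ^ 2 * M i ^ 2 * Q * Q := mul_le_mul_of_nonneg_left hQ (by positivity)
      nlinarith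
    · obtain ⟨j, hj, hji⟩ : ∃ j ∈ S, j ≠ i := by
        by_contra hcon
        push Not at hcon
        exact hone (Finset.eq_singleton_iff_unique_mem.mpr ⟨hi, hcon⟩)
      have hSij : S = {i, j} := by
        by_contra hcon
        obtain ⟨k, hk, hkij⟩ : ∃ k ∈ S, k ≠ i ∧ k ≠ j := by
          by_contra hc2
          push Not at hc2
          apply hcon
          ext k
          simp only [Finset.mem_insert, Finset.mem_singleton]
          constructor
          · intro hk
            by_cases h : k = i
            · exact Or.inl h
            · exact Or.inr (hc2 k hk h)
          · rintro (rfl | rfl) <;> assumption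
        have h1 := herase k hk
        have h2 := hmono {i, j} (S.erase k) (by
          intro x hx
          simp only [Finset.mem_insert, Finset.mem_singleton] at hx
          rcases hx with rfl | rfl
          · exact Finset.mem_erase.mpr ⟨hkij.1.symm, hi⟩
          · exact Finset.mem_erase.mpr ⟨hkij.2.symm, hj⟩)
        rw [Finset.prod_pair hji.symm] at h2
        have h3 := mul_le_mul (hbig i hi).le (hbig j hj).le (by positivity) (by positivity)
        nlinarith [pow_pos t0 6]
      rw [hSij]
      simp only [Finset.prod_pair hji.symm, norm_mul, mul_pow]
      refine hle _ _ (by positivity) ?_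
      refine (cs_sq _ _ _).trans ?_
      simp only [← pow_mul]
      refine (mul_le_mul (hsm' i hi) (hsm' j hj) (by positivity) (by positivity)).trans (le_of_eq (by ring))
  rw [hsplit S]
  refine (cs_sq _ _ _).trans ?_
  refine (mul_le_mul hPS (hprod Sᶜ).second (by positivity) (by have := hpos S; positivity)).trans ?_
  push_cast
  have hc0 := hpos Sᶜ
  calc Q * d * (∏ i ∈ S, (M i : ℝ)) * ((d + ∏ i ∈ Sᶜ, (M i : ℝ)) * ((∏ i ∈ Sᶜ, (M i : ℝ)) * K ^ 2))
      = Q * d * K ^ 2 * (d + ∏ i ∈ Sᶜ, (M i : ℝ)) * ((∏ i ∈ S, (M i : ℝ)) * (∏ i ∈ Sᶜ, (M i : ℝ))) := by ring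
    _ ≤ Q * d * K ^ 2 * ((3 + 2 * W) * d) * Y := by
        refine mul_le_mul (mul_le_mul_of_nonneg_left ?_ (by positivity)) (hsplitM S) ?_ (by positivity)
        · have : (0 : ℝ) ≤ d := by positivity
          nlinarith
        · have := hpos S
          positivity
    _ = (3 + 2 * W) * Q * K ^ 2 * d ^ 2 * Y * 1 := by ring
    _ ≤ (3 + 2 * W) * Q * K ^ 2 * d ^ 2 * Y * (K ^ 2 * t) := by
        refine mul_le_mul_of_nonneg_left ?_ (by positivity)
        exact one_le_mul_of_one_le_of_one_le (one_le_pow₀ hK1) ht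
    _ = _ := by ring

end PSB

open MeasureTheory Real Complex
namespace PSB

noncomputable def lamC : ArithmeticFunction ℂ := ⟨fun n => ((ArithmeticFunction.vonMangoldt n : ℝ) : ℂ), by simp⟩
noncomputable def logC : ArithmeticFunction ℂ := ⟨fun n => ((Real.log n : ℝ) : ℂ), by simp⟩
noncomputable def mobC (z : ℕ) : ArithmeticFunction ℂ :=
  ⟨fun n => if n ≤ z then ((ArithmeticFunction.moebius n : ℤ) : ℂ) else 0, by simp⟩

lemma lamC_zeta : lamC * (ArithmeticFunction.zeta : ArithmeticFunction ℂ) = logC := by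
  ext n
  have h := congrArg (fun f : ArithmeticFunction ℝ => f n) ArithmeticFunction.vonMangoldt_mul_zeta
  simp only [ArithmeticFunction.coe_mul_zeta_apply] at h ⊢
  simp only [lamC, logC, ArithmeticFunction.coe_mk]
  rw [← Complex.ofReal_sum, h]
  simp [ArithmeticFunction.log_apply]

lemma af_sub_apply (f g : ArithmeticFunction ℂ) (n : ℕ) : (f - g) n = f n - g n := by
  have h := ArithmeticFunction.add_apply (f := f - g) (g := g) (n := n)
  rw [sub_add_cancel] at h
  rw [h, add_sub_cancel_right]

/-- vanishing below `a` -/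
def VB (f : ArithmeticFunction ℂ) (a : ℕ) : Prop := ∀ n < a, f n = 0

lemma VB.mul {f g : ArithmeticFunction ℂ} {a b : ℕ} (hf : VB f a) (hg : VB g b) : VB (f * g) (a * b) := by
  intro n hn
  rw [ArithmeticFunction.mul_apply]
  refine Finset.sum_eq_zero fun p hp => ?_
  have hp' := (Nat.mem_divisorsAntidiagonal.mp hp).1
  by_cases h1 : p.1 < a
  · rw [hf _ h1, zero_mul]
  · by_cases h2 : p.2 < b
    · rw [hg _ h2, mul_zero]
    · have := Nat.mul_le_mul (not_lt.mp h1) (not_lt.mp h2)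
      omega

lemma VB_delta (z : ℕ) : VB (1 - ArithmeticFunction.zeta * mobC z) (z + 1) := by
  intro n hn
  rcases Nat.eq_zero_or_pos n with rfl | h0
  · simp
  have h := congrArg (fun f : ArithmeticFunction ℂ => f n) (ArithmeticFunction.coe_moebius_mul_coe_zeta (R := ℂ))
  have h2 : ((ArithmeticFunction.zeta : ArithmeticFunction ℂ) * mobC z) n = (1 : ArithmeticFunction ℂ) n := by
    rw [← h]
    simp only [ArithmeticFunction.coe_zeta_mul_apply, ArithmeticFunction.coe_mul_zeta_apply]
    refine Finset.sum_congr rfl fun i hi => ?_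
    have := Nat.divisor_le hi
    simp only [mobC, ArithmeticFunction.coe_mk]
    rw [if_pos (by omega)]
    rfl
  rw [af_sub_apply, h2, sub_self]

noncomputable def full (z : ℕ) : Fin 3 → ArithmeticFunction ℂ := ![logC, ArithmeticFunction.zeta, mobC z]

lemma heath_brown (z : ℕ) (n : ℕ) (hn : n < (z + 1) ^ 5) :
    lamC n = 5 * (∏ i, full z ((![0, 2] : Fin 2 → Fin 3) i)) n 
      - 10 * (∏ i, full z ((![0, 1, 2, 2] : Fin 4 → Fin 3) i)) n
      + 10 * (∏ i, full z ((![0, 1, 1, 2, 2, 2] : Fin 6 → Fin 3) i)) n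
      - 5 * (∏ i, full z ((![0, 1, 1, 1, 2, 2, 2, 2] : Fin 8 → Fin 3) i)) n
      + (∏ i, full z ((![0, 1, 1, 1, 1, 2, 2, 2, 2, 2] : Fin 10 → Fin 3) i)) n := by
  have hz : VB (lamC * (1 - ArithmeticFunction.zeta * mobC z) ^ 5) ((z + 1) ^ 5) := by
    have h := VB_delta z
    have h5 := ((((h.mul h).mul h).mul h).mul h)
    have h0 : VB lamC 1 := by
      intro n hn
      have : n = 0 := by omega
      subst this; simp
    have := h0.mul h5
    intro n hn
    have := this n (by convert hn using 1; ring)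
    convert this using 2
    ring
  have h1 := hz n hn
  have e : lamC = lamC * (1 - ArithmeticFunction.zeta * mobC z) ^ 5 + 
      5 • (∏ i, full z ((![0, 2] : Fin 2 → Fin 3) i))
      - 10 • (∏ i, full z ((![0, 1, 2, 2] : Fin 4 → Fin 3) i)) 
      + 10 • (∏ i, full z ((![0, 1, 1, 2, 2, 2] : Fin 6 → Fin 3) i))
      - 5 • (∏ i, full z ((![0, 1, 1, 1, 2, 2, 2, 2] : Fin 8 → Fin 3) i))
      + (∏ i, full z ((![0, 1, 1, 1, 1, 2, 2, 2, 2, 2] : Fin 10 → Fin 3) i)) := by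
    simp only [Fin.prod_univ_succ, full]
    simp only [Fin.isValue, Matrix.cons_val_zero, Matrix.cons_val_succ, Matrix.cons_val_one, Matrix.cons_val, Finset.univ_eq_empty, Finset.prod_empty]
    rw [← lamC_zeta]
    simp only [nsmul_eq_mul, Nat.cast_ofNat]
    ring
  have sm : ∀ (k : ℕ) (f : ArithmeticFunction ℂ), (k • f) n = (k : ℂ) * f n := by
    intro k f
    induction k with
    | zero => simp
    | succ k ih => rw [succ_nsmul, ArithmeticFunction.add_apply, ih]; push_cast; ring
  have h2 := congrArg (fun f : ArithmeticFunction ℂ => f n) e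
  simp only [ArithmeticFunction.add_apply, af_sub_apply, sm, h1] at h2
  push_cast at h2
  rw [zero_add] at h2
  exact h2

/-- dyadic pieces -/
noncomputable def pc (z : ℕ) (k : Fin 3) (l : ℕ) : ArithmeticFunction ℂ :=
  ⟨fun n => ![((psiF (n / 2 ^ l) * Real.log n : ℝ) : ℂ), ((psiF (n / 2 ^ l) : ℝ) : ℂ),
    if 2 ^ l ≤ n ∧ n < 2 ^ (l + 1) ∧ n ≤ z then ((ArithmeticFunction.moebius n : ℤ) : ℂ) else 0] k, by
    have : psiF 0 = 0 := psiF_zero (by simp)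
    fin_cases k <;> simp [this]⟩

lemma pc_sum (z J n : ℕ) (hz : z < 2 ^ (J + 1)) (hJ : n ≤ 2 ^ J) (k : Fin 3) : 
    (∑ l ∈ Finset.range (J + 1), pc z k l) n = full z k n := by
  have hs : ∀ (s : Finset ℕ), (∑ l ∈ s, pc z k l) n = ∑ l ∈ s, pc z k l n := by
    intro s
    induction s using Finset.induction_on with
    | empty => simp
    | insert a s ha ih => rw [Finset.sum_insert ha, Finset.sum_insert ha, ArithmeticFunction.add_apply, ih]
  rw [hs]
  rcases Nat.eq_zero_or_pos n with rfl | h0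
  · simp
  have hp := psiF_sum n J h0 hJ
  fin_cases k
  · simp only [pc, full, ArithmeticFunction.coe_mk, Fin.zero_eta, Matrix.cons_val_zero]
    rw [← Complex.ofReal_sum, ← Finset.sum_mul, hp]
    simp [logC]
  · simp only [pc, full, ArithmeticFunction.coe_mk, Fin.mk_one, Matrix.cons_val_one]
    simp only [Matrix.cons_val_zero]
    rw [← Complex.ofReal_sum, hp]
    simp [ArithmeticFunction.natCoe_apply, h0.ne']
  · simp only [pc, full, ArithmeticFunction.coe_mk, Fin.reduceFinMk, Matrix.cons_val]
    simp only [mobC, ArithmeticFunction.coe_mk]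
    by_cases hnz : n ≤ z
    · rw [if_pos hnz, Finset.sum_eq_single (Nat.log 2 n)]
      · rw [if_pos ⟨Nat.pow_log_le_self 2 h0.ne', Nat.lt_pow_succ_log_self (by norm_num) n, hnz⟩]
      · intro l _ hl
        rw [if_neg]
        rintro ⟨h1, h2, _⟩
        exact hl (Nat.log_eq_of_pow_le_of_lt_pow h1 h2).symm
      · intro h
        exfalso
        apply h
        rw [Finset.mem_range]
        exact Nat.log_lt_of_lt_pow h0.ne' (by omega)
    · rw [if_neg hnz]
      refine Finset.sum_eq_zero fun l _ => ?_
      rw [if_neg (by tauto)]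

lemma prod_congr_up {ι : Type*} (s : Finset ι) (f g : ι → ArithmeticFunction ℂ) (Z : ℕ) 
    (h : ∀ i, ∀ n ≤ Z, f i n = g i n) : ∀ n ≤ Z, (∏ i ∈ s, f i) n = (∏ i ∈ s, g i) n := by
  classical
  induction s using Finset.induction_on with
  | empty => simp
  | insert a s ha ih =>
    intro n hn
    rw [Finset.prod_insert ha, Finset.prod_insert ha, ArithmeticFunction.mul_apply, ArithmeticFunction.mul_apply]
    refine Finset.sum_congr rfl fun p hp => ?_
    have hp' := Nat.mem_divisorsAntidiagonal.mp hp
    have h1 : p.1 ≤ n := Nat.le_of_dvd (Nat.pos_of_ne_zero hp'.2) ⟨p.2, hp'.1.symm⟩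
    have h2 : p.2 ≤ n := Nat.le_of_dvd (Nat.pos_of_ne_zero hp'.2) ⟨p.1, by rw [mul_comm]; exact hp'.1.symm⟩
    rw [h a _ (h1.trans hn), ih _ (h2.trans hn)]

lemma full_expand {r : ℕ} (κ : Fin r → Fin 3) (z J n : ℕ) (hz : z < 2 ^ (J + 1)) (hJ : n ≤ 2 ^ J) :
    (∏ i, full z (κ i)) n = ∑ τ ∈ Fintype.piFinset (fun _ : Fin r => Finset.range (J + 1)), (∏ i, pc z (κ i) (τ i)) n := by
  rw [prod_congr_up Finset.univ (fun i => full z (κ i)) (fun i => ∑ l ∈ Finset.range (J + 1), pc z (κ i) l) (2 ^ J) 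
    (fun i n hn => (pc_sum z J n hz hn (κ i)).symm) n hJ]
  rw [Finset.prod_univ_sum]
  generalize (Fintype.piFinset (fun _ : Fin r => Finset.range (J + 1))) = s
  induction s using Finset.induction_on with
  | empty => simp
  | insert a s ha ih => rw [Finset.sum_insert ha, Finset.sum_insert ha, ArithmeticFunction.add_apply, ih]

/-- support control -/
def Pc (f : ArithmeticFunction ℂ) (K M : ℕ) : Prop := ∀ n, f n ≠ 0 → M ≤ K * n ∧ n ≤ M

lemma Pc.mul {f g : ArithmeticFunction ℂ} {K K' M M' : ℕ} (hf : Pc f K M) (hg : Pc g K' M') : 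
    Pc (f * g) (K * K') (M * M') := by
  intro n hn
  rw [ArithmeticFunction.mul_apply] at hn
  obtain ⟨p, hp, hne⟩ := Finset.exists_ne_zero_of_sum_ne_zero hn
  have hp' := (Nat.mem_divisorsAntidiagonal.mp hp).1
  obtain ⟨h1, h2⟩ := hf p.1 (left_ne_zero_of_mul hne)
  obtain ⟨h3, h4⟩ := hg p.2 (right_ne_zero_of_mul hne)
  rw [← hp']
  constructor
  · calc M * M' ≤ (K * p.1) * (K' * p.2) := Nat.mul_le_mul h1 h3
      _ = _ := by ring
  · exact Nat.mul_le_mul h2 h4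

lemma Pc_pc (z : ℕ) (k : Fin 3) (l : ℕ) : Pc (pc z k l) 4 (2 ^ (l + 1)) := by
  intro n hn
  have hps : psiF (n / 2 ^ l) ≠ 0 → 2 ^ (l + 1) ≤ 4 * n ∧ n ≤ 2 ^ (l + 1) := by
    intro h
    have h1 : (n : ℝ) / 2 ^ l ∈ Set.Icc (1 / 2 : ℝ) 2 := by
      by_contra hc
      exact h (psiF_zero hc)
    obtain ⟨h1, h2⟩ := h1
    rw [le_div_iff₀ (by positivity)] at h1
    rw [div_le_iff₀ (by positivity)] at h2
    constructor
    · have : (2 : ℝ) ^ (l + 1) ≤ 4 * n := by rw [pow_succ]; linarith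
      exact_mod_cast this
    · have : (n : ℝ) ≤ 2 ^ (l + 1) := by rw [pow_succ]; linarith
      exact_mod_cast this
  fin_cases k
  · simp only [pc, ArithmeticFunction.coe_mk, Fin.zero_eta, Matrix.cons_val_zero] at hn
    refine hps fun h => hn ?_
    rw [h]; simp
  · simp only [pc, ArithmeticFunction.coe_mk, Fin.mk_one, Matrix.cons_val_one, Matrix.cons_val_zero] at hn
    refine hps fun h => hn ?_
    rw [h]; simp
  · simp only [pc, ArithmeticFunction.coe_mk, Fin.reduceFinMk, Matrix.cons_val] at hn
    have : 2 ^ l ≤ n ∧ n < 2 ^ (l + 1) ∧ n ≤ z := by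
      by_contra hc
      exact hn (if_neg hc)
    rw [pow_succ] at *
    omega

lemma dir_mul (ξ : ℕ → ℂ) (hξ : ∀ a b, ξ (a * b) = ξ a * ξ b) {f g : ArithmeticFunction ℂ} {K K' M M' : ℕ} 
    (hf : Pc f K M) (hg : Pc g K' M') :
    ∑ n ∈ Finset.Icc 1 (M * M'), (f * g) n * ξ n = 
      (∑ n ∈ Finset.Icc 1 M, f n * ξ n) * ∑ n ∈ Finset.Icc 1 M', g n * ξ n := by
  rw [Finset.sum_mul_sum, ← Finset.sum_product']
  rw [← Finset.sum_fiberwise_of_maps_to (s := Finset.Icc 1 M ×ˢ Finset.Icc 1 M') (t := Finset.Icc 1 (M * M'))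
    (g := fun p : ℕ × ℕ => p.1 * p.2)]
  · refine Finset.sum_congr rfl fun n hn => ?_
    rw [ArithmeticFunction.mul_apply, Finset.sum_mul]
    symm
    refine Finset.sum_subset_zero_on_sdiff ?_ ?_ ?_
    · intro p hp
      simp only [Finset.mem_filter] at hp
      rw [Nat.mem_divisorsAntidiagonal]
      exact ⟨hp.2, by have := (Finset.mem_Icc.mp hn).1; omega⟩
    · intro p hp
      simp only [Finset.mem_sdiff, Finset.mem_filter, Finset.mem_product, Finset.mem_Icc, Nat.mem_divisorsAntidiagonal] at hp
      by_contra hne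
      have h0 := left_ne_zero_of_mul hne
      have h1 := (hf p.1 (left_ne_zero_of_mul h0)).2
      have h2 := (hg p.2 (right_ne_zero_of_mul h0)).2
      have h3 : p.1 ≠ 0 := by rintro h; rw [h] at hp; simp at hp; omega
      have h4 : p.2 ≠ 0 := by rintro h; rw [h] at hp; simp at hp; omega
      exact hp.2 ⟨⟨⟨by omega, h1⟩, ⟨by omega, h2⟩⟩, hp.1.1⟩
    · intro p hp
      simp only [Finset.mem_filter] at hp
      rw [← hp.2, hξ]; ring
  · intro p hp
    simp only [Finset.mem_product, Finset.mem_Icc] at hp ⊢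
    exact ⟨Nat.mul_pos hp.1.1 hp.2.1, Nat.mul_le_mul hp.1.2 hp.2.2⟩

lemma dir_prod {ι : Type*} (s : Finset ι) (f : ι → ArithmeticFunction ℂ) (M : ι → ℕ) (hf : ∀ i, Pc (f i) 4 (M i)) :
    Pc (∏ i ∈ s, f i) (4 ^ s.card) (∏ i ∈ s, M i) ∧ ∀ ξ : ℕ → ℂ, ξ 1 = 1 → (∀ a b, ξ (a * b) = ξ a * ξ b) → 
    ∑ n ∈ Finset.Icc 1 (∏ i ∈ s, M i), (∏ i ∈ s, f i) n * ξ n = 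
      ∏ i ∈ s, (∑ n ∈ Finset.Icc 1 (M i), f i n * ξ n) := by
  classical
  induction s using Finset.induction_on with
  | empty => 
    refine ⟨?_, fun ξ h1 _ => by simp [h1]⟩
    intro n hn
    simp only [Finset.prod_empty, ne_eq] at hn ⊢
    have : n = 1 := by
      by_contra h
      exact hn (ArithmeticFunction.one_apply_ne h)
    simp [this]
  | insert a s ha ih =>
    simp only [Finset.prod_insert ha, Finset.card_insert_of_notMem ha]
    refine ⟨?_, fun ξ h1 h2 => ?_⟩
    · have := (hf a).mul ih.1
      rwa [← pow_succ'] at this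
    · rw [dir_mul ξ h2 (hf a) ih.1, ih.2 ξ h1 h2]

end PSB

open MeasureTheory Real Complex
namespace PSB

lemma pc_coeff (z : ℕ) (k : Fin 3) (l J : ℕ) (hl : l ≤ J) (w : ℂ) (n : ℕ) (h1 : 1 ≤ n) (hn : n ≤ 2 ^ (l + 1)) :
    ‖pc z k l n * (n : ℂ) ^ w‖ ≤ (2 + J) * (1 + ‖w‖) ^ 2 * ((2 ^ (l + 1) : ℕ) : ℝ) ^ (max w.re 0) := by
  have hn1 : (1 : ℝ) ≤ n := by exact_mod_cast h1
  have hnM : (n : ℝ) ≤ ((2 ^ (l + 1) : ℕ) : ℝ) := by exact_mod_cast hn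
  have e1 : ‖(n : ℂ) ^ w‖ ≤ ((2 ^ (l + 1) : ℕ) : ℝ) ^ (max w.re 0) := by
    rw [Complex.norm_natCast_cpow_of_pos h1]
    calc (n : ℝ) ^ w.re ≤ (n : ℝ) ^ (max w.re 0) := Real.rpow_le_rpow_of_exponent_le hn1 (le_max_left _ _)
      _ ≤ _ := Real.rpow_le_rpow (by positivity) hnM (le_max_right _ _)
  have hl0 : 0 ≤ Real.log n := Real.log_nonneg hn1
  have hl1 : Real.log n ≤ 1 + J := by
    have : Real.log n ≤ Real.log ((2 ^ (l + 1) : ℕ) : ℝ) := Real.log_le_log (by linarith) hnM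
    push_cast at this
    rw [Real.log_pow] at this
    have h2 : Real.log 2 ≤ 1 := by have := Real.log_two_lt_d9; linarith
    have hlJ : (l : ℝ) ≤ J := by exact_mod_cast hl
    have : ((l + 1 : ℕ) : ℝ) * Real.log 2 ≤ (l + 1 : ℕ) * 1 := mul_le_mul_of_nonneg_left h2 (by positivity)
    push_cast at *
    linarith
  have hJ0 : (0 : ℝ) ≤ J := by positivity
  have e2 : ‖pc z k l n‖ ≤ 2 + J := by
    have hp := psiF_le ((n : ℝ) / 2 ^ l)
    fin_cases k
    · simp only [pc, ArithmeticFunction.coe_mk, Fin.zero_eta, Matrix.cons_val_zero]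
      rw [Complex.norm_real, Real.norm_eq_abs, abs_mul, abs_of_nonneg hl0]
      nlinarith [abs_nonneg (psiF ((n : ℝ) / 2 ^ l))]
    · simp only [pc, ArithmeticFunction.coe_mk, Fin.mk_one, Matrix.cons_val_one, Matrix.cons_val_zero]
      rw [Complex.norm_real, Real.norm_eq_abs]
      linarith
    · simp only [pc, ArithmeticFunction.coe_mk, Fin.reduceFinMk, Matrix.cons_val]
      split_ifs
      · have := ArithmeticFunction.abs_moebius_le_one (n := n)
        rw [Complex.norm_intCast]
        have : |((ArithmeticFunction.moebius n : ℤ) : ℝ)| ≤ 1 := by exact_mod_cast this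
        linarith
      · simp; linarith
  have e3 : 1 ≤ (1 + ‖w‖) ^ 2 := one_le_pow₀ (by linarith [norm_nonneg w])
  rw [norm_mul]
  refine mul_le_mul (e2.trans ?_) e1 (norm_nonneg _) (by positivity)
  nlinarith

lemma tuple_w (η : ℝ) (hη0 : 0 < η) (hη : η ≤ 1 / 2) : ∃ C : ℝ, 0 ≤ C ∧ ∀ (d : ℕ) [NeZero d], 2 ≤ d → 
    ∀ (r : ℕ) (κ : Fin r → Fin 3) (τ : Fin r → ℕ) (J z : ℕ), (∀ i, τ i ≤ J) →
    ∀ (t D Y W : ℝ), 1 ≤ t → 1 ≤ D → 1 ≤ W → (z : ℝ) ≤ t ^ 3 → t ^ 8 ≤ d → Y ≤ W * t ^ 15 →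
    (∀ n : ℕ, 1 ≤ n → (n : ℝ) ≤ Y → (n.divisors.card : ℝ) ≤ D) →
    ((∏ i, 2 ^ (τ i + 1) : ℕ) : ℝ) ≤ Y → ∀ w : ℂ, -1 ≤ w.re →
    ∑ χ ∈ prims d, ∏ i, ‖∑ n ∈ Finset.Icc 1 (2 ^ (τ i + 1)), pc z (κ i) (τ i) n * (χ n * (n : ℂ) ^ w)‖ ≤
      ((2 + J) * (1 + ‖w‖) ^ 2) ^ r * Y ^ (max w.re 0) * 
        (Real.sqrt ((3 + 2 * W) * (1 + C * (d : ℝ) ^ (2 * η)) * D ^ (4 * r) * t * Y) * d) := by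
  obtain ⟨C, hC0, hC⟩ := smooth_four η hη0 hη
  refine ⟨C, hC0, fun d _ hd2 r κ τ J z hτ t D Y W ht hD1 hW hz hd hY hD hMY w hw => ?_⟩
  set ρ := max w.re 0 with hρ
  set B0 : ℝ := (2 + J) * (1 + ‖w‖) ^ 2 with hB0
  have hB0p : 0 < B0 := by positivity
  set B : Fin r → ℝ := fun i => B0 * ((2 ^ (τ i + 1) : ℕ) : ℝ) ^ ρ with hB
  have hBp : ∀ i, 0 < B i := fun i => by
    have : (0 : ℝ) < ((2 ^ (τ i + 1) : ℕ) : ℝ) := by positivity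
    positivity
  set R : Fin r → DirichletCharacter ℂ d → ℂ := fun i χ => 
    ∑ n ∈ Finset.Icc 1 (2 ^ (τ i + 1)), pc z (κ i) (τ i) n * (χ n * (n : ℂ) ^ w) with hR
  have hdp : (0 : ℝ) < d := by exact_mod_cast NeZero.pos d
  have hY1 : 0 < Y := lt_of_lt_of_le (by positivity) hMY
  have key := tuple (fun i χ => (B i : ℂ)⁻¹ * R i χ) (fun i => 2 ^ (τ i + 1)) D Y W t (1 + C * (d : ℝ) ^ (2 * η))
    hD1 ht hW (by have : 0 ≤ C * (d : ℝ) ^ (2 * η) := by positivity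
                  linarith) hd hY (fun i => Nat.one_le_two_pow) ?_ ?_ hD (by exact_mod_cast hMY)
  · have e : ∑ χ ∈ prims d, ∏ i, ‖(B i : ℂ)⁻¹ * R i χ‖ = (∏ i, B i)⁻¹ * ∑ χ ∈ prims d, ∏ i, ‖R i χ‖ := by
      rw [Finset.mul_sum]
      refine Finset.sum_congr rfl fun χ _ => ?_
      rw [← Finset.prod_inv_distrib, ← Finset.prod_mul_distrib]
      refine Finset.prod_congr rfl fun i _ => ?_
      rw [norm_mul, norm_inv, Complex.norm_real, Real.norm_of_nonneg (hBp i).le]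
    rw [e] at key
    have hPB : ∏ i, B i ≤ B0 ^ r * Y ^ ρ := by
      rw [hB, Finset.prod_mul_distrib, Finset.prod_const, Finset.card_univ, Fintype.card_fin]
      refine mul_le_mul_of_nonneg_left ?_ (by positivity)
      rw [Real.finsetProd_rpow _ _ (fun i _ => by positivity)]
      refine Real.rpow_le_rpow (by positivity) ?_ (le_max_right _ _)
      exact_mod_cast hMY
    have hPBp : 0 < ∏ i, B i := Finset.prod_pos fun i _ => hBp i
    rw [Fintype.card_fin] at key
    have k2 : (∏ i, B i)⁻¹ * ∑ χ ∈ prims d, ∏ i, ‖R i χ‖ ≤ 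
        Real.sqrt ((3 + 2 * W) * (1 + C * (d : ℝ) ^ (2 * η)) * D ^ (4 * r) * t * Y) * d := by
      refine abs_le_of_sq_le_sq' ?_ (by positivity) |>.2
      rw [mul_pow _ (d : ℝ), Real.sq_sqrt (by positivity)]
      refine key.trans (le_of_eq (by ring))
    rw [inv_mul_le_iff₀ hPBp] at k2
    refine k2.trans (mul_le_mul_of_nonneg_right hPB (by positivity))
  · intro i
    refine ⟨fun n => (B i : ℂ)⁻¹ * (pc z (κ i) (τ i) n * (n : ℂ) ^ w), fun n hn => ?_, fun χ => ?_⟩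
    · have hn := Finset.mem_Icc.mp hn
      have := pc_coeff z (κ i) (τ i) J (hτ i) w n hn.1 hn.2
      rw [norm_mul, norm_inv, Complex.norm_real, Real.norm_of_nonneg (hBp i).le, inv_mul_le_iff₀ (hBp i), mul_one]
      exact this
    · simp only [hR, Finset.mul_sum]
      refine Finset.sum_congr rfl fun n _ => ?_
      ring
  · intro i
    -- the smooth case, in general form
    have smooth : ∀ p q : ℝ, |p| ≤ 1 → 0 ≤ q → q ≤ 1 + J → (∀ n ∈ Finset.Icc 1 (2 ^ (τ i + 1)), pc z (κ i) (τ i) n = 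
        ((q * psiF (n / (2 : ℝ) ^ (τ i)) + p * psiLog (n / (2 : ℝ) ^ (τ i)) : ℝ) : ℂ)) → 
        ∑ χ ∈ prims d, ‖(B i : ℂ)⁻¹ * R i χ‖ ^ 4 ≤ (1 + C * (d : ℝ) ^ (2 * η)) * d * ((2 ^ (τ i + 1) : ℕ) : ℝ) ^ 2 := by
      intro p q hp hq hqJ hpc
      have h := hC d hd2 ((2 : ℝ) ^ (τ i)) (one_le_pow₀ (by norm_num)) w hw p q hp hq (2 ^ (τ i + 1)) 
        (by push_cast; rw [pow_succ]; linarith)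
      have e1 : ∀ χ : DirichletCharacter ℂ d, R i χ = ∑ n ∈ Finset.Icc (1 : ℕ) (2 ^ (τ i + 1)), 
          (((q * psiF (n / (2 : ℝ) ^ (τ i)) + p * psiLog (n / (2 : ℝ) ^ (τ i)) : ℝ) : ℂ) * (n : ℂ) ^ w) * χ n := by
        intro χ
        rw [hR]
        refine Finset.sum_congr rfl fun n hn => ?_
        rw [hpc n hn]; ring
      simp only [← e1] at h
      have e2 : ∀ χ : DirichletCharacter ℂ d, ‖(B i : ℂ)⁻¹ * R i χ‖ ^ 4 = (B i ^ 4)⁻¹ * ‖R i χ‖ ^ 4 := by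
        intro χ
        rw [norm_mul, norm_inv, Complex.norm_real, Real.norm_of_nonneg (hBp i).le, mul_pow, inv_pow]
      simp only [e2]
      rw [← Finset.mul_sum, inv_mul_le_iff₀ (pow_pos (hBp i) 4)]
      refine h.trans ?_
      have e3 : (1 + q) * (1 + ‖w‖) ^ 2 * (2 * 2 ^ (τ i)) ^ (max w.re 0) ≤ B i := by
        rw [hB]
        simp only [hB0, ← hρ]
        push_cast
        rw [← pow_succ']
        refine mul_le_mul_of_nonneg_right ?_ (by positivity)
        refine mul_le_mul_of_nonneg_right (by linarith) (by positivity)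
      have e4 := pow_le_pow_left₀ (by positivity) e3 4
      have e5 : (d : ℝ) ^ (1 + 2 * η) = d * (d : ℝ) ^ (2 * η) := by rw [Real.rpow_add hdp, Real.rpow_one]
      rw [e5]
      calc C * ((1 + q) * (1 + ‖w‖) ^ 2 * (2 * 2 ^ (τ i)) ^ (max w.re 0)) ^ 4 * (d * (d : ℝ) ^ (2 * η)) * ((2 : ℝ) ^ τ i) ^ 2
          ≤ C * (B i ^ 4) * (d * (d : ℝ) ^ (2 * η)) * ((2 : ℝ) ^ τ i) ^ 2 := by gcongr
        _ = B i ^ 4 * ((C * (d : ℝ) ^ (2 * η)) * d * ((2 : ℝ) ^ τ i) ^ 2) := by ring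
        _ ≤ B i ^ 4 * ((1 + C * (d : ℝ) ^ (2 * η)) * d * ((2 ^ (τ i + 1) : ℕ) : ℝ) ^ 2) := by
            have := (pow_pos (hBp i) 4).le
            push_cast
            gcongr
            · linarith
            · norm_num
            · omega
    generalize hk : κ i = k at *
    fin_cases k
    · right
      have hl2 : 0 ≤ Real.log 2 := Real.log_nonneg (by norm_num)
      refine smooth 1 (τ i * Real.log 2) (by simp) (by positivity) ?_ ?_
      · have h2 : Real.log 2 ≤ 1 := by have := Real.log_two_lt_d9; linarith
        have hlJ : (τ i : ℝ) ≤ J := by exact_mod_cast hτ i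
        have : (τ i : ℝ) * Real.log 2 ≤ τ i * 1 := mul_le_mul_of_nonneg_left h2 (by positivity)
        linarith
      · intro n hn
        have hn := Finset.mem_Icc.mp hn
        have hn0 : (n : ℝ) ≠ 0 := by have : 0 < n := hn.1
                                     positivity
        simp only [pc, ArithmeticFunction.coe_mk, Fin.zero_eta, Matrix.cons_val_zero, psiLog]
        rw [Real.log_div hn0 (by positivity), Real.log_pow]
        congr 1
        ring
    · right
      refine smooth 0 1 (by simp) (by simp) (by have : (0 : ℝ) ≤ J := by positivity
                                                linarith) ?_
      intro n hn
      simp only [pc, ArithmeticFunction.coe_mk, Fin.mk_one, Matrix.cons_val_one, Matrix.cons_val_zero]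
      simp
    · by_cases hzt : 2 ^ (τ i) ≤ z
      · left
        have : ((2 ^ (τ i) : ℕ) : ℝ) ≤ z := by exact_mod_cast hzt
        push_cast at *
        rw [pow_succ]
        linarith
      · right
        have : ∀ χ, R i χ = 0 := by
          intro χ
          rw [hR]
          refine Finset.sum_eq_zero fun n hn => ?_
          rw [hk]
          simp only [pc, ArithmeticFunction.coe_mk, Fin.reduceFinMk, Matrix.cons_val]
          rw [if_neg (by omega), zero_mul]
        simp only [this]
        simp only [mul_zero, norm_zero]
        rw [Finset.sum_eq_zero (by simp)]
        positivity

end PSB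

open MeasureTheory Real Complex
namespace PSB

lemma phi_int (φ : SchwartzMap ℝ ℝ) : Integrable (fun x : ℝ => |φ x| * (1 + 7 * |x|) ^ 20) := by
  have h0 := φ.integrable_pow_mul volume 0
  have h1 := φ.integrable_pow_mul volume 20
  simp only [Real.norm_eq_abs, pow_zero, one_mul] at h0 h1
  refine Integrable.mono' ((h0.add (h1.const_mul (7 ^ 20))).const_mul (2 ^ 20)) ?_ ?_
  · exact Continuous.aestronglyMeasurable (by fun_prop)
  · refine Filter.Eventually.of_forall fun x => ?_
    simp only [Pi.add_apply]
    rw [Real.norm_of_nonneg (by positivity)]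
    have : (1 + 7 * |x|) ^ 20 ≤ 2 ^ 20 * (1 + (7 * |x|) ^ 20) := by
      have hx : 0 ≤ 7 * |x| := by positivity
      rcases le_total (7 * |x|) 1 with h | h
      · have : (1 + 7 * |x|) ^ 20 ≤ 2 ^ 20 := pow_le_pow_left₀ (by positivity) (by linarith) 20
        have : 0 ≤ (7 * |x|) ^ 20 := by positivity
        linarith
      · have : (1 + 7 * |x|) ^ 20 ≤ (2 * (7 * |x|)) ^ 20 := pow_le_pow_left₀ (by positivity) (by linarith) 20
        rw [mul_pow 2] at this
        linarith
    calc |φ x| * (1 + 7 * |x|) ^ 20 ≤ |φ x| * (2 ^ 20 * (1 + (7 * |x|) ^ 20)) := by gcongr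
      _ = _ := by ring

lemma open_fourier (φ : SchwartzMap ℝ ℝ) (N n : ℕ) (hn : 1 ≤ n) (s : ℂ) :
    fourierHat (fun x => φ x) (Real.log n / Real.log N) * (n : ℂ) ^ s = 
      ∫ x : ℝ, (φ x : ℂ) * (n : ℂ) ^ (s - 2 * π * x / Real.log N * Complex.I) := by
  rw [fourierHat, ← MeasureTheory.integral_mul_const]
  congr 1
  ext x
  have hn0 : (n : ℂ) ≠ 0 := by exact_mod_cast (by omega : n ≠ 0)
  rw [mul_assoc, Complex.cpow_sub _ _ hn0, Complex.cpow_def_of_ne_zero hn0 (_ * Complex.I), div_eq_mul_inv ((n : ℂ) ^ s), ← Complex.exp_neg, mul_comm ((n : ℂ) ^ s)]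
  congr 3
  rw [Complex.natCast_log.symm]
  push_cast
  ring

lemma cpow_cont (N n : ℕ) (hn : 1 ≤ n) (s : ℂ) : 
    Continuous (fun x : ℝ => (n : ℂ) ^ (s - 2 * π * x / Real.log N * Complex.I)) := by
  have hn0 : (n : ℂ) ≠ 0 := by exact_mod_cast (by omega : n ≠ 0)
  refine Continuous.const_cpow (by fun_prop) (Or.inl hn0)

lemma w_re (N : ℕ) (s : ℂ) (x : ℝ) : (s - 2 * π * x / Real.log N * Complex.I).re = s.re := by
  have : (2 * π * x / Real.log N * Complex.I : ℂ) = ((2 * π * x / Real.log N : ℝ) : ℂ) * Complex.I := by push_cast; ring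
  rw [this, Complex.sub_re, Complex.re_ofReal_mul, Complex.I_re, mul_zero, sub_zero]

lemma w_norm (N : ℕ) (hN : 1 ≤ Real.log N) (s : ℂ) (x : ℝ) : 
    1 + ‖s - 2 * π * x / Real.log N * Complex.I‖ ≤ (1 + ‖s‖) * (1 + 7 * |x|) := by
  have e : (2 * π * x / Real.log N * Complex.I : ℂ) = ((2 * π * x / Real.log N : ℝ) : ℂ) * Complex.I := by push_cast; ring
  rw [e]
  have h1 := norm_sub_le s (((2 * π * x / Real.log N : ℝ) : ℂ) * Complex.I)
  have h2 : ‖((2 * π * x / Real.log N : ℝ) : ℂ) * Complex.I‖ ≤ 7 * |x| := by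
    rw [norm_mul, Complex.norm_I, mul_one, Complex.norm_real, Real.norm_eq_abs, abs_div, abs_mul, 
      abs_of_pos (by positivity : 0 < 2 * π), abs_of_pos (by linarith : 0 < Real.log N)]
    refine (div_le_self (by positivity) hN).trans ?_
    have := Real.pi_lt_d2
    nlinarith [abs_nonneg x]
  nlinarith [norm_nonneg s, abs_nonneg x, mul_nonneg (norm_nonneg s) (abs_nonneg x)]

lemma phi_n_int (φ : SchwartzMap ℝ ℝ) (N n : ℕ) (hn : 1 ≤ n) (s : ℂ) : 
    Integrable (fun x : ℝ => (φ x : ℂ) * (n : ℂ) ^ (s - 2 * π * x / Real.log N * Complex.I)) := by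
  refine Integrable.mono' ((φ.integrable (μ := volume)).norm.mul_const ((n : ℝ) ^ s.re)) ?_ ?_
  · have := cpow_cont N n hn s
    exact Continuous.aestronglyMeasurable (by fun_prop)
  · refine Filter.Eventually.of_forall fun x => ?_
    rw [norm_mul, Complex.norm_real, Complex.norm_natCast_cpow_of_pos hn, w_re]

/-- opening `φ̂` for a fixed arithmetic function supported up to `P` -/
lemma open_sum (φ : SchwartzMap ℝ ℝ) (N d P : ℕ) (f : ℕ → ℂ) (s : ℂ) (χ : DirichletCharacter ℂ d) : 
    ∑ n ∈ Finset.Icc 1 P, f n * fourierHat (fun x => φ x) (Real.log n / Real.log N) * (χ n * (n : ℂ) ^ s) = 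
    ∫ x : ℝ, (φ x : ℂ) * ∑ n ∈ Finset.Icc 1 P, f n * (χ n * (n : ℂ) ^ (s - 2 * π * x / Real.log N * Complex.I)) := by
  have e1 : ∀ x : ℝ, (φ x : ℂ) * ∑ n ∈ Finset.Icc 1 P, f n * (χ n * (n : ℂ) ^ (s - 2 * π * x / Real.log N * Complex.I)) = 
      ∑ n ∈ Finset.Icc 1 P, (f n * χ n) * ((φ x : ℂ) * (n : ℂ) ^ (s - 2 * π * x / Real.log N * Complex.I)) := by
    intro x
    rw [Finset.mul_sum]
    refine Finset.sum_congr rfl fun n _ => by ring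
  simp only [e1]
  rw [MeasureTheory.integral_finsetSum _ (fun n hn => (phi_n_int φ N n (Finset.mem_Icc.mp hn).1 s).const_mul _)]
  refine Finset.sum_congr rfl fun n hn => ?_
  rw [MeasureTheory.integral_const_mul, ← open_fourier φ N n (Finset.mem_Icc.mp hn).1 s]
  ring

lemma core_tuple (φ : SchwartzMap ℝ ℝ) (η : ℝ) (hη0 : 0 < η) (hη : η ≤ 1 / 2) : 
    ∃ C : ℝ, 0 ≤ C ∧ ∃ Cφ : ℝ, 0 ≤ Cφ ∧ ∀ (N : ℕ), 1 ≤ Real.log N → ∀ (d : ℕ) [NeZero d], 2 ≤ d → 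
    ∀ (r : ℕ) (κ : Fin r → Fin 3) (τ : Fin r → ℕ) (J z Z : ℕ), r ≤ 10 → (∀ i, τ i ≤ J) →
    ∀ (t D X Y W : ℝ), 1 ≤ t → 1 ≤ D → 1 ≤ W → (z : ℝ) ≤ t ^ 3 → t ^ 8 ≤ d → Y ≤ W * t ^ 15 →
    (∀ n : ℕ, 1 ≤ n → (n : ℝ) ≤ Y → (n.divisors.card : ℝ) ≤ D) → 0 ≤ X → 4 ^ 10 * X ≤ Y →
    (X ≤ Z) → (∀ n : ℕ, 1 ≤ n → X < n → fourierHat (fun x => φ x) (Real.log n / Real.log N) = 0) →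
    ∀ s : ℂ, -1 ≤ s.re →
    ∑ χ ∈ prims d, ‖∑ n ∈ Finset.Icc 1 Z, (∏ i, pc z (κ i) (τ i)) n * 
        fourierHat (fun x => φ x) (Real.log n / Real.log N) * (χ n * (n : ℂ) ^ s)‖ ≤
      Cφ * ((2 + J) ^ 10 * (1 + ‖s‖) ^ 20 * Y ^ (max s.re 0) * 
        (Real.sqrt ((3 + 2 * W) * (1 + C * (d : ℝ) ^ (2 * η)) * D ^ 40 * t * Y) * d)) := by
  obtain ⟨C, hC0, hC⟩ := tuple_w η hη0 hη
  refine ⟨C, hC0, ∫ x : ℝ, |φ x| * (1 + 7 * |x|) ^ 20, integral_nonneg (fun x => by positivity), ?_⟩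
  intro N hN d _ hd2 r κ τ J z Z hr hτ t D X Y W ht hD1 hW hz hd hY hD hX hXY hXZ hV s hs
  set V : ℕ → ℂ := fun n => fourierHat (fun x => φ x) (Real.log n / Real.log N) with hVdef
  set P : ℕ := ∏ i, 2 ^ (τ i + 1) with hP
  set f := ∏ i, pc z (κ i) (τ i) with hf
  obtain ⟨hPc, hdir⟩ := dir_prod Finset.univ (fun i => pc z (κ i) (τ i)) (fun i => 2 ^ (τ i + 1)) (fun i => Pc_pc _ _ _)
  rw [← hf, ← hP] at hPc hdir
  have hY0 : 0 ≤ Y := by linarith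
  set E := (Real.sqrt ((3 + 2 * W) * (1 + C * (d : ℝ) ^ (2 * η)) * D ^ 40 * t * Y) * d) with hE
  have hE0 : 0 ≤ E := by positivity
  have hphi0 : 0 ≤ ∫ x : ℝ, |φ x| * (1 + 7 * |x|) ^ 20 := integral_nonneg (fun x => by positivity)
  have hPc' : ∀ n, f n ≠ 0 → P ≤ 4 ^ 10 * n ∧ n ≤ P := by
    intro n hn
    obtain ⟨h1, h2⟩ := hPc n hn
    refine ⟨h1.trans (Nat.mul_le_mul_right _ (Nat.pow_le_pow_right (by norm_num) ?_)), h2⟩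
    simpa using hr
  by_cases hPY : (P : ℝ) ≤ Y
  swap
  · rw [Finset.sum_eq_zero]
    · positivity
    intro χ _
    rw [norm_eq_zero]
    refine Finset.sum_eq_zero fun n hn => ?_
    by_cases hfn : f n = 0
    · rw [hfn]; ring
    · have h1 : (P : ℝ) ≤ 4 ^ 10 * n := by exact_mod_cast (hPc' n hfn).1
      have := hV n (Finset.mem_Icc.mp hn).1 (by push Not at hPY; linarith)
      rw [this]; ring
  -- main case
  have hsumeq : ∀ χ : DirichletCharacter ℂ d, ∑ n ∈ Finset.Icc 1 Z, f n * V n * (χ n * (n : ℂ) ^ s) = 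
      ∑ n ∈ Finset.Icc 1 P, f n * V n * (χ n * (n : ℂ) ^ s) := by
    intro χ
    have h1 : ∑ n ∈ Finset.Icc 1 Z, f n * V n * (χ n * (n : ℂ) ^ s) = 
        ∑ n ∈ Finset.Icc 1 (max Z P), f n * V n * (χ n * (n : ℂ) ^ s) := by
      refine Finset.sum_subset (Finset.Icc_subset_Icc le_rfl (le_max_left _ _)) fun n hn hn' => ?_
      have hn1 := (Finset.mem_Icc.mp hn).1
      have : Z < n := by
        by_contra h
        exact hn' (Finset.mem_Icc.mpr ⟨hn1, by omega⟩)
      rw [hVdef]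
      simp only
      rw [hV n hn1 (hXZ.trans_lt (by exact_mod_cast this))]
      ring
    have h2 : ∑ n ∈ Finset.Icc 1 P, f n * V n * (χ n * (n : ℂ) ^ s) = 
        ∑ n ∈ Finset.Icc 1 (max Z P), f n * V n * (χ n * (n : ℂ) ^ s) := by
      refine Finset.sum_subset (Finset.Icc_subset_Icc le_rfl (le_max_right _ _)) fun n hn hn' => ?_
      have hn1 := (Finset.mem_Icc.mp hn).1
      have : f n = 0 := by
        by_contra h
        exact hn' (Finset.mem_Icc.mpr ⟨hn1, (hPc' n h).2⟩)
      rw [this]; ring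
    rw [h1, h2]
  set K : ℝ := (2 + J) ^ 10 * (1 + ‖s‖) ^ 20 * Y ^ (max s.re 0) * E with hK
  set F : DirichletCharacter ℂ d → ℝ → ℂ := fun χ x => 
    ∑ n ∈ Finset.Icc 1 P, f n * (χ n * (n : ℂ) ^ (s - 2 * π * x / Real.log N * Complex.I)) with hF
  have hFb : ∀ x, ∑ χ ∈ prims d, ‖F χ x‖ ≤ K * (1 + 7 * |x|) ^ 20 := by
    intro x
    have hh := hC d hd2 r κ τ J z hτ t D Y W ht hD1 hW hz hd hY hD hPY (s - 2 * π * x / Real.log N * Complex.I) 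
      (by rw [w_re]; exact hs)
    rw [w_re] at hh
    have e1 : ∀ χ, ‖F χ x‖ = ∏ i, ‖∑ n ∈ Finset.Icc 1 (2 ^ (τ i + 1)), 
        pc z (κ i) (τ i) n * (χ n * (n : ℂ) ^ (s - 2 * π * x / Real.log N * Complex.I))‖ := by
      intro χ
      rw [← norm_prod, ← hdir (fun n => χ n * (n : ℂ) ^ (s - 2 * π * x / Real.log N * Complex.I)) (by simp) ?_]
      intro a b
      push_cast
      rw [map_mul, Complex.natCast_mul_natCast_cpow]
      ring
    simp only [e1]
    refine hh.trans ?_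
    have hw1 : 1 ≤ 1 + ‖s - 2 * π * x / Real.log N * Complex.I‖ := by linarith [norm_nonneg (s - 2 * π * x / Real.log N * Complex.I)]
    have hb1 : ((2 + J : ℝ) * (1 + ‖s - 2 * π * x / Real.log N * Complex.I‖) ^ 2) ^ r ≤ 
        (2 + J) ^ 10 * ((1 + ‖s‖) * (1 + 7 * |x|)) ^ 20 := by
      calc _ ≤ ((2 + J : ℝ) * (1 + ‖s - 2 * π * x / Real.log N * Complex.I‖) ^ 2) ^ 10 := by
            refine pow_le_pow_right₀ ?_ hr
            have : (0 : ℝ) ≤ J := by positivity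
            exact one_le_mul_of_one_le_of_one_le (by linarith) (one_le_pow₀ hw1)
        _ = (2 + J : ℝ) ^ 10 * (1 + ‖s - 2 * π * x / Real.log N * Complex.I‖) ^ 20 := by rw [mul_pow, ← pow_mul]
        _ ≤ _ := by
            refine mul_le_mul_of_nonneg_left (pow_le_pow_left₀ (by linarith) (w_norm N hN s x) 20) (by positivity)
    have hb2 : (Real.sqrt ((3 + 2 * W) * (1 + C * (d : ℝ) ^ (2 * η)) * D ^ (4 * r) * t * Y) * d) ≤ E := by
      rw [hE]
      gcongr
      omega
    calc _ ≤ ((2 + J) ^ 10 * ((1 + ‖s‖) * (1 + 7 * |x|)) ^ 20) * Y ^ (max s.re 0) * E := by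
          gcongr
      _ = _ := by
          rw [hK, mul_pow]
          generalize (1 + ‖s‖) ^ 20 = a
          generalize (1 + 7 * |x|) ^ 20 = b
          ring
  have hFc : ∀ χ, Continuous (F χ) := by
    intro χ
    refine continuous_finsetSum _ fun n hn => ?_
    have := cpow_cont N n (Finset.mem_Icc.mp hn).1 s
    fun_prop
  have hFi : ∀ χ ∈ prims d, Integrable (fun x => |φ x| * ‖F χ x‖) := by
    intro χ hχ
    refine Integrable.mono' ((phi_int φ).mul_const K) ?_ ?_
    · have := hFc χ
      exact Continuous.aestronglyMeasurable (by fun_prop)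
    · refine Filter.Eventually.of_forall fun x => ?_
      rw [Real.norm_of_nonneg (by positivity)]
      have : ‖F χ x‖ ≤ K * (1 + 7 * |x|) ^ 20 := 
        (Finset.single_le_sum (f := fun χ => ‖F χ x‖) (fun _ _ => norm_nonneg _) hχ).trans (hFb x)
      calc |φ x| * ‖F χ x‖ ≤ |φ x| * (K * (1 + 7 * |x|) ^ 20) := by gcongr
        _ = _ := by
          generalize (1 + 7 * |x|) ^ 20 = b
          ring
  calc ∑ χ ∈ prims d, ‖∑ n ∈ Finset.Icc 1 Z, f n * V n * (χ n * (n : ℂ) ^ s)‖ 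
      ≤ ∑ χ ∈ prims d, ∫ x, |φ x| * ‖F χ x‖ := by
        refine Finset.sum_le_sum fun χ _ => ?_
        rw [hsumeq, open_sum]
        refine (norm_integral_le_integral_norm _).trans (le_of_eq ?_)
        congr 1
        ext x
        rw [norm_mul, Complex.norm_real, Real.norm_eq_abs]
    _ = ∫ x, ∑ χ ∈ prims d, |φ x| * ‖F χ x‖ := (MeasureTheory.integral_finsetSum _ hFi).symm
    _ ≤ ∫ x, (|φ x| * (1 + 7 * |x|) ^ 20) * K := by
        refine integral_mono (integrable_finsetSum _ hFi) ((phi_int φ).mul_const K) fun x => ?_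
        simp only
        rw [← Finset.mul_sum]
        calc |φ x| * ∑ χ ∈ prims d, ‖F χ x‖ ≤ |φ x| * (K * (1 + 7 * |x|) ^ 20) := by gcongr; exact hFb x
          _ = _ := by
            generalize (1 + 7 * |x|) ^ 20 = b
            ring
    _ = _ := by rw [MeasureTheory.integral_mul_const]

end PSB

open MeasureTheory Real Complex
namespace PSB

lemma core_raw (φ : SchwartzMap ℝ ℝ) (η : ℝ) (hη0 : 0 < η) (hη : η ≤ 1 / 2) : 
    ∃ C : ℝ, 0 ≤ C ∧ ∃ Cφ : ℝ, 0 ≤ Cφ ∧ ∀ (N : ℕ), 1 ≤ Real.log N → ∀ (d : ℕ) [NeZero d], 2 ≤ d → 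
    ∀ (J z Z : ℕ), Z ≤ 2 ^ J → z < 2 ^ (J + 1) → 
    ∀ (t D X Y W : ℝ), 1 ≤ t → 1 ≤ D → 1 ≤ W → (z : ℝ) ≤ t ^ 3 → t ^ 3 < z + 1 → t ^ 8 ≤ d → Y ≤ W * t ^ 15 →
    (∀ n : ℕ, 1 ≤ n → (n : ℝ) ≤ Y → (n.divisors.card : ℝ) ≤ D) → 0 ≤ X → X ≤ t ^ 15 → 4 ^ 10 * X ≤ Y →
    (X ≤ Z) → (∀ n : ℕ, 1 ≤ n → X < n → fourierHat (fun x => φ x) (Real.log n / Real.log N) = 0) →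
    ∀ s : ℂ, -1 ≤ s.re →
    ∑ χ ∈ prims d, ‖∑ n ∈ Finset.Icc 1 Z, ((ArithmeticFunction.vonMangoldt n : ℝ) : ℂ) * 
        fourierHat (fun x => φ x) (Real.log n / Real.log N) * (χ n * (n : ℂ) ^ s)‖ ≤
      31 * (2 + J) ^ 10 * (Cφ * ((2 + J) ^ 10 * (1 + ‖s‖) ^ 20 * Y ^ (max s.re 0) * 
        (Real.sqrt ((3 + 2 * W) * (1 + C * (d : ℝ) ^ (2 * η)) * D ^ 40 * t * Y) * d))) := by
  obtain ⟨C, hC0, Cφ, hCφ, hmain⟩ := core_tuple φ η hη0 hη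
  refine ⟨C, hC0, Cφ, hCφ, ?_⟩
  intro N hN d _ hd2 J z Z hZJ hzJ t D X Y W ht hD1 hW hz hz1 hd hY hD hX hXt hXY hXZ hV s hs
  set V : ℕ → ℂ := fun n => fourierHat (fun x => φ x) (Real.log n / Real.log N) with hVdef
  set Bd : ℝ := Cφ * ((2 + J) ^ 10 * (1 + ‖s‖) ^ 20 * Y ^ (max s.re 0) * 
        (Real.sqrt ((3 + 2 * W) * (1 + C * (d : ℝ) ^ (2 * η)) * D ^ 40 * t * Y) * d)) with hBd
  have hY0 : 0 ≤ Y := by linarith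
  have hBd0 : 0 ≤ Bd := by positivity
  have hfull : ∀ (r : ℕ) (κ : Fin r → Fin 3), r ≤ 10 → 
      ∑ χ ∈ prims d, ‖∑ n ∈ Finset.Icc 1 Z, (∏ i, full z (κ i)) n * V n * (χ n * (n : ℂ) ^ s)‖ ≤ (2 + J) ^ 10 * Bd := by
    intro r κ hr
    set T := Fintype.piFinset (fun _ : Fin r => Finset.range (J + 1)) with hT
    have e : ∀ χ : DirichletCharacter ℂ d, ∑ n ∈ Finset.Icc 1 Z, (∏ i, full z (κ i)) n * V n * (χ n * (n : ℂ) ^ s) = 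
        ∑ τ ∈ T, ∑ n ∈ Finset.Icc 1 Z, (∏ i, pc z (κ i) (τ i)) n * V n * (χ n * (n : ℂ) ^ s) := by
      intro χ
      rw [Finset.sum_comm]
      refine Finset.sum_congr rfl fun n hn => ?_
      rw [full_expand κ z J n hzJ ((Finset.mem_Icc.mp hn).2.trans hZJ), Finset.sum_mul, Finset.sum_mul]
    calc _ ≤ ∑ χ ∈ prims d, ∑ τ ∈ T, ‖∑ n ∈ Finset.Icc 1 Z, (∏ i, pc z (κ i) (τ i)) n * V n * (χ n * (n : ℂ) ^ s)‖ := by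
          refine Finset.sum_le_sum fun χ _ => ?_
          rw [e]; exact norm_sum_le _ _
      _ = ∑ τ ∈ T, ∑ χ ∈ prims d, ‖∑ n ∈ Finset.Icc 1 Z, (∏ i, pc z (κ i) (τ i)) n * V n * (χ n * (n : ℂ) ^ s)‖ := 
          Finset.sum_comm
      _ ≤ ∑ τ ∈ T, Bd := by
          refine Finset.sum_le_sum fun τ hτ => ?_
          refine hmain N hN d hd2 r κ τ J z Z hr (fun i => ?_) t D X Y W ht hD1 hW hz hd hY hD hX hXY hXZ hV s hs
          have := Finset.mem_range.mp (Fintype.mem_piFinset.mp hτ i)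
          omega
      _ = ((J : ℝ) + 1) ^ r * Bd := by
          rw [Finset.sum_const, nsmul_eq_mul, hT, Fintype.card_piFinset]
          simp
      _ ≤ (2 + J) ^ 10 * Bd := by
          refine mul_le_mul_of_nonneg_right ?_ hBd0
          have hJ0 : (0 : ℝ) ≤ J := by positivity
          calc ((J : ℝ) + 1) ^ r ≤ (2 + J) ^ r := pow_le_pow_left₀ (by positivity) (by linarith) r
            _ ≤ _ := pow_le_pow_right₀ (by linarith) hr
  have hHB : ∀ n ∈ Finset.Icc 1 Z, ∀ χ : DirichletCharacter ℂ d, ((ArithmeticFunction.vonMangoldt n : ℝ) : ℂ) * V n * (χ n * (n : ℂ) ^ s) =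
      5 * ((∏ i, full z ((![0, 2] : Fin 2 → Fin 3) i)) n * V n * (χ n * (n : ℂ) ^ s))
      - 10 * ((∏ i, full z ((![0, 1, 2, 2] : Fin 4 → Fin 3) i)) n * V n * (χ n * (n : ℂ) ^ s))
      + 10 * ((∏ i, full z ((![0, 1, 1, 2, 2, 2] : Fin 6 → Fin 3) i)) n * V n * (χ n * (n : ℂ) ^ s))
      - 5 * ((∏ i, full z ((![0, 1, 1, 1, 2, 2, 2, 2] : Fin 8 → Fin 3) i)) n * V n * (χ n * (n : ℂ) ^ s))
      + (∏ i, full z ((![0, 1, 1, 1, 1, 2, 2, 2, 2, 2] : Fin 10 → Fin 3) i)) n * V n * (χ n * (n : ℂ) ^ s) := by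
    intro n hn χ
    by_cases hnX : X < n
    · have : V n = 0 := hV n (Finset.mem_Icc.mp hn).1 hnX
      rw [this]; ring
    · have h1 : (n : ℝ) < ((z : ℝ) + 1) ^ 5 := by
        calc (n : ℝ) ≤ t ^ 15 := by linarith
          _ = (t ^ 3) ^ 5 := by ring
          _ < _ := pow_lt_pow_left₀ hz1 (by positivity) (by norm_num)
      have h2 := heath_brown z n (by exact_mod_cast h1)
      have h3 : ((ArithmeticFunction.vonMangoldt n : ℝ) : ℂ) = lamC n := rfl
      rw [h3, h2]
      ring
  set S : (r : ℕ) → (Fin r → Fin 3) → DirichletCharacter ℂ d → ℂ := fun r κ χ => 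
    ∑ n ∈ Finset.Icc 1 Z, (∏ i, full z (κ i)) n * V n * (χ n * (n : ℂ) ^ s) with hS
  have hdec : ∀ χ : DirichletCharacter ℂ d, ‖∑ n ∈ Finset.Icc 1 Z, ((ArithmeticFunction.vonMangoldt n : ℝ) : ℂ) * V n * (χ n * (n : ℂ) ^ s)‖ ≤
      5 * ‖S 2 ![0, 2] χ‖ + 10 * ‖S 4 ![0, 1, 2, 2] χ‖ + 10 * ‖S 6 ![0, 1, 1, 2, 2, 2] χ‖ + 
      5 * ‖S 8 ![0, 1, 1, 1, 2, 2, 2, 2] χ‖ + ‖S 10 ![0, 1, 1, 1, 1, 2, 2, 2, 2, 2] χ‖ := by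
    intro χ
    rw [Finset.sum_congr rfl (fun n hn => hHB n hn χ)]
    rw [Finset.sum_add_distrib, Finset.sum_sub_distrib, Finset.sum_add_distrib, Finset.sum_sub_distrib, 
      ← Finset.mul_sum, ← Finset.mul_sum, ← Finset.mul_sum, ← Finset.mul_sum]
    refine (norm_add_le _ _).trans (add_le_add ?_ le_rfl)
    refine (norm_sub_le _ _).trans (add_le_add ?_ (by rw [norm_mul]; simp [hS]))
    refine (norm_add_le _ _).trans (add_le_add ?_ (by rw [norm_mul]; simp [hS]))
    refine (norm_sub_le _ _).trans (add_le_add ?_ (by rw [norm_mul]; simp [hS]))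
    rw [norm_mul]; simp [hS]
  refine (Finset.sum_le_sum fun χ _ => hdec χ).trans ?_
  rw [Finset.sum_add_distrib, Finset.sum_add_distrib, Finset.sum_add_distrib, Finset.sum_add_distrib, 
      ← Finset.mul_sum, ← Finset.mul_sum, ← Finset.mul_sum, ← Finset.mul_sum]
  have h2 := hfull 2 ![0, 2] (by norm_num)
  have h4 := hfull 4 ![0, 1, 2, 2] (by norm_num)
  have h6 := hfull 6 ![0, 1, 1, 2, 2, 2] (by norm_num)
  have h8 := hfull 8 ![0, 1, 1, 1, 2, 2, 2, 2] (by norm_num)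
  have h10 := hfull 10 ![0, 1, 1, 1, 1, 2, 2, 2, 2, 2] (by norm_num)
  simp only [hS]
  calc _ ≤ 5 * ((2 + J) ^ 10 * Bd) + 10 * ((2 + J) ^ 10 * Bd) + 10 * ((2 + J) ^ 10 * Bd) + 5 * ((2 + J) ^ 10 * Bd) + (2 + J) ^ 10 * Bd := by
        linarith
    _ = 31 * (2 + J) ^ 10 * Bd := by 
        generalize ((2 : ℝ) + J) ^ 10 = a
        ring

end PSB

open MeasureTheory Real Complex
namespace PSB

lemma J_bound (κ : ℝ) (hκ : 0 < κ) : ∃ C : ℝ, 0 ≤ C ∧ ∀ N : ℕ, 3 ≤ N → 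
    (2 + ((Nat.log 2 (N ^ 2) + 1 : ℕ) : ℝ)) ≤ C * (N : ℝ) ^ κ := by
  refine ⟨3 + 3 / κ, by positivity, fun N hN => ?_⟩
  have hN0 : (0 : ℝ) < N := by positivity
  have hN1 : (1 : ℝ) ≤ N := by exact_mod_cast (by omega : 1 ≤ N)
  have h1 : (1 : ℝ) ≤ (N : ℝ) ^ κ := Real.one_le_rpow hN1 hκ.le
  have h2 := Real.log_le_rpow_div hN0.le hκ
  have h3 : ((2 ^ Nat.log 2 (N ^ 2) : ℕ) : ℝ) ≤ (N : ℝ) ^ 2 := by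
    exact_mod_cast Nat.pow_log_le_self 2 (by positivity)
  have h4 := Real.log_le_log (by positivity) h3
  push_cast at h4
  rw [Real.log_pow, Real.log_pow] at h4
  have h5 := Real.log_two_gt_d9
  have h6 : (0 : ℝ) ≤ (Nat.log 2 (N ^ 2) : ℝ) := by positivity
  push_cast at h4 ⊢
  have h7 : (Nat.log 2 (N ^ 2) : ℝ) ≤ 3 * Real.log N := by nlinarith
  calc (2 : ℝ) + (Nat.log 2 (N ^ 2) + 1) ≤ 3 * 1 + 3 * Real.log N := by linarith
    _ ≤ 3 * (N : ℝ) ^ κ + 3 * ((N : ℝ) ^ κ / κ) := by linarith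
    _ = _ := by ring

set_option maxHeartbeats 1600000 in
lemma core (φ : SchwartzMap ℝ ℝ) (ε κ : ℝ) (hε0 : 0 < ε) (hε : ε ≤ 15 / 8) (hκ : 0 < κ)
    (hsupp : ∀ ξ : ℝ, 15 / 8 - ε ≤ ξ → fourierHat (fun x => φ x) ξ = 0) : 
    ∃ C : ℝ, 0 ≤ C ∧ ∀ (N : ℕ), 3 ≤ N → ∀ (d : ℕ) [NeZero d], N ≤ d → d ≤ N ^ 2 → ∀ s : ℂ, -1 ≤ s.re →
    ∑ χ ∈ prims d, ‖∑ n ∈ Finset.Icc 1 (N ^ 2), ((ArithmeticFunction.vonMangoldt n : ℝ) : ℂ) * 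
        fourierHat (fun x => φ x) (Real.log n / Real.log N) * (χ n * (n : ℂ) ^ s)‖ ≤
      C * (d * (N : ℝ) ^ (1 - ε / 2 + κ)) * (1 + ‖s‖) ^ 20 * (4 ^ 10 * (N : ℝ) ^ 2) ^ (max s.re 0) := by
  obtain ⟨η, hη0, hη1, hηκ⟩ : ∃ η : ℝ, 0 < η ∧ η ≤ 1 / 2 ∧ η ≤ κ / 8 := 
    ⟨min (1 / 2) (κ / 8), by positivity, min_le_left _ _, min_le_right _ _⟩
  obtain ⟨C, hC0, Cφ, hCφ, hmain⟩ := core_raw φ η hη0 hη1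
  obtain ⟨Cd, hCd1, hCd⟩ := divisor_bound (κ / 160) (by positivity)
  obtain ⟨CJ, hCJ0, hCJ⟩ := J_bound (κ / 80) (by positivity)
  obtain ⟨W, hW⟩ : ∃ W : ℝ, W = 4 ^ 10 := ⟨_, rfl⟩
  have hW1 : 1 ≤ W := by rw [hW]; norm_num
  refine ⟨31 * CJ ^ 10 * (Cφ * (CJ ^ 10 * Real.sqrt ((3 + 2 * W) * (1 + C) * (Cd * W ^ (κ / 160)) ^ 40 * W))), by positivity, ?_⟩
  intro N hN d _ hNd hdN s hs
  rw [← hW]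
  have hn3 : (3 : ℝ) ≤ N := by exact_mod_cast hN
  have hn0 : (0 : ℝ) < N := by linarith
  have hn1 : (1 : ℝ) ≤ N := by linarith
  set n : ℝ := (N : ℝ) with hn
  have hlog : 1 ≤ Real.log n := by
    rw [Real.le_log_iff_exp_le hn0]
    have := Real.exp_one_lt_d9
    linarith
  set J := Nat.log 2 (N ^ 2) + 1 with hJ
  have hZJ : N ^ 2 ≤ 2 ^ J := (Nat.lt_pow_succ_log_self (by norm_num) _).le
  set t : ℝ := n ^ (1 / 8 : ℝ) with ht
  have ht1 : 1 ≤ t := Real.one_le_rpow hn1 (by norm_num)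
  have tp : ∀ k : ℕ, t ^ k = n ^ ((k : ℝ) / 8) := by
    intro k
    rw [ht, ← Real.rpow_natCast, ← Real.rpow_mul hn0.le]
    congr 1; ring
  have hzt := Nat.floor_le (by positivity : 0 ≤ t ^ 3)
  have hzt1 := Nat.lt_floor_add_one (t ^ 3)
  set z := ⌊t ^ 3⌋₊ with hz
  have hzJ : z < 2 ^ (J + 1) := by
    have h1 : (z : ℝ) ≤ n ^ 2 := by
      refine hzt.trans ?_
      rw [tp, ← Real.rpow_natCast n 2]
      exact Real.rpow_le_rpow_of_exponent_le hn1 (by norm_num)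
    have h2 : z ≤ N ^ 2 := by rw [hn] at h1; exact_mod_cast h1
    have h3 : 2 ^ J < 2 ^ (J + 1) := Nat.pow_lt_pow_right (by norm_num) (by omega)
    omega
  set X : ℝ := n ^ (15 / 8 - ε) with hX
  set Y : ℝ := W * X with hY
  have hX1 : 1 ≤ X := Real.one_le_rpow hn1 (by linarith)
  have hX2 : X ≤ n ^ 2 := by
    rw [hX, ← Real.rpow_natCast n 2]
    exact Real.rpow_le_rpow_of_exponent_le hn1 (by push_cast; linarith)
  have hXt : X ≤ t ^ 15 := by
    rw [tp]
    exact Real.rpow_le_rpow_of_exponent_le hn1 (by push_cast; linarith)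
  set D : ℝ := Cd * Y ^ (κ / 160) with hD
  have hY1 : 1 ≤ Y := one_le_mul_of_one_le_of_one_le hW1 hX1
  have hD1 : 1 ≤ D := one_le_mul_of_one_le_of_one_le hCd1 (Real.one_le_rpow hY1 (by positivity))
  have hYn : Y ≤ W * n ^ 2 := mul_le_mul_of_nonneg_left hX2 (by linarith)
  have hdn : n ≤ d := by rw [hn]; exact_mod_cast hNd
  have hdn2 : (d : ℝ) ≤ n ^ 2 := by rw [hn]; exact_mod_cast hdN
  have key := hmain N hlog d (by omega) J z (N ^ 2) hZJ hzJ t D X Y W ht1 hD1 hW1 hzt hzt1 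
    (by rw [tp]; norm_num; exact hdn) (mul_le_mul_of_nonneg_left hXt (by linarith))
    (by
      intro m hm hmY
      refine (hCd m (by omega)).trans ?_
      rw [hD]
      gcongr)
    (by linarith) hXt (by rw [← hW]) (by push_cast; exact hX2)
    (by
      intro m hm hmX
      apply hsupp
      rw [le_div_iff₀ (by linarith)]
      rw [hX] at hmX
      have := Real.log_le_log (by positivity) hmX.le
      rwa [Real.log_rpow hn0] at this) s hs
  refine key.trans ?_
  have hJb := hCJ N hN
  rw [← hJ, ← hn] at hJb
  have hJ10 : (2 + (J : ℝ)) ^ 10 ≤ CJ ^ 10 * n ^ (κ / 8) := by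
    refine (pow_le_pow_left₀ (by positivity) hJb 10).trans (le_of_eq ?_)
    rw [mul_pow, ← Real.rpow_natCast (n ^ _) 10, ← Real.rpow_mul hn0.le]
    congr 2; push_cast; ring
  have hYs : Y ^ (max s.re 0) ≤ (W * n ^ 2) ^ (max s.re 0) := Real.rpow_le_rpow (by linarith) hYn (le_max_right _ _)
  have hsq : Real.sqrt ((3 + 2 * W) * (1 + C * (d : ℝ) ^ (2 * η)) * D ^ 40 * t * Y) ≤ 
      Real.sqrt ((3 + 2 * W) * (1 + C) * (Cd * W ^ (κ / 160)) ^ 40 * W) * n ^ (1 - ε / 2 + κ / 2) := by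
    have e1 : 1 + C * (d : ℝ) ^ (2 * η) ≤ (1 + C) * n ^ (κ / 2) := by
      have a1 : (d : ℝ) ^ (2 * η) ≤ n ^ (κ / 2) := by
        calc (d : ℝ) ^ (2 * η) ≤ (n ^ 2) ^ (2 * η) := Real.rpow_le_rpow (by positivity) hdn2 (by positivity)
          _ = n ^ (4 * η) := by
              rw [← Real.rpow_natCast n 2, ← Real.rpow_mul hn0.le]; congr 1; push_cast; ring
          _ ≤ _ := Real.rpow_le_rpow_of_exponent_le hn1 (by linarith)
      have a2 : 1 ≤ n ^ (κ / 2) := Real.one_le_rpow hn1 (by positivity)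
      have a3 : C * (d : ℝ) ^ (2 * η) ≤ C * n ^ (κ / 2) := mul_le_mul_of_nonneg_left a1 hC0
      linarith
    have e2 : D ^ 40 ≤ (Cd * W ^ (κ / 160)) ^ 40 * n ^ (κ / 2) := by
      have a1 : D ≤ (Cd * W ^ (κ / 160)) * n ^ (κ / 80) := by
        rw [hD, mul_assoc]
        refine mul_le_mul_of_nonneg_left ?_ (by linarith)
        refine (Real.rpow_le_rpow (by linarith) hYn (by positivity)).trans (le_of_eq ?_)
        rw [Real.mul_rpow (by linarith) (by positivity), ← Real.rpow_natCast n 2, ← Real.rpow_mul hn0.le]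
        congr 2; push_cast; ring
      refine (pow_le_pow_left₀ (by linarith) a1 40).trans (le_of_eq ?_)
      rw [mul_pow, ← Real.rpow_natCast (n ^ _) 40, ← Real.rpow_mul hn0.le]
      congr 2; push_cast; ring
    have e3 : t * Y = W * n ^ (2 - ε) := by
      rw [hY, ht, hX, mul_left_comm, ← Real.rpow_add hn0]
      congr 2; ring
    have hsqn : n ^ (1 - ε / 2 + κ / 2) = Real.sqrt (n ^ (2 - ε + κ)) := by
      rw [Real.sqrt_eq_rpow, ← Real.rpow_mul hn0.le]
      congr 1; ring
    rw [hsqn, ← Real.sqrt_mul' _ (by positivity)]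
    apply Real.sqrt_le_sqrt
    have e4 : n ^ (2 - ε + κ) = n ^ (κ / 2) * n ^ (κ / 2) * n ^ (2 - ε) := by
      rw [← Real.rpow_add hn0, ← Real.rpow_add hn0]; congr 1; ring
    rw [mul_assoc _ t Y, e3, e4]
    calc (3 + 2 * W) * (1 + C * (d : ℝ) ^ (2 * η)) * D ^ 40 * (W * n ^ (2 - ε)) 
        ≤ (3 + 2 * W) * ((1 + C) * n ^ (κ / 2)) * ((Cd * W ^ (κ / 160)) ^ 40 * n ^ (κ / 2)) * (W * n ^ (2 - ε)) := by
          gcongr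
      _ = _ := by
          generalize (Cd * W ^ (κ / 160)) ^ 40 = a
          ring
  have hfin : n ^ (1 - ε / 2 + κ / 2) * (n ^ (κ / 8) * n ^ (κ / 8)) ≤ n ^ (1 - ε / 2 + κ) := by
    rw [← Real.rpow_add hn0, ← Real.rpow_add hn0]
    exact Real.rpow_le_rpow_of_exponent_le hn1 (by linarith)
  set sq := Real.sqrt ((3 + 2 * W) * (1 + C) * (Cd * W ^ (κ / 160)) ^ 40 * W) with hsqdef
  have hsq0 : 0 ≤ sq := Real.sqrt_nonneg _
  set sqL := Real.sqrt ((3 + 2 * W) * (1 + C * (d : ℝ) ^ (2 * η)) * D ^ 40 * t * Y) with hsqL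
  set S20 := (1 + ‖s‖) ^ 20 with hS20
  have hS0 : 0 ≤ S20 := by positivity
  calc 31 * (2 + (J : ℝ)) ^ 10 * (Cφ * ((2 + (J : ℝ)) ^ 10 * S20 * Y ^ (max s.re 0) * (sqL * d)))
      ≤ 31 * (CJ ^ 10 * n ^ (κ / 8)) * (Cφ * ((CJ ^ 10 * n ^ (κ / 8)) * S20 * (W * n ^ 2) ^ (max s.re 0) * 
        ((sq * n ^ (1 - ε / 2 + κ / 2)) * d))) := by gcongr
    _ = (31 * CJ ^ 10 * (Cφ * (CJ ^ 10 * sq))) * (d * (n ^ (1 - ε / 2 + κ / 2) * (n ^ (κ / 8) * n ^ (κ / 8)))) * S20 * (W * n ^ 2) ^ (max s.re 0) := by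
        generalize (W * n ^ 2) ^ (max s.re 0) = q
        ring
    _ ≤ _ := by gcongr

end PSB

open MeasureTheory Real Complex
namespace PSB

lemma rect_id (g : ℂ → ℂ) (a b y1 y2 : ℝ) (hab : a ≤ b) (hy : y1 ≤ y2) 
    (hg : ∀ z : ℂ, a ≤ z.re → z.re ≤ b → y1 ≤ z.im → z.im ≤ y2 → DifferentiableAt ℂ g z) :
    (∫ x in a..b, g (x + (y1 : ℂ) * I)) - (∫ x in a..b, g (x + (y2 : ℂ) * I)) + 
      I * (∫ y in y1..y2, g (b + (y : ℂ) * I)) - I * (∫ y in y1..y2, g (a + (y : ℂ) * I)) = 0 := by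
  have := Complex.integral_boundary_rect_eq_zero_of_differentiableOn g ⟨a, y1⟩ ⟨b, y2⟩ (by
    intro z hz
    rw [Complex.mem_reProdIm, Set.uIcc_of_le hab, Set.uIcc_of_le hy] at hz
    exact (hg z hz.1.1 hz.1.2 hz.2.1 hz.2.2).differentiableWithinAt)
  simpa only [smul_eq_mul] using this

lemma contour (q : ℂ → ℂ) (σ δ Cq : ℝ) (hσ0 : 0 < σ) (hσ : σ < 12) (hδ : 0 < δ) (hCq : 0 ≤ Cq)
    (hq : ∀ z : ℂ, -12 ≤ z.im → z.im ≤ 0 → (1 ≤ |z.re| ∨ -σ ≤ z.im) → DifferentiableAt ℂ q z)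
    (hq2 : ∀ z : ℂ, -12 ≤ z.im → z.im ≤ 0 → 1 ≤ |z.re| → ‖q z‖ ≤ Cq * |z.re| ^ (-(1 + δ)))
    (hq3 : ∀ z : ℂ, z.im = -12 → 1 ≤ |z.re| → ‖q z‖ ≤ Cq * (|z.re| ^ 24)⁻¹)
    (hqi : Integrable (fun t : ℝ => q t)) : 
    ∃ C : ℝ, 0 ≤ C ∧ ∀ (F : ℂ → ℂ) (B S : ℝ), 0 ≤ B → (∀ z : ℂ, z.im ≤ 0 → DifferentiableAt ℂ F z) → 
      (∀ z : ℂ, -12 ≤ z.im → z.im ≤ -σ → ‖F z‖ ≤ B * (1 + |z.re|) ^ 20) →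
      (∀ z : ℂ, -12 ≤ z.im → z.im ≤ 0 → ‖F z‖ ≤ S) →
      ‖∫ t : ℝ, q t * F t‖ ≤ C * B := by
  obtain ⟨K, hK⟩ : ∃ K : ℝ, ∀ x ∈ Set.Icc (-1 : ℝ) 1, ‖q (x + ((-σ : ℝ) : ℂ) * I)‖ ≤ K := by
    refine IsCompact.exists_bound_of_continuousOn isCompact_Icc ?_
    intro x hx
    have h1 : DifferentiableAt ℂ q (x + ((-σ : ℝ) : ℂ) * I) := by
      refine hq _ ?_ ?_ (Or.inr ?_) <;> simp <;> linarith
    have : ContinuousAt (fun x : ℝ => q (x + ((-σ : ℝ) : ℂ) * I)) x := by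
      refine ContinuousAt.comp (g := q) (f := fun x : ℝ => (x : ℂ) + ((-σ : ℝ) : ℂ) * I) h1.continuousAt ?_
      fun_prop
    exact this.continuousWithinAt
  have hK0 : 0 ≤ K := (norm_nonneg _).trans (hK 0 (by simp))
  refine ⟨2 * (K * 2 ^ 20) + 2 * (Cq * 2 ^ 20) + 2 * (12 * (Cq * 2 ^ 20)), by positivity, ?_⟩
  intro F B S hB hF hF1 hF0
  have hS0 : 0 ≤ S := (norm_nonneg _).trans (hF0 0 (by simp) (by simp))
  set g : ℂ → ℂ := fun z => q z * F z with hg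
  have hgd : ∀ z : ℂ, -12 ≤ z.im → z.im ≤ 0 → (1 ≤ |z.re| ∨ -σ ≤ z.im) → DifferentiableAt ℂ g z := 
    fun z h1 h2 h3 => (hq z h1 h2 h3).mul (hF z h2)
  have hgi : Integrable (fun t : ℝ => g t) := by
    refine Integrable.mono' (hqi.norm.mul_const S) ?_ ?_
    · refine hqi.aestronglyMeasurable.mul ?_
      have : Continuous (fun t : ℝ => F t) := by
        rw [continuous_iff_continuousAt]
        intro x
        exact ContinuousAt.comp (g := F) (f := fun x : ℝ => (x : ℂ)) (hF x (by simp)).continuousAt (by fun_prop)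
      exact this.aestronglyMeasurable
    · refine Filter.Eventually.of_forall fun t => ?_
      rw [hg]
      simp only [norm_mul]
      exact mul_le_mul_of_nonneg_left (hF0 _ (by simp) (by simp)) (norm_nonneg _)
  set C0 := (2 * (K * 2 ^ 20) + 2 * (Cq * 2 ^ 20) + 2 * (12 * (Cq * 2 ^ 20))) * B with hC0
  have hT : ∀ T : ℝ, 1 < T → ‖∫ x in (-T)..T, g x‖ ≤ C0 + 2 * (Cq * T ^ (-(1 + δ)) * S * 12) := by
    intro T hT
    have R1 := rect_id g (-1) 1 (-σ) 0 (by norm_num) (by linarith) (fun z _ _ h3 h4 => hgd z (by linarith) h4 (Or.inr h3))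
    have R2 := rect_id g 1 T (-12) 0 hT.le (by norm_num) (fun z h1 _ h3 h4 => hgd z h3 h4 (Or.inl (le_trans h1 (le_abs_self _))))
    have R3 := rect_id g (-T) (-1) (-12) 0 (by linarith) (by norm_num) (fun z _ h2 h3 h4 => hgd z h3 h4 (Or.inl (by
      have := neg_le_abs z.re; linarith)))
    simp only [Complex.ofReal_zero, zero_mul, add_zero] at R1 R2 R3
    -- splitting
    have hvert : ∀ x : ℝ, 1 ≤ |x| → ∀ a b : ℝ, -12 ≤ a → a ≤ b → b ≤ 0 → IntervalIntegrable (fun y : ℝ => g (x + (y : ℂ) * I)) volume a b := by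
      intro x hx a b ha hab hb
      refine ContinuousOn.intervalIntegrable ?_
      rw [Set.uIcc_of_le hab]
      intro y hy
      have h1 : DifferentiableAt ℂ g (x + (y : ℂ) * I) := by
        refine hgd _ ?_ ?_ (Or.inl ?_) <;> simp
        · linarith [hy.1]
        · linarith [hy.2]
        · exact hx
      have : ContinuousAt (fun y : ℝ => g (x + (y : ℂ) * I)) y := by
        refine ContinuousAt.comp (g := g) (f := fun y : ℝ => (x : ℂ) + (y : ℂ) * I) h1.continuousAt ?_
        fun_prop
      exact this.continuousWithinAt
    have hs1 := intervalIntegral.integral_add_adjacent_intervals (hvert 1 (by simp) (-12) (-σ) le_rfl (by linarith) (by linarith)) 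
      (hvert 1 (by simp) (-σ) 0 (by linarith) (by linarith) le_rfl)
    have hs2 := intervalIntegral.integral_add_adjacent_intervals (hvert (-1) (by simp) (-12) (-σ) le_rfl (by linarith) (by linarith)) 
      (hvert (-1) (by simp) (-σ) 0 (by linarith) (by linarith) le_rfl)
    have hii : ∀ a b : ℝ, IntervalIntegrable (fun x : ℝ => g x) volume a b := fun a b => hgi.intervalIntegrable
    have hs3 := intervalIntegral.integral_add_adjacent_intervals (hii (-T) (-1)) (hii (-1) 1)
    have hs4 := intervalIntegral.integral_add_adjacent_intervals (hii (-T) 1) (hii 1 T)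
    have hsplit : (∫ x in (-T)..T, g x) = (∫ x in (-1 : ℝ)..1, g (x + ((-σ : ℝ) : ℂ) * I)) + 
        (∫ x in (1 : ℝ)..T, g (x + ((-12 : ℝ) : ℂ) * I)) + (∫ x in (-T)..(-1), g (x + ((-12 : ℝ) : ℂ) * I)) 
        - I * (∫ y in (-12)..(-σ), g ((1 : ℝ) + (y : ℂ) * I)) + I * (∫ y in (-12)..(-σ), g ((-1 : ℝ) + (y : ℂ) * I))
        + I * (∫ y in (-12 : ℝ)..0, g (T + (y : ℂ) * I)) - I * (∫ y in (-12 : ℝ)..0, g ((-T : ℝ) + (y : ℂ) * I)) := by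
      rw [← hs4, ← hs3]
      linear_combination (-1) * R1 - R2 - R3 + I * hs1 - I * hs2
    rw [hsplit]
    have b1 : ‖∫ x in (-1 : ℝ)..1, g (x + ((-σ : ℝ) : ℂ) * I)‖ ≤ (K * (B * 2 ^ 20)) * |1 - (-1)| := by
      refine intervalIntegral.norm_integral_le_of_norm_le_const fun x hx => ?_
      rw [Set.uIoc_of_le (by norm_num)] at hx
      have h1 := hK x ⟨hx.1.le, hx.2⟩
      have h2 := hF1 (x + ((-σ : ℝ) : ℂ) * I) (by simp; linarith) (by simp)
      simp only [hg, norm_mul]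
      refine mul_le_mul h1 (h2.trans ?_) (norm_nonneg _) hK0
      have : |((x : ℂ) + ((-σ : ℝ) : ℂ) * I).re| ≤ 1 := by simp; exact abs_le.mpr ⟨hx.1.le, hx.2⟩
      have h3 : 1 + |((x : ℂ) + ((-σ : ℝ) : ℂ) * I).re| ≤ 2 := by linarith
      exact mul_le_mul_of_nonneg_left (pow_le_pow_left₀ (by positivity) h3 20) hB
    have hor : ∀ x : ℝ, 1 ≤ |x| → ‖g (x + ((-12 : ℝ) : ℂ) * I)‖ ≤ Cq * 2 ^ 20 * B * (x ^ 2)⁻¹ := by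
      intro x hx
      have h1 := hq3 (x + ((-12 : ℝ) : ℂ) * I) (by simp) (by simpa using hx)
      have h2 := hF1 (x + ((-12 : ℝ) : ℂ) * I) (by simp) (by simp; linarith)
      have hre : ((x : ℂ) + ((-12 : ℝ) : ℂ) * I).re = x := by simp
      rw [hre] at h1 h2
      simp only [hg, norm_mul]
      refine (mul_le_mul h1 h2 (norm_nonneg _) (by positivity)).trans ?_
      have h3 : (1 + |x|) ^ 20 ≤ 2 ^ 20 * |x| ^ 22 := by
        calc (1 + |x|) ^ 20 ≤ (2 * |x|) ^ 20 := pow_le_pow_left₀ (by positivity) (by linarith) 20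
          _ = 2 ^ 20 * |x| ^ 20 := mul_pow _ _ _
          _ ≤ _ := mul_le_mul_of_nonneg_left (pow_le_pow_right₀ hx (by norm_num)) (by positivity)
      have hx0 : 0 < |x| := by linarith
      calc Cq * (|x| ^ 24)⁻¹ * (B * (1 + |x|) ^ 20) ≤ Cq * (|x| ^ 24)⁻¹ * (B * (2 ^ 20 * |x| ^ 22)) := by gcongr
        _ = Cq * 2 ^ 20 * B * (|x| ^ 2)⁻¹ := by field_simp
        _ = _ := by rw [sq_abs]
    have hint1 : ∫ x in (1 : ℝ)..T, (x ^ 2)⁻¹ ≤ 1 := by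
      have : ∫ x in (1 : ℝ)..T, (x ^ 2)⁻¹ = ∫ x in (1 : ℝ)..T, x ^ (-2 : ℤ) := by
        refine intervalIntegral.integral_congr fun x _ => ?_
        simp [zpow_neg]
      rw [this, integral_zpow (Or.inr ⟨by norm_num, by rw [Set.uIcc_of_le hT.le]; simp⟩)]
      have : 0 < T⁻¹ := by positivity
      norm_num
      linarith
    have hiv : ∀ a b : ℝ, (0 : ℝ) ∉ Set.uIcc a b → IntervalIntegrable (fun x : ℝ => Cq * 2 ^ 20 * B * (x ^ 2)⁻¹) volume a b := by
      intro a b hab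
      refine ContinuousOn.intervalIntegrable ?_
      refine ContinuousOn.mul continuousOn_const (ContinuousOn.inv₀ (by fun_prop) ?_)
      intro x hx h0
      have : x = 0 := by simpa using h0
      exact hab (this ▸ hx)
    have b2 : ‖∫ x in (1 : ℝ)..T, g (x + ((-12 : ℝ) : ℂ) * I)‖ ≤ Cq * 2 ^ 20 * B := by
      refine (intervalIntegral.norm_integral_le_of_norm_le hT.le (g := fun x => Cq * 2 ^ 20 * B * (x ^ 2)⁻¹) 
        (Filter.Eventually.of_forall fun x hx => hor x (le_trans hx.1.le (le_abs_self _))) 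
        (hiv _ _ (by rw [Set.uIcc_of_le hT.le]; simp))).trans ?_
      rw [intervalIntegral.integral_const_mul]
      have : 0 ≤ Cq * 2 ^ 20 * B := by positivity
      nlinarith
    have b3 : ‖∫ x in (-T)..(-1), g (x + ((-12 : ℝ) : ℂ) * I)‖ ≤ Cq * 2 ^ 20 * B := by
      refine (intervalIntegral.norm_integral_le_of_norm_le (by linarith) (g := fun x => Cq * 2 ^ 20 * B * (x ^ 2)⁻¹) 
        (Filter.Eventually.of_forall fun x hx => hor x (le_trans (by linarith [hx.2]) (neg_le_abs _))) 
        (hiv _ _ (by rw [Set.uIcc_of_le (by linarith)]; simp))).trans ?_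
      rw [intervalIntegral.integral_const_mul]
      have h0 : 0 ≤ Cq * 2 ^ 20 * B := by positivity
      have : ∫ x in (-T)..(-1), (x ^ 2)⁻¹ = ∫ x in (1 : ℝ)..T, (x ^ 2)⁻¹ := by
        have := intervalIntegral.integral_comp_neg (a := 1) (b := T) (fun x : ℝ => (x ^ 2)⁻¹)
        simp only [neg_sq] at this
        exact this.symm
      rw [this]
      nlinarith
    have vb : ∀ x : ℝ, |x| = 1 → ‖∫ y in (-12)..(-σ), g (x + (y : ℂ) * I)‖ ≤ 12 * (Cq * 2 ^ 20) * B := by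
      intro x hx
      have : ‖∫ y in (-12)..(-σ), g (x + (y : ℂ) * I)‖ ≤ (Cq * (B * 2 ^ 20)) * |-σ - (-12)| := by
        refine intervalIntegral.norm_integral_le_of_norm_le_const fun y hy => ?_
        rw [Set.uIoc_of_le (by linarith)] at hy
        have hre : ((x : ℂ) + (y : ℂ) * I).re = x := by simp
        have him : ((x : ℂ) + (y : ℂ) * I).im = y := by simp
        have h1 := hq2 (x + (y : ℂ) * I) (by rw [him]; exact hy.1.le) (by rw [him]; linarith [hy.2]) (by rw [hre, hx])
        have h2 := hF1 (x + (y : ℂ) * I) (by rw [him]; exact hy.1.le) (by rw [him]; linarith [hy.2])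
        rw [hre, hx] at h1 h2
        rw [Real.one_rpow, mul_one] at h1
        norm_num at h2
        simp only [hg, norm_mul]
        refine mul_le_mul h1 (h2.trans (by norm_num)) (norm_nonneg _) hCq
      refine this.trans ?_
      rw [abs_of_nonneg (by linarith)]
      have h0 : 0 ≤ Cq * (B * 2 ^ 20) := by positivity
      nlinarith
    have vT : ∀ x : ℝ, |x| = T → ‖∫ y in (-12 : ℝ)..0, g (x + (y : ℂ) * I)‖ ≤ Cq * T ^ (-(1 + δ)) * S * 12 := by
      intro x hx
      have : ‖∫ y in (-12 : ℝ)..0, g (x + (y : ℂ) * I)‖ ≤ (Cq * T ^ (-(1 + δ)) * S) * |0 - (-12)| := by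
        refine intervalIntegral.norm_integral_le_of_norm_le_const fun y hy => ?_
        rw [Set.uIoc_of_le (by linarith)] at hy
        have hre : ((x : ℂ) + (y : ℂ) * I).re = x := by simp
        have him : ((x : ℂ) + (y : ℂ) * I).im = y := by simp
        have h1 := hq2 (x + (y : ℂ) * I) (by rw [him]; exact hy.1.le) (by rw [him]; linarith [hy.2]) (by rw [hre, hx]; exact hT.le)
        have h2 := hF0 (x + (y : ℂ) * I) (by rw [him]; exact hy.1.le) (by rw [him]; linarith [hy.2])
        rw [hre, hx] at h1
        simp only [hg, norm_mul]
        exact mul_le_mul h1 h2 (norm_nonneg _) (by positivity)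
      refine this.trans (le_of_eq ?_)
      norm_num
    have v1 := vb 1 (by simp)
    have v2 := vb (-1) (by simp)
    have v3 := vT T (abs_of_pos (by linarith))
    have v4 := vT (-T) (by rw [abs_neg]; exact abs_of_pos (by linarith))
    have hI : ∀ w : ℂ, ‖I * w‖ = ‖w‖ := fun w => by simp
    refine (norm_sub_le _ _).trans ?_
    refine (add_le_add (norm_add_le _ _) le_rfl).trans ?_
    refine (add_le_add (add_le_add (norm_add_le _ _) le_rfl) le_rfl).trans ?_
    refine (add_le_add (add_le_add (add_le_add (norm_sub_le _ _) le_rfl) le_rfl) le_rfl).trans ?_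
    refine (add_le_add (add_le_add (add_le_add (add_le_add (norm_add_le _ _) le_rfl) le_rfl) le_rfl) le_rfl).trans ?_
    refine (add_le_add (add_le_add (add_le_add (add_le_add (add_le_add (norm_add_le _ _) le_rfl) le_rfl) le_rfl) le_rfl) le_rfl).trans ?_
    simp only [hI]
    norm_num at b1
    rw [hC0]
    norm_num at *
    linarith
  have hlim := MeasureTheory.intervalIntegral_tendsto_integral hgi (Filter.tendsto_neg_atTop_atBot) Filter.tendsto_id
  have hlim2 : Filter.Tendsto (fun T : ℝ => C0 + 2 * (Cq * T ^ (-(1 + δ)) * S * 12)) Filter.atTop (nhds (C0 + 2 * (Cq * 0 * S * 12))) := by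
    have := tendsto_rpow_neg_atTop (y := 1 + δ) (by linarith)
    exact ((((this.const_mul Cq).mul_const S).mul_const 12).const_mul 2).const_add C0
  simp only [mul_zero, zero_mul, add_zero] at hlim2
  refine le_of_tendsto_of_tendsto hlim.norm hlim2 ?_
  filter_upwards [Filter.eventually_gt_atTop 1] with T hT'
  exact hT T hT'

end PSB

open MeasureTheory Real Complex
namespace PSB

lemma gamma_shift (m : ℕ) (w : ℂ) (hw : 0 ≤ w.re) :
    Complex.Gamma (m + w + 1) = (∏ j ∈ Finset.range m, ((j : ℂ) + 1 + w)) * Complex.Gamma (1 + w) := by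
  induction m with
  | zero => simp [add_comm]
  | succ m ih =>
    rw [Finset.prod_range_succ]
    have h0 : (m : ℂ) + w + 1 ≠ 0 := by
      intro h
      have := congrArg Complex.re h
      simp at this
      have : (0 : ℝ) ≤ m := Nat.cast_nonneg m
      linarith
    have h1 := Complex.Gamma_add_one _ h0
    have e : ((m + 1 : ℕ) : ℂ) + w + 1 = (m : ℂ) + w + 1 + 1 := by push_cast; ring
    rw [e, h1, ih]
    ring

lemma gamma_sq (T : ℝ) (hT : T ≠ 0) : ‖Complex.Gamma (1 + T * I)‖ ^ 2 * Real.sinh (π * T) = π * T := by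
  have hTI : (T : ℂ) * I ≠ 0 := by simp [hT]
  have h1 : Complex.Gamma (1 + T * I) = T * I * Complex.Gamma (T * I) := by
    rw [add_comm, Complex.Gamma_add_one _ hTI]
  have h2 := Complex.Gamma_mul_Gamma_one_sub ((T : ℂ) * I)
  have h3 : Complex.Gamma (1 - T * I) = (starRingEnd ℂ) (Complex.Gamma (1 + T * I)) := by
    rw [← Complex.Gamma_conj]; simp [sub_eq_add_neg]
  have h4 : ((‖Complex.Gamma (1 + T * I)‖ ^ 2 : ℝ) : ℂ) = Complex.Gamma (1 + T * I) * Complex.Gamma (1 - T * I) := by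
    rw [h3, Complex.mul_conj, Complex.normSq_eq_norm_sq]
  have h5 : Complex.sin (π * (T * I)) = Real.sinh (π * T) * I := by
    rw [← mul_assoc, Complex.sin_mul_I]
    push_cast; rfl
  have hs : Real.sinh (π * T) ≠ 0 := by
    rw [Ne, Real.sinh_eq_zero]
    exact mul_ne_zero Real.pi_ne_zero hT
  have hs' : (Real.sinh (π * T) : ℂ) ≠ 0 := by exact_mod_cast hs
  have : ((‖Complex.Gamma (1 + T * I)‖ ^ 2 * Real.sinh (π * T) : ℝ) : ℂ) = ((π * T : ℝ) : ℂ) := by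
    rw [Complex.ofReal_mul, h4, h1, mul_assoc, mul_assoc, mul_assoc, ← mul_assoc (Complex.Gamma _), h2, h5]
    push_cast
    push_cast at hs'
    field_simp
    rw [mul_comm (T : ℂ) (π : ℂ)]
    exact mul_div_cancel_right₀ _ hs'
  exact_mod_cast this

lemma gamma_cosh (u : ℝ) : 1 ≤ ‖Complex.Gamma (1 + 2 * I * u)‖ * Real.cosh (π * u) := by
  by_cases hu : u = 0
  · subst hu; simp
  have h := gamma_sq (2 * u) (by simpa using hu)
  have e : (1 : ℂ) + ((2 * u : ℝ) : ℂ) * I = 1 + 2 * I * u := by push_cast; ring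
  rw [e] at h
  have hs : Real.sinh (π * (2 * u)) = 2 * Real.sinh (π * u) * Real.cosh (π * u) := by
    rw [← Real.sinh_two_mul]; ring_nf
  rw [hs] at h
  set G := ‖Complex.Gamma (1 + 2 * I * u)‖ with hG
  have hG0 : 0 ≤ G := norm_nonneg _
  set x := π * u with hx
  have hx0 : x ≠ 0 := mul_ne_zero Real.pi_ne_zero hu
  have hc : 0 < Real.cosh x := Real.cosh_pos x
  -- G^2 sinh cosh = x
  have h1 : G ^ 2 * (Real.sinh x * Real.cosh x) = x := by
    have : π * (2 * u) = 2 * x := by rw [hx]; ring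
    rw [this] at h; linarith
  have key : ∀ y : ℝ, 0 ≤ y → Real.sinh y ≤ y * Real.cosh y := by
    intro y hy
    have hmono : MonotoneOn (fun y : ℝ => y * Real.cosh y - Real.sinh y) (Set.Ici 0) := by
      refine monotoneOn_of_deriv_nonneg (convex_Ici 0) (by fun_prop) (by fun_prop) ?_
      intro z hz
      simp only [interior_Ici, Set.mem_Ioi] at hz
      have hd : HasDerivAt (fun y : ℝ => y * Real.cosh y - Real.sinh y) (1 * Real.cosh z + z * Real.sinh z - Real.cosh z) z :=
        ((hasDerivAt_id z).mul (Real.hasDerivAt_cosh z)).sub (Real.hasDerivAt_sinh z)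
      rw [hd.deriv]
      have := (Real.sinh_pos_iff.mpr hz).le
      nlinarith
    have := hmono (Set.mem_Ici.mpr le_rfl) (Set.mem_Ici.mpr hy) hy
    simp at this
    linarith
  have key2 : Real.sinh x ^ 2 ≤ Real.sinh x * (x * Real.cosh x) := by
    rcases le_total 0 x with h0 | h0
    · have := key x h0
      have h3 := Real.sinh_nonneg_iff.mpr h0
      nlinarith
    · have := key (-x) (by linarith)
      rw [Real.sinh_neg, Real.cosh_neg] at this
      have h3 := Real.sinh_nonpos_iff.mpr h0
      nlinarith
  have hsx : Real.sinh x ≠ 0 := by rwa [Ne, Real.sinh_eq_zero]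
  have hs2 : 0 < Real.sinh x ^ 2 := by positivity
  have : 1 ≤ (G * Real.cosh x) ^ 2 := by
    have e2 : (G * Real.cosh x) ^ 2 * Real.sinh x ^ 2 = Real.sinh x * (x * Real.cosh x) := by
      calc _ = (G ^ 2 * (Real.sinh x * Real.cosh x)) * (Real.sinh x * Real.cosh x) := by ring
        _ = _ := by rw [h1]; ring
    by_contra hcon
    push Not at hcon
    nlinarith
  have hp : 0 ≤ G * Real.cosh x := by positivity
  nlinarith

lemma gamma_beta (b T : ℝ) (hb : 0 < b) : ‖Complex.Gamma (1 + T * I)‖ * Real.Gamma (b + 1) ≤ ‖Complex.Gamma (1 + b + T * I)‖ := by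
  have h := Complex.Gamma_mul_Gamma_eq_betaIntegral (s := 1 + T * I) (t := (b : ℂ)) (by simp) (by simpa using hb)
  have hB : ‖Complex.betaIntegral (1 + T * I) b‖ ≤ 1 / b := by
    unfold Complex.betaIntegral
    have hi : ∫ x in (0 : ℝ)..1, (1 - x) ^ (b - 1) = 1 / b := by
      have := intervalIntegral.integral_comp_sub_left (a := 0) (b := 1) (fun x : ℝ => x ^ (b - 1)) 1
      rw [this, integral_rpow (Or.inl (by linarith))]
      have hb' : b ≠ 0 := hb.ne'
      simp [Real.zero_rpow hb']
    rw [← hi]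
    refine intervalIntegral.norm_integral_le_of_norm_le (by norm_num) ?_ ?_
    · have : ∀ᵐ x : ℝ ∂volume, x ≠ 1 := by
        simp [ae_iff]
      filter_upwards [this] with x hx1 hx
      have h1 : 0 < 1 - x := by
        rcases lt_or_eq_of_le hx.2 with h | h
        · linarith
        · exact absurd h hx1
      rw [norm_mul]
      have e1 : ‖(x : ℂ) ^ ((1 : ℂ) + T * I - 1)‖ = 1 := by
        rw [Complex.norm_cpow_eq_rpow_re_of_pos hx.1]; simp
      have e2 : ‖(1 - (x : ℂ)) ^ ((b : ℂ) - 1)‖ = (1 - x) ^ (b - 1) := by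
        have : (1 - (x : ℂ)) = ((1 - x : ℝ) : ℂ) := by push_cast; rfl
        rw [this, Complex.norm_cpow_eq_rpow_re_of_pos h1]; simp
      rw [e1, e2, one_mul]
    · have : IntervalIntegrable (fun x : ℝ => x ^ (b - 1)) volume 0 1 :=
        intervalIntegral.intervalIntegrable_rpow' (by linarith)
      have := (this.comp_sub_left 1).symm
      simpa using this
  have hn := congrArg norm h
  rw [norm_mul, norm_mul, Complex.Gamma_ofReal] at hn
  have hg : 0 < Real.Gamma b := Real.Gamma_pos_of_pos hb
  rw [Complex.norm_real, Real.norm_of_nonneg hg.le] at hn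
  have e : (1 : ℂ) + T * I + b = 1 + b + T * I := by ring
  rw [e] at hn
  rw [Real.Gamma_add_one hb.ne']
  have : ‖Complex.Gamma (1 + T * I)‖ * Real.Gamma b ≤ ‖Complex.Gamma (1 + b + T * I)‖ * (1 / b) := by
    rw [hn]; exact mul_le_mul_of_nonneg_left hB (norm_nonneg _)
  calc _ = (‖Complex.Gamma (1 + T * I)‖ * Real.Gamma b) * b := by ring
    _ ≤ (‖Complex.Gamma (1 + b + T * I)‖ * (1 / b)) * b := mul_le_mul_of_nonneg_right this hb.le
    _ = _ := by field_simp

lemma gamma_lower : ∃ g : ℝ, 0 < g ∧ g ≤ 1 ∧ ∀ u y : ℝ, 0 ≤ y → y ≤ 12 →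
    g * ‖Complex.Gamma (1 + 2 * I * u)‖ ≤ ‖Complex.Gamma (1 + 2 * I * ((u : ℂ) + ((-y : ℝ) : ℂ) * I))‖ := by
  have hcont : ContinuousOn Real.Gamma (Set.Icc 1 25) := by
    intro x hx
    have : ∀ m : ℕ, x ≠ -m := by
      intro m h
      have : (0 : ℝ) ≤ m := Nat.cast_nonneg m
      linarith [hx.1]
    exact (Real.differentiableAt_Gamma this).continuousAt.continuousWithinAt
  obtain ⟨x0, hx0, hmin⟩ := isCompact_Icc.exists_isMinOn (Set.nonempty_Icc.mpr (by norm_num : (1 : ℝ) ≤ 25)) hcont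
  refine ⟨Real.Gamma x0, Real.Gamma_pos_of_pos (by linarith [hx0.1]), ?_, ?_⟩
  · have := hmin (Set.left_mem_Icc.mpr (by norm_num : (1 : ℝ) ≤ 25))
    simpa using this
  intro u y hy hy2
  have e : (1 : ℂ) + 2 * I * ((u : ℂ) + ((-y : ℝ) : ℂ) * I) = 1 + ((2 * y : ℝ) : ℂ) + ((2 * u : ℝ) : ℂ) * I := by
    push_cast; linear_combination (-2 * (y : ℂ)) * Complex.I_mul_I
  have e' : (1 : ℂ) + 2 * I * (u : ℂ) = 1 + ((2 * u : ℝ) : ℂ) * I := by push_cast; ring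
  rw [e, e']
  rcases hy.eq_or_lt with h0 | h0
  · subst h0
    have := hmin (Set.left_mem_Icc.mpr (by norm_num : (1 : ℝ) ≤ 25))
    simp at this
    simp only [mul_zero, Complex.ofReal_zero, add_zero]
    exact mul_le_of_le_one_left (norm_nonneg _) this
  · have h1 := gamma_beta (2 * y) (2 * u) (by linarith)
    refine le_trans ?_ h1
    rw [mul_comm]
    refine mul_le_mul_of_nonneg_left (hmin ⟨by linarith, by linarith⟩) (norm_nonneg _)

lemma cosh_normsq (u y : ℝ) : ‖Complex.cosh (π * ((u : ℂ) + (y : ℂ) * I))‖ ^ 2 = Real.sinh (π * u) ^ 2 + Real.cos (π * y) ^ 2 := by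
  have e : (π : ℂ) * ((u : ℂ) + (y : ℂ) * I) = ((π * u : ℝ) : ℂ) + ((π * y : ℝ) : ℂ) * I := by push_cast; ring
  rw [e, Complex.cosh_add, Complex.cosh_mul_I, Complex.sinh_mul_I, ← Complex.ofReal_cosh, ← Complex.ofReal_sinh,
    ← Complex.ofReal_cos, ← Complex.ofReal_sin, ← Complex.normSq_eq_norm_sq, Complex.normSq_apply]
  have a := Real.cosh_sq (π * u)
  have b := Real.sin_sq_add_cos_sq (π * y)
  simp only [add_re, add_im, mul_re, mul_im, ofReal_re, ofReal_im, I_re, I_im]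
  ring_nf
  rw [a]
  generalize Real.sinh (π * u) = S at *
  generalize Real.cos (π * y) = D at *
  have b' : Real.sin (π * y) ^ 2 = 1 - D ^ 2 := by linarith
  rw [b']; ring

lemma cosh_lower (u y : ℝ) (hu : 1 ≤ |u|) : Real.cosh (π * u) / 2 ≤ ‖Complex.cosh (π * ((u : ℂ) + (y : ℂ) * I))‖ := by
  have h1 := cosh_normsq u y
  have h2 : Real.cosh (π * u) ^ 2 / 4 ≤ Real.sinh (π * u) ^ 2 := by
    have h3 : 1 ≤ Real.sinh (π * u) ^ 2 := by
      have : 1 ≤ |Real.sinh (π * u)| := by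
        rw [Real.abs_sinh]
        have h4 : 1 ≤ |π * u| := by
          rw [abs_mul, abs_of_pos Real.pi_pos]
          nlinarith [Real.pi_gt_three]
        exact h4.trans (Real.self_le_sinh_iff.mpr (by linarith))
      rw [← sq_abs]; nlinarith
    rw [Real.cosh_sq]; linarith
  have hc := Real.cosh_pos (π * u)
  refine le_of_sq_le_sq ?_ (norm_nonneg _)
  rw [h1]
  nlinarith [sq_nonneg (Real.cos (π * y))]

end PSB

open MeasureTheory Real Complex
namespace PSB

noncomputable def qF (H : ℂ → ℂ) (z : ℂ) : ℂ := H z * z * (Complex.cosh (π * z))⁻¹ * (Complex.Gamma (1 + 2 * I * z))⁻¹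

lemma cosh_ne (z : ℂ) (h : z.re ≠ 0 ∨ |z.im| < 1 / 2) : Complex.cosh (π * z) ≠ 0 := by
  intro h0
  have h1 := cosh_normsq z.re z.im
  rw [Complex.re_add_im, h0] at h1
  simp only [norm_zero] at h1
  have hs : Real.sinh (π * z.re) = 0 := by nlinarith [sq_nonneg (Real.sinh (π * z.re)), sq_nonneg (Real.cos (π * z.im))]
  have hc : Real.cos (π * z.im) = 0 := by nlinarith [sq_nonneg (Real.sinh (π * z.re)), sq_nonneg (Real.cos (π * z.im))]
  rcases h with h | h
  · rw [Real.sinh_eq_zero] at hs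
    exact mul_ne_zero Real.pi_ne_zero h hs
  · have hp := Real.pi_pos
    rw [abs_lt] at h
    have := Real.cos_pos_of_mem_Ioo (x := π * z.im) ⟨by nlinarith, by nlinarith⟩
    linarith

lemma qF_diff (A δ : ℝ) (hA : 13 < A) (h : ℝ → ℝ) (H : ℂ → ℂ) (hh : IsInHClass A δ h H) (z : ℂ)
    (h1 : |z.im| ≤ 12) (h2 : z.re ≠ 0 ∨ |z.im| < 1 / 2) : DifferentiableAt ℂ (qF H) z := by
  unfold qF
  have d1 : DifferentiableAt ℂ H z := by
    refine hh.holo.differentiableAt ?_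
    have ho : IsOpen {s : ℂ | |s.im| < A} := isOpen_lt (by fun_prop) (by fun_prop)
    refine Filter.mem_of_superset (ho.mem_nhds (show |z.im| < A by linarith)) ?_
    intro s hs
    have hs' : |s.im| < A := hs
    exact hs'.le
  have d2 : DifferentiableAt ℂ (fun z : ℂ => (Complex.cosh (π * z))⁻¹) z :=
    DifferentiableAt.inv (by fun_prop) (cosh_ne z h2)
  have d3 : DifferentiableAt ℂ (fun z : ℂ => (Complex.Gamma (1 + 2 * I * z))⁻¹) z :=
    (Complex.differentiable_one_div_Gamma _).comp z (by fun_prop)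
  exact ((d1.mul differentiableAt_id).mul d2).mul d3

lemma H_bound (A δ : ℝ) (hA : 13 < A) (h : ℝ → ℝ) (H : ℂ → ℂ) (hh : IsInHClass A δ h H) :
    ∃ C : ℝ, 0 ≤ C ∧ ∀ z : ℂ, |z.im| ≤ 12 → ‖H z * z‖ ≤ C * (1 + ‖z‖) ^ (-(1 + δ)) := by
  obtain ⟨C, hC⟩ := hh.bound
  have hC0 : 0 ≤ C := by
    have := (norm_nonneg _).trans (hC 0 (by simp; linarith))
    simpa using this
  refine ⟨C, hC0, fun z hz => ?_⟩
  rw [norm_mul]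
  have h1 := hC z (by linarith)
  have hp : 0 < 1 + ‖z‖ := by positivity
  calc ‖H z‖ * ‖z‖ ≤ C * (1 + ‖z‖) ^ (-(2 + δ)) * (1 + ‖z‖) := by
        refine mul_le_mul h1 (by linarith) (norm_nonneg _) (by positivity)
    _ = C * ((1 + ‖z‖) ^ (-(2 + δ)) * (1 + ‖z‖) ^ (1 : ℝ)) := by rw [Real.rpow_one]; ring
    _ = _ := by rw [← Real.rpow_add hp]; ring_nf

lemma gam_ne (z : ℂ) (hz : z.im ≤ 0) : Complex.Gamma (1 + 2 * I * z) ≠ 0 := by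
  refine Complex.Gamma_ne_zero_of_re_pos ?_
  simp
  linarith

lemma qF_real (A δ : ℝ) (hA : 13 < A) (hδ : 0 < δ) (h : ℝ → ℝ) (H : ℂ → ℂ) (hh : IsInHClass A δ h H) :
    Integrable (fun t : ℝ => qF H t) := by
  obtain ⟨C, hC0, hC⟩ := H_bound A δ hA h H hh
  have hi : Integrable (fun t : ℝ => C * (1 + ‖t‖) ^ (-(1 + δ))) := by
    refine (integrable_one_add_norm (by simp; linarith)).const_mul C
  refine hi.mono' ?_ ?_
  · refine Continuous.aestronglyMeasurable ?_
    rw [continuous_iff_continuousAt]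
    intro t
    exact ContinuousAt.comp (g := qF H) (f := fun t : ℝ => (t : ℂ))
      (qF_diff A δ hA h H hh t (by simp) (Or.inr (by simp))).continuousAt (by fun_prop)
  · filter_upwards with t
    have h1 := hC t (by simp)
    have h2 := gamma_cosh t
    unfold qF
    rw [norm_mul, norm_mul, mul_assoc]
    have e : Complex.cosh (π * t) = (Real.cosh (π * t) : ℂ) := by push_cast; rfl
    rw [e, norm_inv, norm_inv, Complex.norm_real, Real.norm_of_nonneg (Real.cosh_pos _).le, ← mul_inv]
    have h3 : (Real.cosh (π * t) * ‖Complex.Gamma (1 + 2 * I * t)‖)⁻¹ ≤ 1 :=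
      inv_le_one_of_one_le₀ (by rw [mul_comm]; exact h2)
    refine (mul_le_mul h1 h3 (by have := Real.cosh_pos (π * t); positivity) (by positivity)).trans ?_
    simp

lemma qF_bounds (A δ : ℝ) (hA : 13 < A) (hδ : 0 < δ) (h : ℝ → ℝ) (H : ℂ → ℂ) (hh : IsInHClass A δ h H) :
    ∃ C : ℝ, 0 ≤ C ∧ (∀ z : ℂ, -12 ≤ z.im → z.im ≤ 0 → 1 ≤ |z.re| → ‖qF H z‖ ≤ C * |z.re| ^ (-(1 + δ))) ∧ 
     (∀ z : ℂ, z.im = -12 → 1 ≤ |z.re| → ‖qF H z‖ ≤ C * (|z.re| ^ 24)⁻¹) := by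
  obtain ⟨C, hC0, hC⟩ := H_bound A δ hA h H hh
  obtain ⟨g, hg, hg1, hgl⟩ := gamma_lower
  have hCle : C ≤ C / g := by rw [le_div_iff₀ hg]; nlinarith
  have main : ∀ z : ℂ, ∀ k : ℝ, 0 < k → 1 ≤ |z.re| → k * ‖Complex.Gamma (1 + 2 * I * z.re)‖ ≤ ‖Complex.Gamma (1 + 2 * I * z)‖ →
      ‖(Complex.cosh (π * z))⁻¹ * (Complex.Gamma (1 + 2 * I * z))⁻¹‖ ≤ 2 / k := by
    intro z k hk hz hG
    have h1 := cosh_lower z.re z.im hz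
    rw [Complex.re_add_im] at h1
    have h2 := gamma_cosh z.re
    rw [norm_mul, norm_inv, norm_inv, ← mul_inv]
    have h3 : k / 2 ≤ ‖Complex.cosh (π * z)‖ * ‖Complex.Gamma (1 + 2 * I * z)‖ := by
      calc k / 2 ≤ (Real.cosh (π * z.re) / 2) * (k * ‖Complex.Gamma (1 + 2 * I * z.re)‖) := by nlinarith
        _ ≤ _ := mul_le_mul h1 hG (by positivity) (norm_nonneg _)
    calc _ ≤ (k / 2)⁻¹ := inv_anti₀ (by positivity) h3
      _ = _ := by rw [inv_div]
  refine ⟨2 * (C / g), by positivity, ?_, ?_⟩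
  · intro z h1 h2 h3
    have hz : |z.im| ≤ 12 := abs_le.mpr ⟨h1, by linarith⟩
    have h4 := hgl z.re (-z.im) (by linarith) (by linarith)
    rw [neg_neg, Complex.re_add_im] at h4
    have h5 := main z g hg h3 h4
    have h6 := hC z hz
    unfold qF
    rw [mul_assoc, norm_mul]
    have h7 : (1 + ‖z‖) ^ (-(1 + δ)) ≤ |z.re| ^ (-(1 + δ)) := by
      refine Real.rpow_le_rpow_of_nonpos (by linarith) ?_ (by linarith)
      have := Complex.abs_re_le_norm z
      linarith
    calc _ ≤ C * |z.re| ^ (-(1 + δ)) * (2 / g) := 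
          mul_le_mul (h6.trans (mul_le_mul_of_nonneg_left h7 hC0)) h5 (norm_nonneg _) (by positivity)
      _ = _ := by ring
  · intro z h1 h3
    have hz : |z.im| ≤ 12 := by rw [h1]; norm_num
    have hG : |z.re| ^ 24 * ‖Complex.Gamma (1 + 2 * I * z.re)‖ ≤ ‖Complex.Gamma (1 + 2 * I * z)‖ := by
      have e : (1 : ℂ) + 2 * I * z = ((24 : ℕ) : ℂ) + 2 * I * z.re + 1 := by
        conv_lhs => rw [← Complex.re_add_im z, h1]
        push_cast
        linear_combination (-24 : ℂ) * Complex.I_mul_I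
      rw [e, gamma_shift 24 _ (by simp), norm_mul, norm_prod]
      refine mul_le_mul_of_nonneg_right ?_ (norm_nonneg _)
      rw [← Finset.card_range 24, ← Finset.prod_const]
      simp only [Finset.card_range]
      refine Finset.prod_le_prod (fun i _ => abs_nonneg _) fun i _ => ?_
      have h8 := Complex.abs_im_le_norm ((i : ℂ) + 1 + 2 * I * z.re)
      simp at h8
      refine le_trans ?_ h8
      linarith
    have h5 := main z (|z.re| ^ 24) (by positivity) h3 hG
    have h6 := hC z hz
    have h7 : (1 + ‖z‖) ^ (-(1 + δ)) ≤ 1 := by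
      refine Real.rpow_le_one_of_one_le_of_nonpos ?_ (by linarith)
      have := norm_nonneg z
      linarith
    unfold qF
    rw [mul_assoc, norm_mul]
    calc _ ≤ (C / g) * (2 / |z.re| ^ 24) := 
          mul_le_mul ((h6.trans (mul_le_of_le_one_right hC0 h7)).trans hCle) h5 (norm_nonneg _) (by positivity)
      _ = _ := by rw [div_eq_mul_inv 2]; ring

lemma contourH (A δ σ : ℝ) (hA : 13 < A) (hδ : 0 < δ) (h : ℝ → ℝ) (H : ℂ → ℂ) (hh : IsInHClass A δ h H)
    (hσ0 : 0 < σ) (hσ : σ < 1 / 2) :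
    ∃ C : ℝ, 0 ≤ C ∧ ∀ (F : ℂ → ℂ) (B S : ℝ), 0 ≤ B → (∀ z : ℂ, z.im ≤ 0 → DifferentiableAt ℂ F z) → 
      (∀ z : ℂ, -12 ≤ z.im → z.im ≤ -σ → ‖F z‖ ≤ B * (1 + |z.re|) ^ 20) →
      (∀ z : ℂ, -12 ≤ z.im → z.im ≤ 0 → ‖F z‖ ≤ S) →
      ‖∫ t : ℝ, qF H t * F t‖ ≤ C * B := by
  obtain ⟨C, hC0, h1, h2⟩ := qF_bounds A δ hA hδ h H hh
  refine contour (qF H) σ δ C hσ0 (by linarith) hδ hC0 ?_ h1 h2 (qF_real A δ hA hδ h H hh)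
  intro z hz1 hz2 hz3
  refine qF_diff A δ hA h H hh z (abs_le.mpr ⟨hz1, by linarith⟩) ?_
  rcases hz3 with h | h
  · left
    intro h0
    rw [h0] at h
    norm_num at h
  · right
    exact abs_lt.mpr ⟨by linarith, by linarith⟩

end PSB

open MeasureTheory Real Complex
namespace PSB

noncomputable def Pm (m : ℕ) (z : ℂ) : ℂ := (∏ j ∈ Finset.range m, ((j : ℂ) + 1 + 2 * I * z))⁻¹

lemma Pm_fac (j : ℕ) (z : ℂ) (hz : z.im ≤ 0) : 1 ≤ ‖(j : ℂ) + 1 + 2 * I * z‖ := by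
  have h := Complex.abs_re_le_norm ((j : ℂ) + 1 + 2 * I * z)
  have h2 := le_abs_self ((j : ℂ) + 1 + 2 * I * z).re
  simp at h h2
  have : (0 : ℝ) ≤ j := Nat.cast_nonneg j
  linarith

lemma Pm_prod (m : ℕ) (z : ℂ) (hz : z.im ≤ 0) : 1 ≤ ‖∏ j ∈ Finset.range m, ((j : ℂ) + 1 + 2 * I * z)‖ := by
  rw [norm_prod]
  refine Finset.prod_induction _ (fun x : ℝ => 1 ≤ x) (fun a b ha hb => one_le_mul_of_one_le_of_one_le ha hb) le_rfl ?_
  intro i _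
  exact Pm_fac i z hz

lemma Pm_norm (m : ℕ) (z : ℂ) (hz : z.im ≤ 0) : ‖Pm m z‖ ≤ 1 := by
  unfold Pm
  rw [norm_inv]
  exact inv_le_one_of_one_le₀ (Pm_prod m z hz)

lemma Pm_diff (m : ℕ) (z : ℂ) (hz : z.im ≤ 0) : DifferentiableAt ℂ (Pm m) z := by
  unfold Pm
  refine DifferentiableAt.inv (by fun_prop) ?_
  rw [← norm_pos_iff]
  linarith [Pm_prod m z hz]

/-- one term of the Bessel series -/
lemma bessel_term (m n : ℕ) (hn : 1 ≤ n) (t c : ℝ) (hc : 0 < c) :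
    ((-1) ^ m / ((Nat.factorial m : ℂ) * Complex.Gamma (m + 2 * I * t + 1))) *
      Complex.exp ((2 * m + 2 * I * t) * Real.log ((4 * π * Real.sqrt n / c) / 2)) =
    ((-1) ^ m / (Nat.factorial m : ℂ)) * (Complex.Gamma (1 + 2 * I * t))⁻¹ * 
      (Pm m t * (Complex.exp (2 * (m + I * t) * Real.log (2 * π / c)) * (n : ℂ) ^ ((m : ℂ) + I * t))) := by
  have hn0 : (0 : ℝ) < n := by exact_mod_cast hn
  have hl : Real.log ((4 * π * Real.sqrt n / c) / 2) = Real.log (2 * π / c) + Real.log n / 2 := by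
    have e : (4 * π * Real.sqrt n / c) / 2 = (2 * π / c) * Real.sqrt n := by ring
    have hp := Real.pi_pos
    rw [e, Real.log_mul (by positivity) (by positivity), Real.log_sqrt hn0.le]
  have hnn : (n : ℂ) ≠ 0 := by exact_mod_cast (by omega : n ≠ 0)
  rw [gamma_shift m (2 * I * t) (by simp), hl, Complex.cpow_def_of_ne_zero hnn, ← Complex.natCast_log, ← Complex.exp_add]
  unfold Pm
  have : (2 * (m : ℂ) + 2 * I * t) * ((Real.log (2 * π / c) + Real.log n / 2 : ℝ) : ℂ) = 
    2 * (m + I * t) * (Real.log (2 * π / c) : ℂ) + (Real.log n : ℂ) * (m + I * t) := by push_cast; ring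
  rw [this, div_eq_mul_inv, mul_inv, mul_inv, div_eq_mul_inv]
  ring

noncomputable def termF (H : ℂ → ℂ) (c : ℝ) (n m : ℕ) (t : ℝ) : ℂ :=
  ((-1) ^ m / (Nat.factorial m : ℂ)) * 
    (qF H t * (Pm m t * (Complex.exp (2 * (m + I * t) * Real.log (2 * π / c)) * (n : ℂ) ^ ((m : ℂ) + I * t))))

lemma term_norm (H : ℂ → ℂ) (c : ℝ) (hc : 0 < c) (n m : ℕ) (hn : 1 ≤ n) (t : ℝ) : 
    ‖termF H c n m t‖ ≤ (((2 * π / c) ^ 2 * n) ^ m / (Nat.factorial m)) * ‖qF H t‖ := by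
  unfold termF
  have hn0 : (0 : ℝ) < n := by exact_mod_cast hn
  have hp := Real.pi_pos
  have h0 : 0 < 2 * π / c := by positivity
  have e1 : ‖Complex.exp (2 * (m + I * t) * Real.log (2 * π / c))‖ = ((2 * π / c) ^ 2) ^ m := by
    rw [Complex.norm_exp]
    have : (2 * ((m : ℂ) + I * t) * (Real.log (2 * π / c) : ℂ)).re = Real.log (2 * π / c) * (2 * m : ℕ) := by
      simp; ring
    rw [this, Real.exp_mul, Real.exp_log h0, Real.rpow_natCast, pow_mul]
  have e2 : ‖(n : ℂ) ^ ((m : ℂ) + I * t)‖ = (n : ℝ) ^ m := by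
    rw [Complex.norm_natCast_cpow_of_pos hn]; simp
  rw [norm_mul, norm_mul, norm_mul, norm_mul, e1, e2, norm_div, norm_pow, norm_neg, norm_one, one_pow, Complex.norm_natCast]
  have h1 := Pm_norm m t (by simp)
  rw [mul_pow]
  calc _ ≤ 1 / (Nat.factorial m : ℝ) * (‖qF H t‖ * (1 * (((2 * π / c) ^ 2) ^ m * (n : ℝ) ^ m))) := by gcongr
    _ = _ := by ring

lemma term_int (A δ : ℝ) (hA : 13 < A) (hδ : 0 < δ) (h : ℝ → ℝ) (H : ℂ → ℂ) (hh : IsInHClass A δ h H)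
    (c : ℝ) (hc : 0 < c) (n m : ℕ) (hn : 1 ≤ n) : Integrable (termF H c n m) := by
  have hq := qF_real A δ hA hδ h H hh
  refine (hq.norm.const_mul (((2 * π / c) ^ 2 * n) ^ m / (Nat.factorial m))).mono' ?_ ?_
  · unfold termF
    refine AEStronglyMeasurable.const_mul ?_ _
    refine hq.aestronglyMeasurable.mul ?_
    refine Continuous.aestronglyMeasurable ?_
    have h1 : Continuous (fun t : ℝ => Pm m t) := by
      rw [continuous_iff_continuousAt]
      intro t
      exact ContinuousAt.comp (g := Pm m) (f := fun t : ℝ => (t : ℂ)) (Pm_diff m t (by simp)).continuousAt (by fun_prop)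
    have hnn : (n : ℂ) ≠ 0 := by exact_mod_cast (by omega : n ≠ 0)
    refine h1.mul (Continuous.mul (by fun_prop) ?_)
    exact Continuous.const_cpow (by fun_prop) (Or.inl hnn)
  · filter_upwards with t
    exact term_norm H c hc n m hn t

lemma Hplus_series (A δ : ℝ) (hA : 13 < A) (hδ : 0 < δ) (h : ℝ → ℝ) (H : ℂ → ℂ) (hh : IsInHClass A δ h H)
    (c : ℝ) (hc : 0 < c) (n : ℕ) (hn : 1 ≤ n) :
    HasSum (fun m => (2 * I / π) * ∫ t : ℝ, termF H c n m t) (Hplus h (4 * π * Real.sqrt n / c)) := by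
  have hs : Summable (fun m : ℕ => ∫ t : ℝ, ‖termF H c n m t‖) := by
    have hq := qF_real A δ hA hδ h H hh
    refine Summable.of_nonneg_of_le (fun m => integral_nonneg fun t => norm_nonneg _) (fun m => ?_)
      ((Real.summable_pow_div_factorial ((2 * π / c) ^ 2 * n)).mul_right (∫ t : ℝ, ‖qF H t‖))
    rw [← integral_const_mul]
    exact integral_mono (term_int A δ hA hδ h H hh c hc n m hn).norm (hq.norm.const_mul _) (fun t => term_norm H c hc n m hn t)
  have h1 := hasSum_integral_of_summable_integral_norm (fun m => term_int A δ hA hδ h H hh c hc n m hn) hs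
  have h2 := h1.mul_left (2 * I / π)
  have e : Hplus h (4 * π * Real.sqrt n / c) = (2 * I / π) * ∫ t : ℝ, ∑' m, termF H c n m t := by
    unfold Hplus
    congr 1
    refine integral_congr_ae ?_
    filter_upwards with t
    unfold besselJ
    simp only [bessel_term _ n hn t c hc]
    rw [mul_assoc, mul_comm (∑' m, _), ← mul_assoc, ← tsum_mul_left]
    refine tsum_congr fun m => ?_
    unfold termF qF
    rw [hh.extends_h]
    push_cast
    ring
  rw [e]
  exact h2

lemma hplus_sum (A δ : ℝ) (hA : 13 < A) (hδ : 0 < δ) (h : ℝ → ℝ) (H : ℂ → ℂ) (hh : IsInHClass A δ h H)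
    (c : ℝ) (hc : 0 < c) (Z : ℕ) (β : ℕ → ℂ) :
    HasSum (fun m => ((2 * I / π) * ((-1) ^ m / (Nat.factorial m : ℂ))) * ∫ t : ℝ, qF H t * 
      (Pm m t * (Complex.exp (2 * (m + I * t) * Real.log (2 * π / c)) * ∑ n ∈ Finset.Icc 1 Z, β n * (n : ℂ) ^ ((m : ℂ) + I * t)))) 
      (∑ n ∈ Finset.Icc 1 Z, β n * Hplus h (4 * π * Real.sqrt n / c)) := by
  have h1 : HasSum (fun m => ∑ n ∈ Finset.Icc 1 Z, β n * ((2 * I / π) * ∫ t : ℝ, termF H c n m t)) 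
      (∑ n ∈ Finset.Icc 1 Z, β n * Hplus h (4 * π * Real.sqrt n / c)) := by
    refine hasSum_sum fun n hn => ?_
    exact (Hplus_series A δ hA hδ h H hh c hc n (Finset.mem_Icc.mp hn).1).mul_left (β n)
  convert h1 using 2 with m
  have e : ∀ n ∈ Finset.Icc 1 Z, β n * ((2 * I / π) * ∫ t : ℝ, termF H c n m t) = (2 * I / π) * ∫ t : ℝ, β n * termF H c n m t := by
    intro n hn
    rw [integral_const_mul]; ring
  rw [Finset.sum_congr rfl e, ← Finset.mul_sum, ← integral_finsetSum _ (fun n hn => (term_int A δ hA hδ h H hh c hc n m (Finset.mem_Icc.mp hn).1).const_mul (β n)),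
    mul_assoc, ← integral_const_mul]
  congr 2
  funext t
  unfold termF
  rw [Finset.mul_sum, Finset.mul_sum, Finset.mul_sum, Finset.mul_sum]
  refine Finset.sum_congr rfl fun n hn => ?_
  ring

end PSB

open MeasureTheory Real Complex
namespace PSB

lemma pow_comb (σ K c R a M : ℝ) (hσ0 : 0 < σ) (hσ : σ < 1 / 2) (hK : 1 ≤ K) (hc : 1 ≤ c) (hR0 : 0 ≤ R)
    (hR : R ≤ K * c ^ 2) (ha : σ ≤ a) (haM : a ≤ M) :
    (2 * π / c) ^ (2 * a) * R ^ (max (a - 1 / 2) 0) ≤ (4 * π ^ 2 * K) ^ M * c ^ (-(2 * σ)) := by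
  have hp := Real.pi_gt_three
  have hc0 : 0 < c := by linarith
  set e := max (a - 1 / 2) 0 with he
  have he0 : 0 ≤ e := le_max_right _ _
  have heM : e ≤ M := max_le (by linarith) (by linarith)
  have h1 : R ^ e ≤ K ^ M * c ^ (2 * e) := by
    calc R ^ e ≤ (K * c ^ 2) ^ e := Real.rpow_le_rpow hR0 hR he0
      _ = K ^ e * c ^ (2 * e) := by
        rw [Real.mul_rpow (by linarith) (by positivity), ← Real.rpow_natCast c 2, ← Real.rpow_mul hc0.le]
        norm_num
      _ ≤ _ := mul_le_mul_of_nonneg_right (Real.rpow_le_rpow_of_exponent_le hK heM) (by positivity)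
  have h2 : (2 * π / c) ^ (2 * a) ≤ (4 * π ^ 2) ^ M * c ^ (-(2 * a)) := by
    rw [div_eq_mul_inv, Real.mul_rpow (by positivity) (by positivity), Real.inv_rpow hc0.le, ← Real.rpow_neg hc0.le]
    refine mul_le_mul_of_nonneg_right ?_ (by positivity)
    have e1 : (4 * π ^ 2) = (2 * π) ^ (2 : ℝ) := by norm_num; ring
    rw [e1, ← Real.rpow_mul (by positivity)]
    exact Real.rpow_le_rpow_of_exponent_le (by linarith) (by linarith)
  calc _ ≤ ((4 * π ^ 2) ^ M * c ^ (-(2 * a))) * (K ^ M * c ^ (2 * e)) := 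
        mul_le_mul h2 h1 (by positivity) (by positivity)
    _ = (4 * π ^ 2 * K) ^ M * c ^ (-(2 * a) + 2 * e) := by
        rw [Real.mul_rpow (x := 4 * π ^ 2) (y := K) (by positivity) (by linarith), Real.rpow_add hc0]
        generalize (4 * π ^ 2) ^ M = X
        ring
    _ ≤ _ := by
        refine mul_le_mul_of_nonneg_left (Real.rpow_le_rpow_of_exponent_le hc ?_) (by positivity)
        rcases max_cases (a - 1 / 2) 0 with h | h
        · rw [he, h.1]; linarith
        · rw [he, h.1]; linarith

lemma transfer (A δ σ K : ℝ) (hA : 13 < A) (hδ : 0 < δ) (h : ℝ → ℝ) (H : ℂ → ℂ) (hh : IsInHClass A δ h H)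
    (hσ0 : 0 < σ) (hσ : σ < 1 / 2) (hK : 1 ≤ K) :
    ∃ C : ℝ, 0 ≤ C ∧ ∀ (Z : ℕ) (β : ℕ → ℂ) (c R B : ℝ), 1 ≤ c → 0 ≤ R → R ≤ K * c ^ 2 → 0 ≤ B → 
      (∀ z : ℂ, σ ≤ z.re → ‖∑ n ∈ Finset.Icc 1 Z, β n * (n : ℂ) ^ z‖ ≤ B * (1 + ‖z‖) ^ 20 * R ^ (max (z.re - 1 / 2) 0)) → 
      ‖∑ n ∈ Finset.Icc 1 Z, β n * Hplus h (4 * π * Real.sqrt n / c)‖ ≤ C * (B * c ^ (-(2 * σ))) := by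
  obtain ⟨C, hC0, hC⟩ := contourH A δ σ hA hδ h H hh hσ0 hσ
  have hp := Real.pi_gt_three
  obtain ⟨K1, hK1⟩ : ∃ K1 : ℝ, K1 = 4 * π ^ 2 * K := ⟨_, rfl⟩
  have hK10 : 0 < K1 := by rw [hK1]; positivity
  have hsum : Summable (fun m : ℕ => 1 / (Nat.factorial m : ℝ) * (C * ((m + 13 : ℝ) ^ 20 * K1 ^ (m + 12 : ℝ)))) := by
    have h1 := (Real.summable_pow_div_factorial (Real.exp 1 * K1)).mul_left (C * ((Nat.factorial 20 : ℝ) * Real.exp 13 * K1 ^ 12))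
    refine Summable.of_nonneg_of_le (fun m => by positivity) (fun m => ?_) h1
    have h2 : (m + 13 : ℝ) ^ 20 ≤ (Nat.factorial 20 : ℝ) * Real.exp (m + 13) := by
      have := Real.pow_div_factorial_le_exp (x := (m + 13 : ℝ)) (by positivity) 20
      rw [div_le_iff₀ (by positivity)] at this
      linarith
    have h3 : Real.exp ((m : ℝ) + 13) = Real.exp 1 ^ m * Real.exp 13 := by
      rw [Real.exp_add, ← Real.exp_nat_mul]; ring_nf
    have h4 : K1 ^ (m + 12 : ℝ) = K1 ^ m * K1 ^ 12 := by
      have : (m + 12 : ℝ) = ((m + 12 : ℕ) : ℝ) := by push_cast; rfl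
      rw [this, Real.rpow_natCast, pow_add]
    rw [h3] at h2
    rw [h4, mul_pow]
    generalize (m + 13 : ℝ) ^ 20 = X at *
    generalize (Nat.factorial 20 : ℝ) = Y at *
    generalize K1 ^ 12 = W at *
    have hW : 0 ≤ K1 ^ m * W := by rw [← h4]; positivity
    have h5 : X * (K1 ^ m * W) ≤ Y * (Real.exp 1 ^ m * Real.exp 13) * (K1 ^ m * W) := mul_le_mul_of_nonneg_right h2 hW
    calc _ ≤ 1 / (Nat.factorial m : ℝ) * (C * (Y * (Real.exp 1 ^ m * Real.exp 13) * (K1 ^ m * W))) := by gcongr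
      _ = _ := by ring
  refine ⟨∑' m : ℕ, 1 / (Nat.factorial m : ℝ) * (C * ((m + 13 : ℝ) ^ 20 * K1 ^ (m + 12 : ℝ))), tsum_nonneg fun m => by positivity, ?_⟩
  intro Z β c R B hc hR0 hR hB hD
  have hc0 : 0 < c := by linarith
  have hser := hplus_sum A δ hA hδ h H hh c hc0 Z β
  have hpos : 0 ≤ B * c ^ (-(2 * σ)) := by positivity
  have h2pc : 0 < 2 * π / c := by positivity
  have main : ∀ m : ℕ, ‖((2 * I / π) * ((-1) ^ m / (Nat.factorial m : ℂ))) * ∫ t : ℝ, qF H t * 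
      (Pm m t * (Complex.exp (2 * (m + I * t) * Real.log (2 * π / c)) * ∑ n ∈ Finset.Icc 1 Z, β n * (n : ℂ) ^ ((m : ℂ) + I * t)))‖ ≤ 
      (1 / (Nat.factorial m : ℝ) * (C * ((m + 13 : ℝ) ^ 20 * K1 ^ (m + 12 : ℝ)))) * (B * c ^ (-(2 * σ))) := by
    intro m
    have hm0 : (0 : ℝ) ≤ m := Nat.cast_nonneg m
    have hF := hC (fun z => Pm m z * (Complex.exp (2 * (m + I * z) * Real.log (2 * π / c)) * ∑ n ∈ Finset.Icc 1 Z, β n * (n : ℂ) ^ ((m : ℂ) + I * z)))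
      (((m + 13 : ℝ) ^ 20 * K1 ^ (m + 12 : ℝ)) * (B * c ^ (-(2 * σ))))
      (Real.exp (2 * (m + 12) * |Real.log (2 * π / c)|) * ∑ n ∈ Finset.Icc 1 Z, ‖β n‖ * (n : ℝ) ^ (m + 12 : ℝ)) (by positivity) ?_ ?_ ?_
    · rw [norm_mul]
      have h1 : ‖(2 * I / (π : ℂ)) * ((-1) ^ m / (Nat.factorial m : ℂ))‖ ≤ 1 / (Nat.factorial m : ℝ) := by
        rw [norm_mul, norm_div, norm_div, norm_pow, norm_neg, norm_one, one_pow, Complex.norm_natCast, norm_mul, Complex.norm_I, 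
          Complex.norm_real, Real.norm_of_nonneg (by linarith)]
        refine mul_le_of_le_one_left (by positivity) ?_
        rw [div_le_one (by linarith)]
        norm_num
        linarith
      calc _ ≤ 1 / (Nat.factorial m : ℝ) * (C * (((m + 13 : ℝ) ^ 20 * K1 ^ (m + 12 : ℝ)) * (B * c ^ (-(2 * σ))))) :=
            mul_le_mul h1 hF (norm_nonneg _) (by positivity)
        _ = _ := by 
            generalize (m + 13 : ℝ) ^ 20 = X
            ring
    · intro z hz
      refine (Pm_diff m z hz).mul (DifferentiableAt.mul (by fun_prop) ?_)
      refine DifferentiableAt.fun_sum fun n hn => ?_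
      have hnn : (n : ℂ) ≠ 0 := by have := (Finset.mem_Icc.mp hn).1; exact_mod_cast (by omega : n ≠ 0)
      refine DifferentiableAt.const_mul ?_ _
      exact DifferentiableAt.const_cpow (by fun_prop) (Or.inl hnn)
    · intro z hz1 hz2
      have hP := Pm_norm m z (by linarith)
      set w : ℂ := (m : ℂ) + I * z with hw
      have hwre : w.re = m - z.im := by simp [hw, sub_eq_add_neg]
      have hd := hD w (by rw [hwre]; linarith)
      have he : ‖Complex.exp (2 * w * Real.log (2 * π / c))‖ = (2 * π / c) ^ (2 * w.re) := by
        rw [Complex.norm_exp, Real.rpow_def_of_pos h2pc]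
        congr 1
        simp; ring
      have hcomb := pow_comb σ K c R w.re (m + 12) hσ0 hσ hK hc hR0 hR (by rw [hwre]; linarith) (by rw [hwre]; linarith)
      rw [← hK1] at hcomb
      have hwn : 1 + ‖w‖ ≤ (m + 13) * (1 + |z.re|) := by
        have h1 : ‖w‖ ≤ m + ‖z‖ := by
          refine (norm_add_le _ _).trans ?_
          rw [Complex.norm_natCast, norm_mul, Complex.norm_I, one_mul]
        have h2 := Complex.norm_le_abs_re_add_abs_im z
        have h3 : |z.im| ≤ 12 := abs_le.mpr ⟨hz1, by linarith⟩
        have h4 := abs_nonneg z.re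
        nlinarith
      have hwn20 : (1 + ‖w‖) ^ 20 ≤ (m + 13 : ℝ) ^ 20 * (1 + |z.re|) ^ 20 := by
        rw [← mul_pow]; exact pow_le_pow_left₀ (by positivity) hwn 20
      rw [norm_mul, norm_mul, he]
      have hX : (0 : ℝ) ≤ (1 + ‖w‖) ^ 20 := by positivity
      have hY : (0 : ℝ) ≤ (1 + |z.re|) ^ 20 := by positivity
      have hW : (0 : ℝ) ≤ (m + 13 : ℝ) ^ 20 := by positivity
      generalize (1 + ‖w‖) ^ 20 = X at *
      generalize (1 + |z.re|) ^ 20 = Y at *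
      generalize (m + 13 : ℝ) ^ 20 = W at *
      calc _ ≤ 1 * ((2 * π / c) ^ (2 * w.re) * (B * X * R ^ (max (w.re - 1 / 2) 0))) := by gcongr
        _ = B * X * ((2 * π / c) ^ (2 * w.re) * R ^ (max (w.re - 1 / 2) 0)) := by ring
        _ ≤ B * (W * Y) * (K1 ^ (m + 12 : ℝ) * c ^ (-(2 * σ))) := by gcongr
        _ = _ := by ring
    · intro z hz1 hz2
      have hP := Pm_norm m z (by linarith)
      set w : ℂ := (m : ℂ) + I * z with hw
      have hwre : w.re = m - z.im := by simp [hw, sub_eq_add_neg]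
      have he : ‖Complex.exp (2 * w * Real.log (2 * π / c))‖ ≤ Real.exp (2 * (m + 12) * |Real.log (2 * π / c)|) := by
        rw [Complex.norm_exp]
        refine Real.exp_le_exp.mpr ?_
        have : (2 * w * (Real.log (2 * π / c) : ℂ)).re = 2 * w.re * Real.log (2 * π / c) := by simp
        rw [this]
        have h1 := le_abs_self (Real.log (2 * π / c))
        have h2 := abs_nonneg (Real.log (2 * π / c))
        calc _ ≤ 2 * w.re * |Real.log (2 * π / c)| := mul_le_mul_of_nonneg_left h1 (by rw [hwre]; linarith)
          _ ≤ _ := mul_le_mul_of_nonneg_right (by rw [hwre]; linarith) h2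
      have hs : ‖∑ n ∈ Finset.Icc 1 Z, β n * (n : ℂ) ^ w‖ ≤ ∑ n ∈ Finset.Icc 1 Z, ‖β n‖ * (n : ℝ) ^ (m + 12 : ℝ) := by
        refine norm_sum_le_of_le _ fun n hn => ?_
        have hn1 := (Finset.mem_Icc.mp hn).1
        rw [norm_mul, Complex.norm_natCast_cpow_of_pos hn1]
        refine mul_le_mul_of_nonneg_left (Real.rpow_le_rpow_of_exponent_le (by exact_mod_cast hn1) ?_) (norm_nonneg _)
        rw [hwre]; linarith
      rw [norm_mul, norm_mul]
      calc _ ≤ 1 * (Real.exp (2 * (m + 12) * |Real.log (2 * π / c)|) * ∑ n ∈ Finset.Icc 1 Z, ‖β n‖ * (n : ℝ) ^ (m + 12 : ℝ)) := by gcongr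
        _ = _ := one_mul _
  rw [← hser.tsum_eq, ← tsum_mul_right]
  exact tsum_of_norm_bounded (hsum.mul_right _).hasSum main

end PSB

open MeasureTheory Real Complex
namespace PSB

lemma char_bound (A δ σ : ℝ) (hA : 13 < A) (hδ : 0 < δ) (h : ℝ → ℝ) (H : ℂ → ℂ) (hh : IsInHClass A δ h H)
    (hσ0 : 0 < σ) (hσ : σ < 1 / 2) (V : ℕ → ℝ → ℂ) :
    ∃ C : ℝ, 0 ≤ C ∧ ∀ (N : ℕ), 3 ≤ N → ∀ (d : ℕ) [NeZero d] (c : ℕ), N ≤ c → ∀ B : ℝ, 0 ≤ B → 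
      (∀ s : ℂ, -1 ≤ s.re → ∑ χ ∈ prims d, ‖∑ n ∈ Finset.Icc 1 (N ^ 2), ((ArithmeticFunction.vonMangoldt n : ℝ) : ℂ) * 
        V N (Real.log n / Real.log N) * (χ n * (n : ℂ) ^ s)‖ ≤ B * (1 + ‖s‖) ^ 20 * (4 ^ 10 * (N : ℝ) ^ 2) ^ (max s.re 0)) → 
      ∑ χ ∈ prims d, ‖∑ n ∈ Finset.Icc 1 (N ^ 2), ((ArithmeticFunction.vonMangoldt n : ℝ) : ℂ) * χ (n : ZMod d) /
                    (Real.sqrt n : ℂ) * V N (Real.log n / Real.log N) *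
                  Hplus h (4 * π * Real.sqrt n / c) * (1 / (Real.log N : ℂ))‖ ≤ C * (B * (c : ℝ) ^ (-(2 * σ))) := by
  obtain ⟨C, hC0, hC⟩ := transfer A δ σ (4 ^ 10) hA hδ h H hh hσ0 hσ (by norm_num)
  obtain ⟨W, hW⟩ : ∃ W : ℝ, W = 4 ^ 10 := ⟨_, rfl⟩
  obtain ⟨U, hU⟩ : ∃ U : ℝ, U = 2 ^ 20 := ⟨_, rfl⟩
  have hW0 : 0 < W := by rw [hW]; positivity
  have hU0 : 0 < U := by rw [hU]; positivity
  rw [← hW] at hC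
  refine ⟨C * U, by positivity, ?_⟩
  intro N hN d _ c hNc B hB hyp
  rw [← hW] at hyp
  set Q : DirichletCharacter ℂ d → ℂ := fun χ => ∑ n ∈ Finset.Icc 1 (N ^ 2), ((ArithmeticFunction.vonMangoldt n : ℝ) : ℂ) * χ (n : ZMod d) /
                    (Real.sqrt n : ℂ) * V N (Real.log n / Real.log N) *
                  Hplus h (4 * π * Real.sqrt n / c) * (1 / (Real.log N : ℂ)) with hQ
  have hη : ∀ χ, ∃ η : ℂ, ‖η‖ ≤ 1 ∧ η * Q χ = ‖Q χ‖ := by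
    intro χ
    by_cases h0 : Q χ = 0
    · exact ⟨0, by simp, by simp [h0]⟩
    · have hn : (‖Q χ‖ : ℂ) ≠ 0 := by simpa using h0
      refine ⟨(starRingEnd ℂ) (Q χ) / ‖Q χ‖, ?_, ?_⟩
      · rw [norm_div, Complex.norm_conj, Complex.norm_real, norm_norm]
        exact div_self_le_one _
      · rw [div_mul_eq_mul_div, mul_comm, Complex.mul_conj, Complex.normSq_eq_norm_sq]
        field_simp
        push_cast
        rfl
  choose η hη1 hη2 using hη
  have hN1 : (3 : ℝ) ≤ N := by exact_mod_cast hN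
  have hNc' : (N : ℝ) ≤ c := by exact_mod_cast hNc
  have hlog : 1 ≤ Real.log N := by
    rw [Real.le_log_iff_exp_le (by linarith)]
    linarith [Real.exp_one_lt_d9]
  set β : ℕ → ℂ := fun n => ∑ χ ∈ prims d, η χ * (((ArithmeticFunction.vonMangoldt n : ℝ) : ℂ) * χ (n : ZMod d) /
                    (Real.sqrt n : ℂ) * V N (Real.log n / Real.log N) * (1 / (Real.log N : ℂ))) with hβ
  have e1 : ∑ χ ∈ prims d, (‖Q χ‖ : ℂ) = ∑ n ∈ Finset.Icc 1 (N ^ 2), β n * Hplus h (4 * π * Real.sqrt n / c) := by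
    rw [Finset.sum_congr rfl (fun χ _ => (hη2 χ).symm)]
    simp only [hQ, hβ, Finset.mul_sum, Finset.sum_mul]
    rw [Finset.sum_comm]
    refine Finset.sum_congr rfl fun n _ => Finset.sum_congr rfl fun χ _ => ?_
    ring
  have hb := hC (N ^ 2) β c (W * (N : ℝ) ^ 2) (B * U) (by linarith) (by positivity) (by gcongr) (by positivity) ?_
  · rw [← e1, ← Complex.ofReal_sum, Complex.norm_real, Real.norm_of_nonneg (Finset.sum_nonneg fun _ _ => norm_nonneg _)] at hb
    refine hb.trans (le_of_eq ?_)
    ring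
  · intro z hz
    have e2 : ∑ n ∈ Finset.Icc 1 (N ^ 2), β n * (n : ℂ) ^ z = (1 / (Real.log N : ℂ)) * ∑ χ ∈ prims d, η χ * 
        ∑ n ∈ Finset.Icc 1 (N ^ 2), ((ArithmeticFunction.vonMangoldt n : ℝ) : ℂ) * 
        V N (Real.log n / Real.log N) * (χ n * (n : ℂ) ^ (z - 1 / 2)) := by
      simp only [hβ, Finset.mul_sum, Finset.sum_mul]
      rw [Finset.sum_comm]
      refine Finset.sum_congr rfl fun χ _ => Finset.sum_congr rfl fun n hn => ?_
      have hn1 := (Finset.mem_Icc.mp hn).1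
      have hnn : (n : ℂ) ≠ 0 := by exact_mod_cast (by omega : n ≠ 0)
      have e3 : (Real.sqrt n : ℂ) = (n : ℂ) ^ (1 / 2 : ℂ) := by
        rw [Real.sqrt_eq_rpow, Complex.ofReal_cpow (Nat.cast_nonneg n)]
        push_cast; rfl
      rw [Complex.cpow_sub _ _ hnn, ← e3]
      ring
    rw [e2, norm_mul]
    have h1 : ‖1 / (Real.log N : ℂ)‖ ≤ 1 := by
      rw [norm_div, norm_one, Complex.norm_real, Real.norm_of_nonneg (by linarith), div_le_one (by linarith)]
      exact hlog
    have hre : (z - 1 / 2).re = z.re - 1 / 2 := by simp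
    have h2 := hyp (z - 1 / 2) (by rw [hre]; linarith)
    rw [hre] at h2
    have h3 : (1 + ‖z - 1 / 2‖) ^ 20 ≤ U * (1 + ‖z‖) ^ 20 := by
      rw [hU, ← mul_pow]
      refine pow_le_pow_left₀ (by positivity) ?_ 20
      have := norm_sub_le z (1 / 2)
      have h4 : ‖(1 / 2 : ℂ)‖ = 1 / 2 := by norm_num
      have := norm_nonneg z
      linarith
    set T : DirichletCharacter ℂ d → ℂ := fun χ => ∑ n ∈ Finset.Icc 1 (N ^ 2), ((ArithmeticFunction.vonMangoldt n : ℝ) : ℂ) * 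
        V N (Real.log n / Real.log N) * (χ n * (n : ℂ) ^ (z - 1 / 2)) with hT
    have h5 : ‖∑ χ ∈ prims d, η χ * T χ‖ ≤ ∑ χ ∈ prims d, ‖T χ‖ := by
      refine norm_sum_le_of_le _ fun χ _ => ?_
      rw [norm_mul]
      exact mul_le_of_le_one_left (norm_nonneg _) (hη1 χ)
    refine (mul_le_of_le_one_left (norm_nonneg _) h1).trans (h5.trans (h2.trans ?_))
    · clear_value T
      clear e2 h2 hC hyp h5
      clear_value β Q
      generalize (1 + ‖z - 1 / 2‖) ^ 20 = X at *
      generalize (1 + ‖z‖) ^ 20 = Y at *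
      calc _ ≤ B * (U * Y) * (W * (N : ℝ) ^ 2) ^ (max (z.re - 1 / 2) 0) := by gcongr
        _ = _ := by ring

lemma log_bound (κ : ℝ) (hκ : 0 < κ) : ∃ C : ℝ, 1 ≤ C ∧ ∀ N : ℕ, 3 ≤ N → 1 + Real.log N ≤ C * (N : ℝ) ^ κ := by
  refine ⟨1 + 1 / κ, by simp; exact hκ.le, fun N hN => ?_⟩
  have hN1 : (3 : ℝ) ≤ N := by exact_mod_cast hN
  have h1 := Real.log_le_rpow_div (x := N) (by linarith) hκ
  have h2 : 1 ≤ (N : ℝ) ^ κ := Real.one_le_rpow (by linarith) hκ.le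
  calc _ ≤ (N : ℝ) ^ κ + (N : ℝ) ^ κ / κ := by linarith
    _ = _ := by ring

lemma V_bound (φ : SchwartzMap ℝ ℝ) : ∃ C : ℝ, 0 ≤ C ∧ ∀ ξ : ℝ, ‖fourierHat (fun x => φ x) ξ‖ ≤ C := by
  refine ⟨∫ x, ‖φ x‖, integral_nonneg fun _ => norm_nonneg _, fun ξ => ?_⟩
  unfold fourierHat
  refine (norm_integral_le_integral_norm _).trans (le_of_eq ?_)
  congr 1
  funext x
  rw [norm_mul, Complex.norm_real]
  have : (-2 * (π : ℂ) * I * x * ξ) = ((-2 * π * x * ξ : ℝ) : ℂ) * I := by push_cast; ring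
  rw [this, Complex.norm_exp_ofReal_mul_I, mul_one]

/-- trivial bound for small moduli -/
lemma triv (φ : SchwartzMap ℝ ℝ) (κ : ℝ) (hκ : 0 < κ) :
    ∃ C : ℝ, 0 ≤ C ∧ ∀ (N : ℕ), 3 ≤ N → ∀ (d : ℕ) [NeZero d], ∀ s : ℂ, -1 ≤ s.re →
    ∑ χ ∈ prims d, ‖∑ n ∈ Finset.Icc 1 (N ^ 2), ((ArithmeticFunction.vonMangoldt n : ℝ) : ℂ) * 
        fourierHat (fun x => φ x) (Real.log n / Real.log N) * (χ n * (n : ℂ) ^ s)‖ ≤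
      C * (d * (N : ℝ) ^ (2 + κ)) * (1 + ‖s‖) ^ 20 * (4 ^ 10 * (N : ℝ) ^ 2) ^ (max s.re 0) := by
  obtain ⟨C1, hC1, hV⟩ := V_bound φ
  obtain ⟨C2, hC2, hL⟩ := log_bound κ hκ
  refine ⟨2 * C1 * C2, by positivity, ?_⟩
  intro N hN d _ s hs
  have hN1 : (3 : ℝ) ≤ N := by exact_mod_cast hN
  obtain ⟨W, hW⟩ : ∃ W : ℝ, W = (4 ^ 10 * (N : ℝ) ^ 2) ^ (max s.re 0) := ⟨_, rfl⟩
  rw [← hW]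
  have hW0 : 0 ≤ W := by rw [hW]; positivity
  have hlog0 : 0 ≤ Real.log N := Real.log_nonneg (by linarith)
  have hterm : ∀ χ ∈ prims d, ‖∑ n ∈ Finset.Icc 1 (N ^ 2), ((ArithmeticFunction.vonMangoldt n : ℝ) : ℂ) * 
        fourierHat (fun x => φ x) (Real.log n / Real.log N) * (χ n * (n : ℂ) ^ s)‖ ≤ (N : ℝ) ^ 2 * (2 * Real.log N * C1 * W) := by
    intro χ _
    refine (norm_sum_le _ _).trans ((Finset.sum_le_sum (g := fun _ => 2 * Real.log N * C1 * W) fun n hn => ?_).trans ?_)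
    · have hn1 := (Finset.mem_Icc.mp hn).1
      have hn2 := (Finset.mem_Icc.mp hn).2
      have hn1' : (1 : ℝ) ≤ n := by exact_mod_cast hn1
      have hn2' : (n : ℝ) ≤ (N : ℝ) ^ 2 := by exact_mod_cast hn2
      rw [norm_mul, norm_mul, norm_mul, Complex.norm_real, Real.norm_of_nonneg ArithmeticFunction.vonMangoldt_nonneg,
        Complex.norm_natCast_cpow_of_pos hn1]
      have h1 : ArithmeticFunction.vonMangoldt n ≤ 2 * Real.log N := by
        refine ArithmeticFunction.vonMangoldt_le_log.trans ?_
        have := Real.log_le_log (by linarith) hn2'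
        rwa [Real.log_pow] at this
      have h2 : (n : ℝ) ^ s.re ≤ W := by
        rw [hW]
        calc (n : ℝ) ^ s.re ≤ (n : ℝ) ^ (max s.re 0) := Real.rpow_le_rpow_of_exponent_le hn1' (le_max_left _ _)
          _ ≤ _ := by
            refine Real.rpow_le_rpow (by linarith) ?_ (le_max_right _ _)
            nlinarith
      have h3 := χ.norm_le_one n
      calc _ ≤ 2 * Real.log N * C1 * (1 * W) := by
            have h5 := hV (Real.log n / Real.log N)
            have h6 : 0 ≤ ArithmeticFunction.vonMangoldt n := ArithmeticFunction.vonMangoldt_nonneg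
            gcongr
        _ = _ := by ring
    · simp
  refine (Finset.sum_le_sum hterm).trans ?_
  rw [Finset.sum_const, nsmul_eq_mul]
  have h1 := card_prims_le d
  have h2 := hL N hN
  have h3 : (1 : ℝ) ≤ (1 + ‖s‖) ^ 20 := one_le_pow₀ (by linarith [norm_nonneg s])
  generalize (1 + ‖s‖) ^ 20 = Y at *
  have hN2 : (N : ℝ) ^ (2 + κ) = (N : ℝ) ^ 2 * (N : ℝ) ^ κ := by
    rw [Real.rpow_add (by linarith)]; norm_num
  calc _ ≤ (d : ℝ) * ((N : ℝ) ^ 2 * (2 * (C2 * (N : ℝ) ^ κ) * C1 * W)) := by gcongr; linarith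
    _ = (2 * C1 * C2 * (d * (N : ℝ) ^ (2 + κ))) * 1 * W := by rw [hN2]; ring
    _ ≤ _ := by gcongr

end PSB

open MeasureTheory Real Complex
namespace PSB

lemma sumPrimitive_eq (d : ℕ) [NeZero d] (f : DirichletCharacter ℂ d → ℝ) : sumPrimitive d f = ∑ χ ∈ prims d, f χ := by
  unfold sumPrimitive
  rw [← finsum_mem_coe_finset]
  have : {χ : DirichletCharacter ℂ d | χ.IsPrimitive} = ((prims d : Finset (DirichletCharacter ℂ d)) : Set (DirichletCharacter ℂ d)) := by
    ext χ
    rw [Finset.mem_coe, mem_prims]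
    rfl
  rw [this]

lemma per_d (ε κ : ℝ) (hε : 0 < ε) (hε2 : ε ≤ 15 / 8) (hκ : 0 < κ) (hκ2 : κ < 1 / 2) (A δ : ℝ) (hA : 13 < A) (hδ : 0 < δ)
    (h : ℝ → ℝ) (H : ℂ → ℂ) (hh : IsInHClass A δ h H)
    (φ : SchwartzMap ℝ ℝ) (hsupp : ∀ ξ : ℝ, 15 / 8 - ε ≤ ξ → fourierHat (fun x => φ x) ξ = 0) :
    ∃ C : ℝ, 0 ≤ C ∧ ∀ N : ℕ, 3 ≤ N → N.Prime → ∀ c : ℕ, 0 < c → c < N ^ 2 → N ∣ c → ∀ d : ℕ, d ∣ c →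
      (d : ℝ) * sumPrimitive d (fun χ =>
              ‖∑' n : ℕ, ((ArithmeticFunction.vonMangoldt n : ℝ) : ℂ) * χ (n : ZMod d) /
                    (Real.sqrt n : ℂ) * fourierHat (fun x => φ x) (Real.log n / Real.log N) *
                  Hplus h (4 * π * Real.sqrt n / c) * (1 / (Real.log N : ℂ))‖) ≤ 
        C * ((c : ℝ) ^ 2 * (N : ℝ) ^ (1 - ε / 2 + κ) * (c : ℝ) ^ (-(2 * (1 / 2 - κ)))) := by
  obtain ⟨C0, hC0, hcb⟩ := char_bound A δ (1 / 2 - κ) hA hδ h H hh (by linarith) (by linarith) (fun _ ξ => fourierHat (fun x => φ x) ξ)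
  obtain ⟨C1, hC1, hcore⟩ := core φ ε κ hε hε2 hκ hsupp
  obtain ⟨C2, hC2, htriv⟩ := triv φ κ hκ
  refine ⟨C0 * (C1 + C2), by positivity, ?_⟩
  intro N hN hp c hc0 hc hNc d hd
  have hd0 : 0 < d := Nat.pos_of_dvd_of_pos hd hc0
  haveI : NeZero d := ⟨hd0.ne'⟩
  have hN1 : (3 : ℝ) ≤ N := by exact_mod_cast hN
  have hlogN : 0 < Real.log N := Real.log_pos (by linarith)
  rw [sumPrimitive_eq]
  have hts : ∀ χ : DirichletCharacter ℂ d, ∑' n : ℕ, ((ArithmeticFunction.vonMangoldt n : ℝ) : ℂ) * χ (n : ZMod d) /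
                    (Real.sqrt n : ℂ) * fourierHat (fun x => φ x) (Real.log n / Real.log N) *
                  Hplus h (4 * π * Real.sqrt n / c) * (1 / (Real.log N : ℂ)) = 
      ∑ n ∈ Finset.Icc 1 (N ^ 2), ((ArithmeticFunction.vonMangoldt n : ℝ) : ℂ) * χ (n : ZMod d) /
                    (Real.sqrt n : ℂ) * fourierHat (fun x => φ x) (Real.log n / Real.log N) *
                  Hplus h (4 * π * Real.sqrt n / c) * (1 / (Real.log N : ℂ)) := by
    intro χ
    refine tsum_eq_sum fun n hn => ?_
    rw [Finset.mem_Icc, not_and_or] at hn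
    rcases hn with hn | hn
    · have : n = 0 := by omega
      subst this
      simp
    · push Not at hn
      have h1 : (N : ℝ) ^ 2 ≤ n := by exact_mod_cast hn.le
      have h2 := Real.log_le_log (by positivity) h1
      rw [Real.log_pow] at h2
      have h3 : 15 / 8 - ε ≤ Real.log n / Real.log N := by
        rw [le_div_iff₀ hlogN]
        push_cast at h2
        nlinarith
      rw [hsupp _ h3]
      simp
  rw [Finset.sum_congr rfl (fun χ _ => by rw [hts χ])]
  have hNlec : N ≤ c := Nat.le_of_dvd hc0 hNc
  have hdc : d ≤ c := Nat.le_of_dvd hc0 hd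
  have hdc' : (d : ℝ) ≤ c := by exact_mod_cast hdc
  have hY : 0 ≤ (c : ℝ) ^ (-(2 * (1 / 2 - κ))) := by positivity
  have hE : 0 ≤ (N : ℝ) ^ (1 - ε / 2 + κ) := by positivity
  by_cases hNd : N ∣ d
  · have hNled : N ≤ d := Nat.le_of_dvd hd0 hNd
    have hb := hcb N hN d c hNlec (C1 * (d * (N : ℝ) ^ (1 - ε / 2 + κ))) (by positivity) (fun s hs => hcore N hN d hNled (hdc.trans hc.le) s hs)
    calc _ ≤ (d : ℝ) * (C0 * (C1 * (d * (N : ℝ) ^ (1 - ε / 2 + κ)) * (c : ℝ) ^ (-(2 * (1 / 2 - κ))))) := by gcongr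
      _ = C0 * C1 * (((d : ℝ) ^ 2 * (N : ℝ) ^ (1 - ε / 2 + κ)) * (c : ℝ) ^ (-(2 * (1 / 2 - κ)))) := by ring
      _ ≤ C0 * (C1 + C2) * (((c : ℝ) ^ 2 * (N : ℝ) ^ (1 - ε / 2 + κ)) * (c : ℝ) ^ (-(2 * (1 / 2 - κ)))) := by
        gcongr; linarith
  · have hcop : Nat.Coprime N d := (Nat.Prime.coprime_iff_not_dvd hp).mpr hNd
    have hdN : N * d ≤ c := Nat.le_of_dvd hc0 (hcop.mul_dvd_of_dvd_of_dvd hNc hd)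
    have hdN' : (N : ℝ) * d ≤ c := by exact_mod_cast hdN
    have hb := hcb N hN d c hNlec (C2 * (d * (N : ℝ) ^ (2 + κ))) (by positivity) (fun s hs => htriv N hN d s hs)
    have hN2 : (N : ℝ) ^ (2 + κ) = (N : ℝ) ^ 2 * (N : ℝ) ^ κ := by
      rw [Real.rpow_add (by linarith)]; norm_num
    have hle : (N : ℝ) ^ κ ≤ (N : ℝ) ^ (1 - ε / 2 + κ) := Real.rpow_le_rpow_of_exponent_le (by linarith) (by linarith)
    calc _ ≤ (d : ℝ) * (C0 * (C2 * (d * (N : ℝ) ^ (2 + κ)) * (c : ℝ) ^ (-(2 * (1 / 2 - κ))))) := by gcongr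
      _ = C0 * C2 * ((((N : ℝ) * d) ^ 2 * (N : ℝ) ^ κ) * (c : ℝ) ^ (-(2 * (1 / 2 - κ)))) := by rw [hN2]; ring
      _ ≤ C0 * (C1 + C2) * (((c : ℝ) ^ 2 * (N : ℝ) ^ (1 - ε / 2 + κ)) * (c : ℝ) ^ (-(2 * (1 / 2 - κ)))) := by
        gcongr; linarith

lemma tot_bound (c : ℕ) : (c : ℝ) ≤ c.divisors.card * c.totient := by
  have h : ∑ d ∈ c.divisors, d.totient ≤ ∑ _d ∈ c.divisors, c.totient := by
    refine Finset.sum_le_sum fun d hd => ?_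
    have h1 := Nat.mem_divisors.mp hd
    exact Nat.le_of_dvd (Nat.totient_pos.mpr (Nat.pos_of_ne_zero h1.2)) (Nat.totient_dvd_of_dvd h1.1)
  rw [Nat.sum_totient, Finset.sum_const, smul_eq_mul] at h
  exact_mod_cast h

lemma sum_inv (N : ℕ) (hN : 3 ≤ N) : ∑ c ∈ (Finset.Ioo 0 (N ^ 2)).filter (fun c => N ∣ c), (c : ℝ)⁻¹ ≤ (N : ℝ)⁻¹ * (1 + Real.log N) := by
  have hsub : (Finset.Ioo 0 (N ^ 2)).filter (fun c => N ∣ c) ⊆ (Finset.range N).image (fun k => N * (k + 1)) := by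
    intro c hc
    rw [Finset.mem_filter, Finset.mem_Ioo] at hc
    obtain ⟨⟨h1, h2⟩, k, rfl⟩ := hc
    rw [Finset.mem_image]
    have hk : k ≠ 0 := by rintro rfl; simp at h1
    refine ⟨k - 1, ?_, ?_⟩
    · rw [Finset.mem_range]
      have : k < N := by nlinarith
      omega
    · congr 1; omega
  refine (Finset.sum_le_sum_of_subset_of_nonneg hsub fun _ _ _ => by positivity).trans ?_
  rw [Finset.sum_image (by
    intro a _ b _ hab
    have : N * (a + 1) = N * (b + 1) := hab
    have := Nat.eq_of_mul_eq_mul_left (by omega) this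
    omega)]
  have h1 := harmonic_le_one_add_log N
  unfold harmonic at h1
  push_cast at h1
  have h2 : ∑ k ∈ Finset.range N, (((N * (k + 1) : ℕ) : ℝ))⁻¹ = (N : ℝ)⁻¹ * ∑ k ∈ Finset.range N, ((k : ℝ) + 1)⁻¹ := by
    rw [Finset.mul_sum]
    refine Finset.sum_congr rfl fun k _ => ?_
    push_cast
    rw [mul_inv]
  rw [h2]
  exact mul_le_mul_of_nonneg_left h1 (by positivity)

lemma final (ε : ℝ) (hε : 0 < ε) (hε2 : ε ≤ 15 / 8) (A δ : ℝ) (hA : 13 < A) (hδ : 0 < δ)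
    (h : ℝ → ℝ) (H : ℂ → ℂ) (hh : IsInHClass A δ h H)
    (φ : SchwartzMap ℝ ℝ) (hsupp : ∀ ξ : ℝ, 15 / 8 - ε ≤ ξ → fourierHat (fun x => φ x) ξ = 0) :
    ∃ C : ℝ, ∀ N : ℕ, 3 ≤ N → N.Prime →
      (∑ c ∈ (Finset.Ioo 0 (N ^ 2)).filter (fun c => N ∣ c),
        (1 / ((c : ℝ) * (Nat.totient c : ℝ))) *
          ∑ d ∈ c.divisors.filter (· ≠ 1), (d : ℝ) *
            sumPrimitive d (fun χ =>
              ‖∑' n : ℕ, ((ArithmeticFunction.vonMangoldt n : ℝ) : ℂ) * χ (n : ZMod d) /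
                    (Real.sqrt n : ℂ) * fourierHat (fun x => φ x) (Real.log n / Real.log N) *
                  Hplus h (4 * π * Real.sqrt n / c) * (1 / (Real.log N : ℂ))‖))
        ≤ C * (N : ℝ) ^ (-(ε / 10)) := by
  obtain ⟨κ, hκ⟩ : ∃ κ : ℝ, κ = ε / 25 := ⟨_, rfl⟩
  have hκ0 : 0 < κ := by rw [hκ]; positivity
  obtain ⟨C, hC0, hC⟩ := per_d ε κ hε hε2 hκ0 (by rw [hκ]; linarith) A δ hA hδ h H hh φ hsupp
  obtain ⟨Cd, hCd1, hCd⟩ := divisor_bound κ hκ0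
  obtain ⟨CL, hCL1, hCL⟩ := log_bound κ hκ0
  refine ⟨C * Cd ^ 2 * CL, ?_⟩
  intro N hN hp
  have hN1 : (3 : ℝ) ≤ N := by exact_mod_cast hN
  have hN0 : (0 : ℝ) < N := by linarith
  set E := (N : ℝ) ^ (1 - ε / 2 + κ) with hE
  have hE0 : 0 ≤ E := by rw [hE]; positivity
  have hc : ∀ c ∈ (Finset.Ioo 0 (N ^ 2)).filter (fun c => N ∣ c), (1 / ((c : ℝ) * (Nat.totient c : ℝ))) *
          ∑ d ∈ c.divisors.filter (· ≠ 1), (d : ℝ) *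
            sumPrimitive d (fun χ =>
              ‖∑' n : ℕ, ((ArithmeticFunction.vonMangoldt n : ℝ) : ℂ) * χ (n : ZMod d) /
                    (Real.sqrt n : ℂ) * fourierHat (fun x => φ x) (Real.log n / Real.log N) *
                  Hplus h (4 * π * Real.sqrt n / c) * (1 / (Real.log N : ℂ))‖) ≤ (C * Cd ^ 2 * E * (N : ℝ) ^ (8 * κ)) * (c : ℝ)⁻¹ := by
    intro c hc
    rw [Finset.mem_filter, Finset.mem_Ioo] at hc
    obtain ⟨⟨hc0, hcN⟩, hNc⟩ := hc
    have hc0' : (0 : ℝ) < c := by exact_mod_cast hc0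
    have hc1' : (1 : ℝ) ≤ c := by exact_mod_cast hc0
    have hcN' : (c : ℝ) ≤ (N : ℝ) ^ 2 := by exact_mod_cast hcN.le
    have hφ : (0 : ℝ) < Nat.totient c := by exact_mod_cast Nat.totient_pos.mpr hc0
    set Y := (c : ℝ) ^ (-(2 * (1 / 2 - κ))) with hY
    have hY0 : 0 ≤ Y := by rw [hY]; positivity
    have h1 : ∑ d ∈ c.divisors.filter (· ≠ 1), (d : ℝ) *
            sumPrimitive d (fun χ =>
              ‖∑' n : ℕ, ((ArithmeticFunction.vonMangoldt n : ℝ) : ℂ) * χ (n : ZMod d) /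
                    (Real.sqrt n : ℂ) * fourierHat (fun x => φ x) (Real.log n / Real.log N) *
                  Hplus h (4 * π * Real.sqrt n / c) * (1 / (Real.log N : ℂ))‖) ≤ c.divisors.card * (C * ((c : ℝ) ^ 2 * E * Y)) := by
      refine (Finset.sum_le_sum (g := fun _ => C * ((c : ℝ) ^ 2 * E * Y)) fun d hd => ?_).trans ?_
      · exact hC N hN hp c hc0 hcN hNc d (Nat.mem_divisors.mp (Finset.mem_filter.mp hd).1).1
      · rw [Finset.sum_const, nsmul_eq_mul]
        refine mul_le_mul_of_nonneg_right ?_ (by positivity)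
        exact_mod_cast Finset.card_filter_le _ _
    have h2 := tot_bound c
    have h3 := hCd c hc0.ne'
    set τ : ℝ := (c.divisors.card : ℝ) with hτ
    have hτ0 : 0 ≤ τ := Nat.cast_nonneg _
    have h4 : 1 / ((c : ℝ) * (Nat.totient c : ℝ)) ≤ τ / (c : ℝ) ^ 2 := by
      rw [div_le_div_iff₀ (by positivity) (by positivity)]
      nlinarith
    have h5 : Y = (c : ℝ) ^ (2 * κ) * (c : ℝ)⁻¹ := by
      rw [hY, ← Real.rpow_neg_one (c : ℝ), ← Real.rpow_add hc0']
      ring_nf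
    have h6 : τ ^ 2 ≤ Cd ^ 2 * (c : ℝ) ^ (2 * κ) := by
      calc τ ^ 2 ≤ (Cd * (c : ℝ) ^ κ) ^ 2 := pow_le_pow_left₀ hτ0 h3 2
        _ = Cd ^ 2 * ((c : ℝ) ^ κ * (c : ℝ) ^ κ) := by ring
        _ = _ := by rw [← Real.rpow_add hc0']; ring_nf
    have h7 : (c : ℝ) ^ (2 * κ) * (c : ℝ) ^ (2 * κ) ≤ (N : ℝ) ^ (8 * κ) := by
      rw [← Real.rpow_add hc0']
      calc _ ≤ ((N : ℝ) ^ 2) ^ (2 * κ + 2 * κ) := Real.rpow_le_rpow hc0'.le hcN' (by positivity)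
        _ = _ := by
          rw [← Real.rpow_natCast, ← Real.rpow_mul hN0.le]
          push_cast; ring_nf
    calc _ ≤ τ / (c : ℝ) ^ 2 * (τ * (C * ((c : ℝ) ^ 2 * E * Y))) := 
          mul_le_mul h4 h1 (Finset.sum_nonneg fun d _ => mul_nonneg (Nat.cast_nonneg _) (by 
            unfold sumPrimitive
            exact finsum_nonneg fun _ => finsum_nonneg fun _ => norm_nonneg _)) (by positivity)
      _ = C * E * Y * τ ^ 2 := by field_simp
      _ ≤ C * E * Y * (Cd ^ 2 * (c : ℝ) ^ (2 * κ)) := by gcongr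
      _ = C * Cd ^ 2 * E * ((c : ℝ) ^ (2 * κ) * (c : ℝ) ^ (2 * κ)) * (c : ℝ)⁻¹ := by rw [h5]; ring
      _ ≤ _ := by gcongr
  refine (Finset.sum_le_sum hc).trans ?_
  rw [← Finset.mul_sum]
  have h1 := sum_inv N hN
  have h2 := hCL N hN
  calc _ ≤ C * Cd ^ 2 * E * (N : ℝ) ^ (8 * κ) * ((N : ℝ)⁻¹ * (CL * (N : ℝ) ^ κ)) := by
        refine mul_le_mul_of_nonneg_left (h1.trans ?_) (by positivity)
        gcongr
    _ = C * Cd ^ 2 * CL * (E * (N : ℝ) ^ (8 * κ) * (N : ℝ) ^ (-1 : ℝ) * (N : ℝ) ^ κ) := by rw [Real.rpow_neg_one]; ring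
    _ = _ := by
      rw [hE, ← Real.rpow_add hN0, ← Real.rpow_add hN0, ← Real.rpow_add hN0]
      congr 2
      rw [hκ]; ring

end PSB

/-- The main prime-sum bound: for `h ∈ 𝓗(A,δ)` and `φ` an even Schwartz function with
`supp φ̂ ⊂ (-15/8+ε, 15/8-ε)`, the weighted sum over `c ≡ 0 (mod N)`, `c < N²`, of sums over
primitive characters of the von Mangoldt Dirichlet polynomials twisted by `φ̂` and `H⁺` is
`≪ N^{-ε/10}`. -/
theorem prime_sum_bound (ε : ℝ) (hε : 0 < ε) (A δ : ℝ) (hA : 13 < A) (hδ : 0 < δ)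
    (h : ℝ → ℝ) (H : ℂ → ℂ) (hh : IsInHClass A δ h H)
    (φ : SchwartzMap ℝ ℝ) (heven : ∀ x : ℝ, φ (-x) = φ x)
    (hsupp : Function.support (fourierHat (fun x => φ x)) ⊆
      Set.Ioo (-(15 / 8) + ε) (15 / 8 - ε)) :
    ∃ C : ℝ, ∀ N : ℕ, N.Prime →
      (∑ c ∈ (Finset.Ioo 0 (N ^ 2)).filter (fun c => N ∣ c),
        (1 / ((c : ℝ) * (Nat.totient c : ℝ))) *
          ∑ d ∈ c.divisors.filter (· ≠ 1), (d : ℝ) *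
            sumPrimitive d (fun χ =>
              ‖∑' n : ℕ, ((ArithmeticFunction.vonMangoldt n : ℝ) : ℂ) * χ (n : ZMod d) /
                    (Real.sqrt n : ℂ) * fourierHat (fun x => φ x) (Real.log n / Real.log N) *
                  Hplus h (4 * π * Real.sqrt n / c) * (1 / (Real.log N : ℂ))‖))
        ≤ C * (N : ℝ) ^ (-(ε / 10)) := by
  by_cases hε2 : ε ≤ 15 / 8
  · have hs : ∀ ξ : ℝ, 15 / 8 - ε ≤ ξ → fourierHat (fun x => φ x) ξ = 0 := by
      intro ξ hξ
      by_contra h0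
      have := hsupp (Function.mem_support.mpr h0)
      linarith [this.2]
    obtain ⟨C, hC⟩ := PSB.final ε hε hε2 A δ hA hδ h H hh φ hs
    obtain ⟨L, hL⟩ : ∃ L : ℕ → ℝ, ∀ N, L N = (∑ c ∈ (Finset.Ioo 0 (N ^ 2)).filter (fun c => N ∣ c),
        (1 / ((c : ℝ) * (Nat.totient c : ℝ))) *
          ∑ d ∈ c.divisors.filter (· ≠ 1), (d : ℝ) *
            sumPrimitive d (fun χ =>
              ‖∑' n : ℕ, ((ArithmeticFunction.vonMangoldt n : ℝ) : ℂ) * χ (n : ZMod d) /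
                    (Real.sqrt n : ℂ) * fourierHat (fun x => φ x) (Real.log n / Real.log N) *
                  Hplus h (4 * π * Real.sqrt n / c) * (1 / (Real.log N : ℂ))‖)) := ⟨_, fun _ => rfl⟩
    simp only [← hL] at hC ⊢
    refine ⟨max C (L 2 / (2 : ℝ) ^ (-(ε / 10))), fun N hN => ?_⟩
    rcases Nat.lt_or_ge N 3 with h3 | h3
    · have : N = 2 := by have := hN.two_le; omega
      subst this
      have hp : (0 : ℝ) < (2 : ℝ) ^ (-(ε / 10)) := by positivity
      calc L 2 = (L 2 / (2 : ℝ) ^ (-(ε / 10))) * (2 : ℝ) ^ (-(ε / 10)) := by field_simp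
        _ ≤ _ := by
          push_cast
          exact mul_le_mul_of_nonneg_right (le_max_right _ _) hp.le
    · exact (hC N h3 hN).trans (mul_le_mul_of_nonneg_right (le_max_left _ _) (by positivity))
  · have hz : ∀ ξ : ℝ, fourierHat (fun x => φ x) ξ = 0 := by
      intro ξ
      by_contra h0
      have := hsupp (Function.mem_support.mpr h0)
      linarith [this.1, this.2]
    refine ⟨0, fun N hN => ?_⟩
    simp [hz, sumPrimitive]
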